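/- Multi-parameter analogue of (0.6): There is a constant C depending only on N₁,…,Nₙ such that E_ω ‖S_{D(ω)} f‖_{L¹(X)} ≤ C ‖f‖_{H¹(X₁×…×Xₙ)} for all f ∈ H¹(X₁×…×Xₙ), where S_{D(ω)} is the multi-parameter random dyadic square function. -/

import Mathlib

open MeasureTheory Filter Topology
open scoped ENNReal

noncomputable section

namespace Treil

/-- The cube of sidelength `2^k` of the dyadic lattice `t + 𝒟₀` that contains `x`. -/
def dcube {N : ℕ} (t : Fin N → ℝ) (k : ℤ) (x : Fin N → ℝ) : Set (Fin N → ℝ) :=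
  {y | ∀ i, ⌊(y i - t i) / (2 : ℝ) ^ k⌋ = ⌊(x i - t i) / (2 : ℝ) ^ k⌋}

/-- The averaging operator `E_k` over the cubes of sidelength `2^k` of the (generalized)
dyadic lattice whose layer at scale `2^k` has offset `c k`. -/
def avg {N : ℕ} (c : ℤ → Fin N → ℝ) (k : ℤ) (f : (Fin N → ℝ) → ℝ) (x : Fin N → ℝ) : ℝ :=
  (∫ y in dcube (c k) k x, f y) / ((2 : ℝ) ^ k) ^ (N : ℕ)

/-- The martingale difference `Δ_k = E_{k-1} - E_k`. -/
def mdiff {N : ℕ} (c : ℤ → Fin N → ℝ) (k : ℤ) (f : (Fin N → ℝ) → ℝ) (x : Fin N → ℝ) : ℝ :=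
  avg c (k - 1) f x - avg c k f x

/-- The square of the dyadic square function, `|S_𝒟 f (x)|² = ∑_k |Δ_k f (x)|²`,
with values in `[0,∞]`. -/
def Ssq {N : ℕ} (c : ℤ → Fin N → ℝ) (f : (Fin N → ℝ) → ℝ) (x : Fin N → ℝ) : ℝ≥0∞ :=
  ∑' k : ℤ, ENNReal.ofReal ((mdiff c k f x) ^ 2)

/-- The offset (at scale `2^k`) of the random dyadic lattice on `ℝ` built from the uniform
shift `u ∈ [0,1)` and the fair signs `ξ_j`, `j ≥ 1`, encoded as the binary digits of
`v ∈ [0,1)` (`ξ_j = -1` iff `⌊v 2^j⌋` is odd); the interval `I_0 = [u-1, u)` belongs to the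
lattice, and `I_k` is obtained from `I_{k-1}` by adjoining the right neighbour if `ξ_k = +1`
and the left neighbour if `ξ_k = -1`. -/
def randOffset1 (u v : ℝ) (k : ℤ) : ℝ :=
  u - 1 - ∑ j ∈ Finset.range k.toNat, (if ⌊v * 2 ^ (j + 1)⌋ % 2 = 1 then (2 : ℝ) ^ j else 0)

/-- The sample space for the random dyadic lattice in `ℝ^N`: each of the `N` independent
coordinate lattices is driven by a pair (uniform shift, digit-encoded fair signs). -/
abbrev RSpace (N : ℕ) := Fin N → ℝ × ℝ

/-- The probability measure of the random dyadic lattice in `ℝ^N`. -/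
def randMeasure (N : ℕ) : Measure (RSpace N) :=
  Measure.pi fun _ =>
    (volume.restrict (Set.Ico (0 : ℝ) 1)).prod (volume.restrict (Set.Ico (0 : ℝ) 1))

/-- The per-scale offsets of the random dyadic lattice `𝒟(ω)` in `ℝ^N`. -/
def randOffset {N : ℕ} (ω : RSpace N) (k : ℤ) : Fin N → ℝ :=
  fun i => randOffset1 (ω i).1 (ω i).2 k

/-- An (axis-parallel, half-open) cube in `ℝ^N`. -/
def IsPCube {N : ℕ} (Q : Set (Fin N → ℝ)) : Prop :=
  ∃ (a : Fin N → ℝ) (l : ℝ), 0 < l ∧ Q = Set.univ.pi fun i => Set.Ico (a i) (a i + l)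

/-- An `H¹`-atom: supported in a cube `Q`, bounded by `|Q|⁻¹`, with zero mean. -/
def IsAtom {N : ℕ} (a : (Fin N → ℝ) → ℝ) : Prop :=
  ∃ Q : Set (Fin N → ℝ), IsPCube Q ∧ (∀ x, x ∉ Q → a x = 0) ∧
    (∀ x, |a x| ≤ ((volume Q).toReal)⁻¹) ∧ (∫ x, a x) = 0

/-- The atomic `H¹(ℝ^N)` norm: the infimum of `∑ |λ_j|` over all decompositions
`f = ∑ λ_j a_j` converging in `L¹`, with atoms `a_j`. -/
def H1norm {N : ℕ} (f : (Fin N → ℝ) → ℝ) : ℝ≥0∞ :=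
  ⨅ (lam : ℕ → ℝ) (a : ℕ → (Fin N → ℝ) → ℝ) (_ : ∀ j, IsAtom (a j))
    (_ : Tendsto (fun m => ∫ x, |f x - ∑ j ∈ Finset.range m, lam j * a j x|) atTop (𝓝 0)),
    ∑' j, ENNReal.ofReal |lam j|
/-! ### Multi-parameter setting: `X = X₁ × ⋯ × Xₙ`, `X_j = ℝ^{N_j}` -/

variable (n : ℕ) (Nd : Fin n → ℕ)

/-- The product space `X = X₁ × X₂ × ⋯ × Xₙ`, `X_j = ℝ^{N_j}`. -/
abbrev X := Π j : Fin n, (Fin (Nd j) → ℝ)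

/-- The averaging operator `E_𝐤 = E¹_{k₁} ⋯ Eⁿ_{kₙ}` over the "rectangles"
`R = Q₁ × ⋯ × Qₙ` of the product lattice with per-variable, per-scale offsets `c`. -/
def ravg (c : Π j : Fin n, ℤ → Fin (Nd j) → ℝ) (k : Fin n → ℤ) (f : X n Nd → ℝ)
    (x : X n Nd) : ℝ :=
  (∫ y in Set.univ.pi fun j => dcube (c j (k j)) (k j) (x j), f y) /
    ∏ j, ((2 : ℝ) ^ (k j)) ^ (Nd j : ℕ)

/-- The multi-parameter martingale difference
`Δ_𝐤 = Δ¹_{k₁} ⋯ Δⁿ_{kₙ} = ∏_j (E^j_{k_j - 1} - E^j_{k_j})`, expanded by multilinearity. -/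
def rmdiff (c : Π j : Fin n, ℤ → Fin (Nd j) → ℝ) (k : Fin n → ℤ) (f : X n Nd → ℝ)
    (x : X n Nd) : ℝ :=
  ∑ ε : Fin n → Bool,
    (-1 : ℝ) ^ (Finset.univ.filter fun j => ε j = false).card *
      ravg n Nd c (fun j => k j - if ε j then 1 else 0) f x

/-- The square of the multi-parameter dyadic square function,
`|S_𝒟 f (x)|² = ∑_{R ∋ x} |Δ_R f (x)|² = ∑_{𝐤 ∈ ℤⁿ} |Δ_𝐤 f (x)|²`. -/
def rSsq (c : Π j : Fin n, ℤ → Fin (Nd j) → ℝ) (f : X n Nd → ℝ) (x : X n Nd) : ℝ≥0∞ :=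
  ∑' k : Fin n → ℤ, ENNReal.ofReal ((rmdiff n Nd c k f x) ^ 2)

/-- The sample space of the random product dyadic lattice
`𝒟(ω) = 𝒟₁(ω) × ⋯ × 𝒟ₙ(ω)`. -/
abbrev PSpace := Π j : Fin n, RSpace (Nd j)

instance randMeasure.instSigmaFinite (M : ℕ) : SigmaFinite (randMeasure M) := by
  unfold randMeasure; infer_instance

/-- The probability measure of the random product dyadic lattice (the `n` factors are
independent). -/
def prodRandMeasure : Measure (PSpace n Nd) := Measure.pi fun j => randMeasure (Nd j)

/-- The quantity `∫_X [𝔼_ω |S_{𝒟(ω)} f (x)|²]^{1/2} dx` for the multi-parameter random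
dyadic square function. -/
def randProdSNorm (f : X n Nd → ℝ) : ℝ≥0∞ :=
  ∫⁻ x, (∫⁻ ω, rSsq n Nd (fun j => randOffset (ω j)) f x ∂prodRandMeasure n Nd) ^ (1 / 2 : ℝ)

/-! ### The product (Chang–Fefferman) Hardy space `H¹(X₁ × ⋯ × Xₙ)` -/

/-- The upper half-space variables `((y₁,t₁),…,(yₙ,tₙ))`. -/
abbrev W := Π j : Fin n, ((Fin (Nd j) → ℝ) × ℝ)

/-- The Poisson kernel of the upper half-space `ℝ^{M+1}_+`. -/
def pk (M : ℕ) (y : Fin M → ℝ) (t : ℝ) : ℝ :=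
  (Real.Gamma (((M : ℝ) + 1) / 2) / Real.pi ^ (((M : ℝ) + 1) / 2)) * t /
    ((∑ i, y i ^ 2) + t ^ 2) ^ (((M : ℝ) + 1) / 2)

/-- The extension of `f` to `ℝ^{N₁+1}_+ × ⋯ × ℝ^{Nₙ+1}_+` obtained by applying the Poisson
(harmonic) extension in each variable. -/
def prodPoisson (f : X n Nd → ℝ) (p : W n Nd) : ℝ :=
  ∫ z, f z * ∏ j, pk (Nd j) ((p j).1 - z j) (p j).2

/-- The coordinate direction `i` in the `j`-th half-space factor (`i = N_j` is the
`t_j`-direction). -/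
def dirW (j : Fin n) (i : Fin (Nd j + 1)) : W n Nd :=
  Pi.single j (if h : (i : ℕ) < Nd j then (Pi.single (⟨i, h⟩ : Fin (Nd j)) 1, 0) else (0, 1))

/-- `|∇₁ ∇₂ ⋯ ∇ₙ u (p)|²`: the sum over all choices of one coordinate direction in each
half-space factor of the square of the corresponding mixed partial derivative. -/
def mixedGradSq (u : W n Nd → ℝ) (p : W n Nd) : ℝ :=
  ∑ d : Π j : Fin n, Fin (Nd j + 1),
    (iteratedFDeriv ℝ n u p fun j => dirW n Nd j (d j)) ^ 2

/-- The product cone `Γ_{x₁} × ⋯ × Γ_{xₙ}`, `Γ_{x_j} = {(y,t) : |y - x_j| < t}`. -/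
def prodCone (x : X n Nd) : Set (W n Nd) :=
  {p | ∀ j, Real.sqrt (∑ i, ((p j).1 i - x j i) ^ 2) < (p j).2}

/-- The square of the product Lusin square function `S⃗^L f`. -/
def lusinSq (f : X n Nd → ℝ) (x : X n Nd) : ℝ≥0∞ :=
  ∫⁻ p in prodCone n Nd x,
    ENNReal.ofReal (mixedGradSq n Nd (prodPoisson n Nd f) p *
      ∏ j, (p j).2 ^ (1 - (Nd j : ℝ)))

/-- The norm of the multi-parameter (product) Hardy space `H¹(X₁ × ⋯ × Xₙ)` of
Chang–Fefferman: `‖f‖ = ‖S⃗^L f‖_{L¹(X)}`. -/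
def H1prodNorm (f : X n Nd → ℝ) : ℝ≥0∞ :=
  ∫⁻ x, (lusinSq n Nd f x) ^ (1 / 2 : ℝ)

/-- A primitive of the Gaussian. -/
def gaussPrim (x : ℝ) : ℝ := ∫ s in (0 : ℝ)..x, Real.exp (-s ^ 2)

lemma hasDerivAt_gaussPrim (x : ℝ) : HasDerivAt gaussPrim (Real.exp (-x ^ 2)) x := by
  have hc : Continuous fun s : ℝ => Real.exp (-s ^ 2) := by fun_prop
  exact intervalIntegral.integral_hasDerivAt_right (hc.intervalIntegrable _ _)
    (hc.stronglyMeasurableAtFilter _ _) hc.continuousAt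

lemma tendsto_gaussPrim_atTop : Tendsto gaussPrim atTop (𝓝 (√Real.pi / 2)) := by
  have h := integral_gaussian_Ioi 1
  simp only [div_one, neg_mul, one_mul] at h
  rw [← h]
  have hi : Integrable fun s : ℝ => Real.exp (-s ^ 2) := by
    simpa using integrable_exp_neg_mul_sq (b := 1) one_pos
  exact intervalIntegral_tendsto_integral_Ioi 0 hi.integrableOn tendsto_id

lemma gaussPrim_neg (x : ℝ) : gaussPrim (-x) = -gaussPrim x := by
  unfold gaussPrim
  have := intervalIntegral.integral_comp_neg (a := 0) (b := x) (fun s : ℝ => Real.exp (-s ^ 2))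
  simp only [neg_sq, neg_zero] at this
  rw [this, intervalIntegral.integral_symm]

lemma tendsto_gaussPrim_atBot : Tendsto gaussPrim atBot (𝓝 (-(√Real.pi / 2))) := by
  have := (tendsto_gaussPrim_atTop.comp tendsto_neg_atBot_atTop).neg
  refine this.congr fun x => ?_
  simp [gaussPrim_neg]

lemma integral_rpow_neg_half_mul_exp {α β : ℝ} (hα : 0 < α) (hβ : 0 < β) :
    IntegrableOn (fun r : ℝ => r ^ (-(1 / 2) : ℝ) * Real.exp (-(α ^ 2 * r) - β ^ 2 / r))
      (Set.Ioi 0) ∧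
    ∫ r in Set.Ioi (0 : ℝ), r ^ (-(1 / 2) : ℝ) * Real.exp (-(α ^ 2 * r) - β ^ 2 / r) =
      √Real.pi / α * Real.exp (-(2 * α * β)) := by
  set Ψ : ℝ → ℝ := fun r => α⁻¹ * (Real.exp (2 * α * β) * gaussPrim (α * √r + β / √r) +
    Real.exp (-(2 * α * β)) * gaussPrim (α * √r - β / √r)) with hΨ
  have hs : Tendsto Real.sqrt atTop atTop := Real.tendsto_sqrt_atTop
  have hs0 : Tendsto Real.sqrt (𝓝[>] 0) (𝓝[>] 0) := by
    refine tendsto_nhdsWithin_iff.2 ⟨?_, ?_⟩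
    · have : Tendsto Real.sqrt (𝓝 0) (𝓝 0) := by
        simpa using Real.continuous_sqrt.tendsto 0
      exact this.mono_left nhdsWithin_le_nhds
    · filter_upwards [self_mem_nhdsWithin] with r hr using Real.sqrt_pos.2 hr
  have hinv : Tendsto (fun r : ℝ => β / √r) (𝓝[>] 0) atTop := by
    simp only [div_eq_mul_inv]
    exact (tendsto_inv_nhdsGT_zero.comp hs0).const_mul_atTop hβ
  have hinv' : Tendsto (fun r : ℝ => β / √r) atTop (𝓝 0) := hs.const_div_atTop β
  have hlin : Tendsto (fun r : ℝ => α * √r) (𝓝[>] 0) (𝓝 0) := by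
    simpa using (hs0.mono_right nhdsWithin_le_nhds).const_mul α
  have hlin' : Tendsto (fun r : ℝ => α * √r) atTop atTop := hs.const_mul_atTop hα
  have h1 : Tendsto Ψ atTop (𝓝 (α⁻¹ * (Real.exp (2 * α * β) * (√Real.pi / 2) +
      Real.exp (-(2 * α * β)) * (√Real.pi / 2)))) := by
    refine ((((tendsto_gaussPrim_atTop.comp ?_).const_mul _).add
      ((tendsto_gaussPrim_atTop.comp ?_).const_mul _)).const_mul _)
    · exact hlin'.atTop_add hinv'
    · simpa [sub_eq_add_neg] using hlin'.atTop_add hinv'.neg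
  have h0 : Tendsto Ψ (𝓝[>] 0) (𝓝 (α⁻¹ * (Real.exp (2 * α * β) * (√Real.pi / 2) +
      Real.exp (-(2 * α * β)) * (-(√Real.pi / 2))))) := by
    refine ((((tendsto_gaussPrim_atTop.comp ?_).const_mul _).add
      ((tendsto_gaussPrim_atBot.comp ?_).const_mul _)).const_mul _)
    · exact hlin.add_atTop hinv
    · simpa [sub_eq_add_neg] using hlin.add_atBot (tendsto_neg_atTop_atBot.comp hinv)
  have hd : ∀ r ∈ Set.Ioi (0 : ℝ), HasDerivAt Ψ
      (r ^ (-(1 / 2) : ℝ) * Real.exp (-(α ^ 2 * r) - β ^ 2 / r)) r := by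
    intro r hr
    have hr' : 0 < r := hr
    have hq : 0 < √r := Real.sqrt_pos.2 hr'
    have hsq := Real.hasDerivAt_sqrt hr'.ne'
    have ha := hsq.const_mul α
    have hb := (hsq.inv hq.ne').const_mul β
    have e1 := ((hasDerivAt_gaussPrim _).comp r (ha.add hb)).const_mul (Real.exp (2 * α * β))
    have e2 := ((hasDerivAt_gaussPrim _).comp r (ha.sub hb)).const_mul
      (Real.exp (-(2 * α * β)))
    have e3 := (e1.add e2).const_mul α⁻¹
    refine (e3.congr_deriv ?_).congr_of_eventuallyEq (Eventually.of_forall fun r => ?_)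
    · have hsr : √r ^ 2 = r := Real.sq_sqrt hr'.le
      have hp : r ^ (-(1 / 2) : ℝ) = (√r)⁻¹ := by
        rw [Real.rpow_neg hr'.le, Real.sqrt_eq_rpow]
      have x1 : Real.exp (2 * α * β) * Real.exp (-(α * √r + β * (√r)⁻¹) ^ 2) =
          Real.exp (-(α ^ 2 * r) - β ^ 2 / r) := by
        rw [← Real.exp_add]; congr 1
        have h4 : √r * (√r)⁻¹ = 1 := mul_inv_cancel₀ hq.ne'
        have h5 : β ^ 2 / r = β ^ 2 * (√r)⁻¹ ^ 2 := by rw [← hsr]; simp [div_eq_mul_inv]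
        rw [h5]
        linear_combination (-α ^ 2) * hsr + (-1) * (2 * α * β) * h4
      have x2 : Real.exp (-(2 * α * β)) * Real.exp (-(α * √r - β * (√r)⁻¹) ^ 2) =
          Real.exp (-(α ^ 2 * r) - β ^ 2 / r) := by
        rw [← Real.exp_add]; congr 1
        have h4 : √r * (√r)⁻¹ = 1 := mul_inv_cancel₀ hq.ne'
        have h5 : β ^ 2 / r = β ^ 2 * (√r)⁻¹ ^ 2 := by rw [← hsr]; simp [div_eq_mul_inv]
        rw [h5]
        linear_combination (-α ^ 2) * hsr + 1 * (2 * α * β) * h4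
      simp only [Pi.add_apply, Pi.sub_apply, Pi.inv_apply]
      rw [← mul_assoc, ← mul_assoc, x1, x2, hp]
      field_simp
      ring
    · simp [hΨ, div_eq_mul_inv]
  have hnn : ∀ r ∈ Set.Ioi (0 : ℝ),
      0 ≤ r ^ (-(1 / 2) : ℝ) * Real.exp (-(α ^ 2 * r) - β ^ 2 / r) := fun r hr => by
    have : (0 : ℝ) < r := hr
    positivity
  set Ψ' : ℝ → ℝ := Function.update Ψ 0 (α⁻¹ * (Real.exp (2 * α * β) * (√Real.pi / 2) +
      Real.exp (-(2 * α * β)) * (-(√Real.pi / 2)))) with hΨ'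
  have hne : ∀ r ∈ Set.Ioi (0 : ℝ), Ψ' =ᶠ[𝓝 r] Ψ := fun r hr => by
    filter_upwards [lt_mem_nhds (show (0 : ℝ) < r from hr)] with s hs
    simp [hΨ', Function.update_of_ne (ne_of_gt hs)]
  have hd' : ∀ r ∈ Set.Ioi (0 : ℝ), HasDerivAt Ψ'
      (r ^ (-(1 / 2) : ℝ) * Real.exp (-(α ^ 2 * r) - β ^ 2 / r)) r := fun r hr =>
    (hd r hr).congr_of_eventuallyEq (hne r hr)
  have hc : ContinuousWithinAt Ψ' (Set.Ici 0) 0 := by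
    rw [← continuousWithinAt_Ioi_iff_Ici]
    unfold ContinuousWithinAt
    simp only [hΨ', Function.update_self]
    refine h0.congr' ?_
    filter_upwards [self_mem_nhdsWithin] with s hs
    have hs' : (0 : ℝ) < s := hs
    simp [Function.update_of_ne hs'.ne']
  have h1' : Tendsto Ψ' atTop (𝓝 (α⁻¹ * (Real.exp (2 * α * β) * (√Real.pi / 2) +
      Real.exp (-(2 * α * β)) * (√Real.pi / 2)))) := by
    refine h1.congr' ?_
    filter_upwards [eventually_gt_atTop 0] with s hs
    simp [hΨ', Function.update_of_ne (ne_of_gt hs)]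
  have hInt := integrableOn_Ioi_deriv_of_nonneg hc hd' hnn h1'
  refine ⟨hInt, ?_⟩
  rw [integral_Ioi_of_hasDerivAt_of_tendsto hc hd' hInt h1']
  simp only [hΨ', Function.update_self]
  ring

open scoped FourierTransform

lemma integral_rpow_neg_half_mul_exp' {α β : ℝ} (hα : 0 < α) (hβ : 0 ≤ β) :
    IntegrableOn (fun r : ℝ => r ^ (-(1 / 2) : ℝ) * Real.exp (-(α ^ 2 * r) - β ^ 2 / r))
      (Set.Ioi 0) ∧
    ∫ r in Set.Ioi (0 : ℝ), r ^ (-(1 / 2) : ℝ) * Real.exp (-(α ^ 2 * r) - β ^ 2 / r) =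
      √Real.pi / α * Real.exp (-(2 * α * β)) := by
  rcases hβ.eq_or_lt with rfl | hβ
  · have h1 := integrableOn_rpow_mul_exp_neg_mul_rpow (p := 1) (s := -(1 / 2)) (b := α ^ 2)
      (by norm_num) one_pos (by positivity)
    have h2 := Real.integral_rpow_mul_exp_neg_mul_Ioi (a := 1 / 2) (r := α ^ 2)
      (by norm_num) (by positivity)
    rw [Real.Gamma_one_half_eq] at h2
    refine ⟨by simpa using h1, ?_⟩
    have h3 : ((1 : ℝ) / 2 - 1) = -(1 / 2) := by norm_num
    rw [h3] at h2
    simp only [ne_eq, OfNat.ofNat_ne_zero, not_false_eq_true, zero_pow, zero_div, sub_zero,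
      mul_zero, neg_zero, Real.exp_zero, mul_one]
    rw [h2, one_div, ← Real.sqrt_eq_rpow, Real.sqrt_inv, Real.sqrt_sq hα.le]
    field_simp
  · exact integral_rpow_neg_half_mul_exp hα hβ

/-- The subordination density whose integral in `r` is a multiple of the Poisson kernel. -/
def subDens (N : ℕ) (t : ℝ) (y : EuclideanSpace ℝ (Fin N)) (r : ℝ) : ℝ :=
  r ^ (((N : ℝ) - 1) / 2) * Real.exp (-(r * (‖y‖ ^ 2 + t ^ 2)))

lemma pk_eq_integral (N : ℕ) {t : ℝ} (ht : 0 < t) (y : EuclideanSpace ℝ (Fin N)) :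
    pk N y.ofLp t = (Real.pi ^ (((N : ℝ) + 1) / 2))⁻¹ * t *
      ∫ r in Set.Ioi (0 : ℝ), subDens N t y r := by
  have h2 := Real.integral_rpow_mul_exp_neg_mul_Ioi (a := ((N : ℝ) + 1) / 2)
    (r := ‖y‖ ^ 2 + t ^ 2) (by positivity) (by positivity)
  have h3 : ((N : ℝ) + 1) / 2 - 1 = ((N : ℝ) - 1) / 2 := by ring
  rw [h3] at h2
  unfold subDens
  simp_rw [mul_comm _ (‖y‖ ^ 2 + t ^ 2)]
  rw [h2, pk, EuclideanSpace.real_norm_sq_eq, one_div, Real.inv_rpow (by positivity)]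
  ring

lemma integral_subDens_left (N : ℕ) (t : ℝ) {r : ℝ} (hr : 0 < r) :
    ∫ y, subDens N t y r = Real.pi ^ ((N : ℝ) / 2) *
      (r ^ (-(1 / 2) : ℝ) * Real.exp (-(t ^ 2 * r))) := by
  have h1 : ∀ y : EuclideanSpace ℝ (Fin N), subDens N t y r =
      r ^ (((N : ℝ) - 1) / 2) * Real.exp (-(t ^ 2 * r)) * Real.exp (-r * ‖y‖ ^ 2) := by
    intro y
    rw [subDens, mul_assoc, ← Real.exp_add]; ring_nf
  simp_rw [h1]
  rw [integral_const_mul, GaussianFourier.integral_rexp_neg_mul_sq_norm hr,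
    Real.div_rpow Real.pi_pos.le hr.le, finrank_euclideanSpace, Fintype.card_fin]
  have : r ^ (-(1 / 2) : ℝ) = r ^ (((N : ℝ) - 1) / 2) / r ^ ((N : ℝ) / 2) := by
    rw [← Real.rpow_sub hr]; ring_nf
  rw [this]; ring

lemma measurable_subDens (N : ℕ) (t : ℝ) :
    Measurable (fun p : EuclideanSpace ℝ (Fin N) × ℝ => subDens N t p.1 p.2) := by
  unfold subDens
  fun_prop

lemma integrable_subDens (N : ℕ) {t : ℝ} (ht : 0 < t) :
    Integrable (fun p : EuclideanSpace ℝ (Fin N) × ℝ => subDens N t p.1 p.2)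
      ((volume : Measure (EuclideanSpace ℝ (Fin N))).prod (volume.restrict (Set.Ioi 0))) := by
  rw [integrable_prod_iff' (measurable_subDens N t).aestronglyMeasurable]
  have hpos : ∀ᵐ r : ℝ ∂(volume.restrict (Set.Ioi 0)), 0 < r :=
    ae_restrict_mem measurableSet_Ioi
  constructor
  · filter_upwards [hpos] with r hr
    have h1 : ∀ y : EuclideanSpace ℝ (Fin N), subDens N t y r =
        r ^ (((N : ℝ) - 1) / 2) * Real.exp (-(t ^ 2 * r)) * Real.exp (-r * ‖y‖ ^ 2) := by
      intro y
      rw [subDens, mul_assoc, ← Real.exp_add]; ring_nf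
    simp_rw [h1]
    refine Integrable.const_mul ?_ _
    have := (GaussianFourier.integrable_cexp_neg_mul_sq_norm_add
      (V := EuclideanSpace ℝ (Fin N)) (b := (r : ℂ)) (by simpa using hr) 0 0).norm
    refine this.congr (Eventually.of_forall fun y => ?_)
    simp [Complex.norm_exp, ← Complex.ofReal_pow]
  · have h2 := (integral_rpow_neg_half_mul_exp' ht le_rfl).1.const_mul
      (Real.pi ^ ((N : ℝ) / 2))
    refine Integrable.congr h2 ?_
    filter_upwards [hpos] with r hr
    have h3 : ∀ y : EuclideanSpace ℝ (Fin N), ‖subDens N t y r‖ = subDens N t y r := by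
      intro y
      rw [Real.norm_of_nonneg]; unfold subDens; positivity
    simp_rw [h3]
    rw [integral_subDens_left N t hr]
    simp

lemma integrable_pk_euclidean (N : ℕ) {t : ℝ} (ht : 0 < t) :
    Integrable (fun y : EuclideanSpace ℝ (Fin N) => pk N y.ofLp t) := by
  simp_rw [pk_eq_integral N ht]
  exact (integrable_subDens N ht).integral_prod_left.const_mul _

/-- The Fourier transform of the Poisson kernel. -/
lemma fourier_pk (N : ℕ) {t : ℝ} (ht : 0 < t) (ξ : EuclideanSpace ℝ (Fin N)) :
    𝓕 (fun y : EuclideanSpace ℝ (Fin N) => (pk N y.ofLp t : ℂ)) ξ =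
      Real.exp (-(2 * Real.pi * t * ‖ξ‖)) := by
  have hInt : Integrable (Function.uncurry fun (y : EuclideanSpace ℝ (Fin N)) (r : ℝ) =>
      Real.fourierChar (-inner ℝ y ξ) • ((subDens N t y r : ℝ) : ℂ))
      ((volume : Measure (EuclideanSpace ℝ (Fin N))).prod (volume.restrict (Set.Ioi 0))) := by
    refine (integrable_subDens N ht).mono ?_ ?_
    · refine Measurable.aestronglyMeasurable ?_
      have := Complex.measurable_ofReal.comp (measurable_subDens N t)
      simp only [Function.uncurry_def, Circle.smul_def, smul_eq_mul]
      refine Measurable.mul ?_ this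
      exact (Continuous.measurable (by fun_prop))
    · exact Eventually.of_forall fun p => by simp [Function.uncurry_def]
  rw [Real.fourier_eq]
  calc ∫ y : EuclideanSpace ℝ (Fin N), Real.fourierChar (-inner ℝ y ξ) • (pk N y.ofLp t : ℂ)
      = ∫ y : EuclideanSpace ℝ (Fin N), ((Real.pi ^ (((N : ℝ) + 1) / 2))⁻¹ * t : ℝ) *
        ∫ r in Set.Ioi (0 : ℝ),
          Real.fourierChar (-inner ℝ y ξ) • ((subDens N t y r : ℝ) : ℂ) := by
        refine integral_congr_ae (Eventually.of_forall fun y => ?_)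
        simp only [pk_eq_integral N ht]
        simp only [Circle.smul_def, smul_eq_mul]
        rw [integral_const_mul, integral_complex_ofReal]
        push_cast; ring
    _ = ((Real.pi ^ (((N : ℝ) + 1) / 2))⁻¹ * t : ℝ) * ∫ r in Set.Ioi (0 : ℝ),
        ∫ y : EuclideanSpace ℝ (Fin N),
          Real.fourierChar (-inner ℝ y ξ) • ((subDens N t y r : ℝ) : ℂ) := by
        rw [integral_const_mul, integral_integral_swap hInt]
    _ = ((Real.pi ^ (((N : ℝ) + 1) / 2))⁻¹ * t : ℝ) * ∫ r in Set.Ioi (0 : ℝ),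
        ((Real.pi ^ ((N : ℝ) / 2) * (r ^ (-(1 / 2) : ℝ) *
          Real.exp (-(t ^ 2 * r) - (Real.pi * ‖ξ‖) ^ 2 / r)) : ℝ) : ℂ) := by
        congr 1
        refine setIntegral_congr_fun measurableSet_Ioi fun r hr => ?_
        have hr' : (0 : ℝ) < r := hr
        have h1 : ∀ y : EuclideanSpace ℝ (Fin N),
            Real.fourierChar (-inner ℝ y ξ) • ((subDens N t y r : ℝ) : ℂ) =
            ((r ^ (((N : ℝ) - 1) / 2) * Real.exp (-(t ^ 2 * r)) : ℝ) : ℂ) *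
            (Real.fourierChar (-inner ℝ y ξ) • Complex.exp (-(r : ℂ) * (‖y‖ : ℂ) ^ 2)) := by
          intro y
          have : subDens N t y r =
              r ^ (((N : ℝ) - 1) / 2) * Real.exp (-(t ^ 2 * r)) * Real.exp (-r * ‖y‖ ^ 2) := by
            rw [subDens, mul_assoc, ← Real.exp_add]; ring_nf
          rw [this]
          simp only [Circle.smul_def, smul_eq_mul]
          push_cast; ring
        simp_rw [h1]
        rw [integral_const_mul, ← Real.fourier_eq
          (fun y : EuclideanSpace ℝ (Fin N) => Complex.exp (-(r : ℂ) * (‖y‖ : ℂ) ^ 2)) ξ,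
          fourier_gaussian_innerProductSpace (by simpa using hr')]
        rw [finrank_euclideanSpace, Fintype.card_fin]
        have h2 : ((Real.pi : ℂ) / (r : ℂ)) ^ ((N : ℂ) / 2) =
            (((Real.pi / r) ^ ((N : ℝ) / 2) : ℝ) : ℂ) := by
          rw [Complex.ofReal_cpow (by positivity)]; push_cast; rfl
        have h3 : Complex.exp (-(Real.pi : ℂ) ^ 2 * (‖ξ‖ : ℂ) ^ 2 / (r : ℂ)) =
            ((Real.exp (-Real.pi ^ 2 * ‖ξ‖ ^ 2 / r) : ℝ) : ℂ) := by push_cast; rfl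
        rw [h2, h3, ← Complex.ofReal_mul, ← Complex.ofReal_mul]
        congr 1
        rw [Real.div_rpow Real.pi_pos.le hr'.le]
        have h4 : r ^ (-(1 / 2) : ℝ) = r ^ (((N : ℝ) - 1) / 2) / r ^ ((N : ℝ) / 2) := by
          rw [← Real.rpow_sub hr']; ring_nf
        have h5 : -(t ^ 2 * r) - (Real.pi * ‖ξ‖) ^ 2 / r =
            -(t ^ 2 * r) + -Real.pi ^ 2 * ‖ξ‖ ^ 2 / r := by ring
        rw [h4, h5, Real.exp_add]
        ring
    _ = _ := by
        rw [integral_complex_ofReal, ← Complex.ofReal_mul]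
        congr 1
        rw [integral_const_mul, (integral_rpow_neg_half_mul_exp' ht (by positivity)).2]
        have : Real.pi ^ (((N : ℝ) + 1) / 2) = Real.pi ^ ((N : ℝ) / 2) * √Real.pi := by
          rw [Real.sqrt_eq_rpow, ← Real.rpow_add Real.pi_pos]; ring_nf
        rw [this]
        have h5 : Real.pi ^ ((N : ℝ) / 2) ≠ 0 := by positivity
        have h6 : √Real.pi ≠ 0 := by positivity
        field_simp

lemma integrable_exp_neg_mul_norm (N : ℕ) {c : ℝ} (hc : 0 < c) :
    Integrable (fun ξ : EuclideanSpace ℝ (Fin N) => Real.exp (-(c * ‖ξ‖))) := by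
  set m : ℝ := min 1 (c / (N + 1)) with hm
  have hm0 : 0 < m := by positivity
  have h := (integrable_one_add_norm (E := EuclideanSpace ℝ (Fin N)) (μ := volume)
    (r := (N + 1 : ℕ)) (by simp)).const_mul ((m ^ (N + 1))⁻¹)
  refine h.mono' (by fun_prop) (Eventually.of_forall fun ξ => ?_)
  rw [Real.norm_of_nonneg (Real.exp_pos _).le, Real.rpow_neg (by positivity), Real.rpow_natCast,
    ← mul_inv, ← mul_pow, Real.exp_neg]
  refine inv_anti₀ (by positivity) ?_
  have h1 : c * ‖ξ‖ = ((N + 1 : ℕ) : ℝ) * (c / (N + 1) * ‖ξ‖) := by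
    push_cast; field_simp
  rw [h1, Real.exp_nat_mul]
  refine pow_le_pow_left₀ (by positivity) ?_ _
  have h2 := Real.add_one_le_exp (c / (N + 1) * ‖ξ‖)
  have h3 : m ≤ 1 := min_le_left _ _
  have h4 : m * ‖ξ‖ ≤ c / (N + 1) * ‖ξ‖ :=
    mul_le_mul_of_nonneg_right (min_le_right _ _) (norm_nonneg _)
  linarith

lemma continuous_pk_euclidean (N : ℕ) {t : ℝ} (ht : 0 < t) :
    Continuous (fun y : EuclideanSpace ℝ (Fin N) => pk N y.ofLp t) := by
  unfold pk
  refine Continuous.div (by fun_prop) ?_ ?_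
  · refine Continuous.rpow_const (by fun_prop) fun y => Or.inl ?_
    have : 0 ≤ ∑ i, y.ofLp i ^ 2 := Finset.sum_nonneg fun i _ => sq_nonneg _
    positivity
  · intro y
    have : 0 ≤ ∑ i, y.ofLp i ^ 2 := Finset.sum_nonneg fun i _ => sq_nonneg _
    positivity

lemma fourierInv_exp (N : ℕ) {t : ℝ} (ht : 0 < t) (x : EuclideanSpace ℝ (Fin N)) :
    𝓕⁻ (fun ξ : EuclideanSpace ℝ (Fin N) =>
      ((Real.exp (-(2 * Real.pi * t * ‖ξ‖)) : ℝ) : ℂ)) x = (pk N x.ofLp t : ℂ) := by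
  have h := Continuous.fourierInv_fourier_eq
    (Complex.continuous_ofReal.comp (continuous_pk_euclidean N ht))
    (integrable_pk_euclidean N ht).ofReal ?_
  · refine Eq.trans ?_ (congrFun h x)
    exact congrArg (fun h : EuclideanSpace ℝ (Fin N) → ℂ => 𝓕⁻ h x)
      (funext fun ξ => (fourier_pk N ht ξ).symm)
  · refine (integrable_exp_neg_mul_norm N (c := 2 * Real.pi * t) (by positivity)).ofReal.congr
      (Eventually.of_forall fun ξ => ?_)
    exact (fourier_pk N ht ξ).symm

lemma integral_pk_euclidean (N : ℕ) {t : ℝ} (ht : 0 < t) :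
    ∫ y : EuclideanSpace ℝ (Fin N), pk N y.ofLp t = 1 := by
  have h := fourier_pk N ht 0
  rw [Real.fourier_eq] at h
  simp only [inner_zero_right, neg_zero, AddChar.map_zero_eq_one, one_smul, norm_zero, mul_zero,
    Real.exp_zero] at h
  rw [integral_complex_ofReal] at h
  exact_mod_cast h

lemma integral_pk_mul_pk_euclidean (N : ℕ) {a b : ℝ} (ha : 0 < a) (hb : 0 < b)
    (x : EuclideanSpace ℝ (Fin N)) :
    ∫ y : EuclideanSpace ℝ (Fin N), pk N (x - y).ofLp a * pk N y.ofLp b =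
      pk N x.ofLp (a + b) := by
  set g : EuclideanSpace ℝ (Fin N) → ℂ := fun ξ =>
    Real.fourierChar (inner ℝ ξ x) • ((Real.exp (-(2 * Real.pi * a * ‖ξ‖)) : ℝ) : ℂ) with hg
  have hgi : Integrable g := by
    refine (integrable_exp_neg_mul_norm N (c := 2 * Real.pi * a) (by positivity)).mono ?_ ?_
    · refine Continuous.aestronglyMeasurable ?_
      simp only [hg, Circle.smul_def, smul_eq_mul]
      fun_prop
    · refine Eventually.of_forall fun p => le_of_eq ?_
      simp only [hg, Circle.norm_smul, Complex.norm_real]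
  have key := VectorFourier.integral_fourierIntegral_smul_eq_flip (e := Real.fourierChar)
    (L := innerₗ (EuclideanSpace ℝ (Fin N))) (μ := volume) (ν := volume)
    Real.continuous_fourierChar (by simp only [innerₗ_apply_apply]; fun_prop)
    (integrable_pk_euclidean N hb).ofReal hgi
  have e1 : ∀ ξ, VectorFourier.fourierIntegral Real.fourierChar volume
      (innerₗ (EuclideanSpace ℝ (Fin N))) (fun y => (pk N y.ofLp b : ℂ)) ξ =
      Real.exp (-(2 * Real.pi * b * ‖ξ‖)) := fun ξ => fourier_pk N hb ξ
  have e2 : ∀ y, VectorFourier.fourierIntegral Real.fourierChar volume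
      (innerₗ (EuclideanSpace ℝ (Fin N))).flip g y = (pk N (x - y).ofLp a : ℂ) := by
    intro y
    rw [← fourierInv_exp N ha, Real.fourierInv_eq, VectorFourier.fourierIntegral]
    refine integral_congr_ae (Eventually.of_forall fun ξ => ?_)
    simp only [LinearMap.flip_apply, innerₗ_apply_apply, hg, smul_smul, inner_sub_right]
    rw [← AddChar.map_add_eq_mul, real_inner_comm]
    congr 2
    ring
  have e3 : ∫ y : EuclideanSpace ℝ (Fin N),
      ((pk N (x - y).ofLp a * pk N y.ofLp b : ℝ) : ℂ) = (pk N x.ofLp (a + b) : ℂ) := by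
    rw [← fourierInv_exp N (add_pos ha hb), Real.fourierInv_eq]
    refine Eq.trans ?_ (key.symm.trans ?_)
    · refine integral_congr_ae (Eventually.of_forall fun y => ?_)
      simp only [e2, smul_eq_mul]
      push_cast
      exact mul_comm _ _
    · refine integral_congr_ae (Eventually.of_forall fun ξ => ?_)
      simp only [hg]
      rw [show (fun y : EuclideanSpace ℝ (Fin N) => RCLike.ofReal (pk N y.ofLp b)) =
        fun y : EuclideanSpace ℝ (Fin N) => (pk N y.ofLp b : ℂ) from rfl, e1]
      simp only [Circle.smul_def, smul_eq_mul]
      rw [mul_left_comm, ← Complex.ofReal_mul, ← Real.exp_add]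
      congr 3
      ring
  rw [integral_complex_ofReal] at e3
  exact_mod_cast e3

/-- The normalizing constant of the Poisson kernel. -/
def poiC (N : ℕ) : ℝ := Real.Gamma (((N : ℝ) + 1) / 2) / Real.pi ^ (((N : ℝ) + 1) / 2)

lemma poiC_pos (N : ℕ) : 0 < poiC N := by
  unfold poiC
  have := Real.Gamma_pos_of_pos (show (0 : ℝ) < ((N : ℝ) + 1) / 2 by positivity)
  positivity

/-- The inverse Euclidean length of `(y, t)`. -/
def ih {N : ℕ} (y : Fin N → ℝ) (t : ℝ) : ℝ := (√((∑ i, y i ^ 2) + t ^ 2))⁻¹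

section ih
variable {N : ℕ} {y : Fin N → ℝ} {t : ℝ}

lemma ssq_nonneg (y : Fin N → ℝ) : 0 ≤ ∑ i, y i ^ 2 := Finset.sum_nonneg fun i _ => sq_nonneg _

lemma ssq_add_pos (y : Fin N → ℝ) (ht : 0 < t) : 0 < (∑ i, y i ^ 2) + t ^ 2 := by
  have := ssq_nonneg y
  positivity

lemma ih_nonneg (y : Fin N → ℝ) (t : ℝ) : 0 ≤ ih y t := inv_nonneg.2 (Real.sqrt_nonneg _)

lemma mul_ih_le_one (y : Fin N → ℝ) (ht : 0 < t) : t * ih y t ≤ 1 := by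
  unfold ih
  rw [← div_eq_mul_inv, div_le_one (Real.sqrt_pos.2 (ssq_add_pos y ht))]
  exact Real.le_sqrt_of_sq_le (by linarith [ssq_nonneg y])

lemma norm_add_le_sqrt (y : Fin N → ℝ) (ht : 0 < t) :
    ‖y‖ + t ≤ 2 * √((∑ i, y i ^ 2) + t ^ 2) := by
  have h1 : ‖y‖ ≤ √((∑ i, y i ^ 2) + t ^ 2) := by
    refine (pi_norm_le_iff_of_nonneg (Real.sqrt_nonneg _)).2 fun i => ?_
    refine Real.le_sqrt_of_sq_le ?_
    have := Finset.single_le_sum (f := fun i => y i ^ 2) (fun i _ => sq_nonneg _)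
      (Finset.mem_univ i)
    simp only [Real.norm_eq_abs, sq_abs] at this ⊢
    nlinarith [sq_nonneg t]
  have h2 : t ≤ √((∑ i, y i ^ 2) + t ^ 2) :=
    Real.le_sqrt_of_sq_le (by linarith [ssq_nonneg y])
  linarith

lemma ih_le (y : Fin N → ℝ) (ht : 0 < t) : ih y t ≤ 2 * (‖y‖ + t)⁻¹ := by
  unfold ih
  have h := norm_add_le_sqrt y ht
  have hp := Real.sqrt_pos.2 (ssq_add_pos y ht)
  rw [← div_eq_mul_inv, inv_eq_one_div, div_le_div_iff₀ hp (by positivity)]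
  linarith

lemma hasDerivAt_ih (y : Fin N → ℝ) (ht : 0 < t) :
    HasDerivAt (ih y) (-t * ih y t ^ 3) t := by
  have hp := ssq_add_pos y ht
  have hq := Real.sqrt_pos.2 hp
  have h1 : HasDerivAt (fun t : ℝ => (∑ i, y i ^ 2) + t ^ 2) (2 * t) t := by
    simpa using (hasDerivAt_pow 2 t).const_add (∑ i, y i ^ 2)
  have h2 := (h1.sqrt hp.ne').inv hq.ne'
  refine h2.congr_deriv ?_
  unfold ih
  field_simp

lemma pk_eq_ih (y : Fin N → ℝ) (t : ℝ) : pk N y t = poiC N * (t * ih y t ^ (N + 1)) := by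
  have h : ((∑ i, y i ^ 2) + t ^ 2) ^ (((N : ℝ) + 1) / 2) =
      √((∑ i, y i ^ 2) + t ^ 2) ^ (N + 1) := by
    have h0 : 0 ≤ (∑ i, y i ^ 2) + t ^ 2 := by have := ssq_nonneg y; positivity
    rw [Real.sqrt_eq_rpow, ← Real.rpow_mul_natCast h0]
    congr 1; push_cast; ring
  rw [pk, h, ih, poiC, inv_pow]
  ring

/-- The `t`-derivative of the Poisson kernel. -/
def pkt (N : ℕ) (y : Fin N → ℝ) (t : ℝ) : ℝ :=
  poiC N * (ih y t ^ (N + 1) - (N + 1) * t ^ 2 * ih y t ^ (N + 3))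

/-- The second `t`-derivative of the Poisson kernel. -/
def pktt (N : ℕ) (y : Fin N → ℝ) (t : ℝ) : ℝ :=
  poiC N * (-(3 * (N + 1)) * t * ih y t ^ (N + 3) + (N + 1) * (N + 3) * t ^ 3 * ih y t ^ (N + 5))

lemma hasDerivAt_pk (y : Fin N → ℝ) (ht : 0 < t) : HasDerivAt (pk N y) (pkt N y t) t := by
  have h1 := (((hasDerivAt_id t).mul ((hasDerivAt_ih y ht).pow (N + 1))).const_mul (poiC N))
  refine (h1.congr_deriv ?_).congr_of_eventuallyEq (Eventually.of_forall fun s => ?_)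
  · simp only [pkt, id, Pi.pow_apply]
    push_cast
    ring
  · simp [pk_eq_ih]

lemma hasDerivAt_pkt (y : Fin N → ℝ) (ht : 0 < t) : HasDerivAt (pkt N y) (pktt N y t) t := by
  have h1 := (((hasDerivAt_ih y ht).pow (N + 1)).sub
    ((((hasDerivAt_pow 2 t).const_mul ((N : ℝ) + 1))).mul
      ((hasDerivAt_ih y ht).pow (N + 3)))).const_mul (poiC N)
  refine (h1.congr_deriv ?_).congr_of_eventuallyEq (Eventually.of_forall fun s => ?_)
  · simp only [pktt, Pi.pow_apply]
    push_cast
    ring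
  · simp [pkt]

lemma pk_nonneg (y : Fin N → ℝ) (ht : 0 ≤ t) : 0 ≤ pk N y t := by
  rw [pk_eq_ih]
  have := poiC_pos N
  have := ih_nonneg y t
  positivity

lemma abs_pkt_le_ih (y : Fin N → ℝ) (ht : 0 < t) :
    |pkt N y t| ≤ poiC N * (N + 2) * ih y t ^ (N + 1) := by
  have h0 := ih_nonneg y t
  have h1 : (t * ih y t) ^ 2 ≤ 1 := pow_le_one₀ (by positivity) (mul_ih_le_one y ht)
  have h2 : 0 ≤ ih y t ^ (N + 1) := by positivity
  have hc := poiC_pos N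
  rw [pkt, abs_mul, abs_of_pos hc, mul_assoc (poiC N)]
  refine mul_le_mul_of_nonneg_left ?_ hc.le
  have h3 : (N + 1) * t ^ 2 * ih y t ^ (N + 3) =
      (N + 1) * ((t * ih y t) ^ 2 * ih y t ^ (N + 1)) := by ring
  rw [h3]
  have h4 : 0 ≤ (t * ih y t) ^ 2 * ih y t ^ (N + 1) := by positivity
  have h5 : (t * ih y t) ^ 2 * ih y t ^ (N + 1) ≤ ih y t ^ (N + 1) := by nlinarith
  have hN : (0 : ℝ) ≤ N := Nat.cast_nonneg N
  rw [abs_le]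
  constructor <;> nlinarith

lemma ih_pow_le (m : ℕ) (y : Fin N → ℝ) (ht : 0 < t) :
    ih y t ^ m ≤ 2 ^ m * ((‖y‖ + t) ^ m)⁻¹ := by
  rw [← inv_pow, ← mul_pow]
  exact pow_le_pow_left₀ (ih_nonneg y t) (ih_le y ht) m

/-- A constant for size and smoothness bounds of the Poisson kernel and its derivatives. -/
def poiB (N : ℕ) : ℝ := poiC N * (N + 2) ^ 2 * 2 ^ (N + 1) * 3

lemma poiB_pos (N : ℕ) : 0 < poiB N := by
  have := poiC_pos N
  unfold poiB; positivity

lemma pk_le (y : Fin N → ℝ) (ht : 0 < t) :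
    pk N y t ≤ poiB N * (t * ((‖y‖ + t) ^ (N + 1))⁻¹) := by
  rw [pk_eq_ih]
  have hc := poiC_pos N
  have h := ih_pow_le (N + 1) y ht
  calc poiC N * (t * ih y t ^ (N + 1)) ≤ poiC N * (t * (2 ^ (N + 1) * ((‖y‖ + t) ^ (N + 1))⁻¹)) := by
        gcongr
    _ = (poiC N * 1 * 2 ^ (N + 1) * 1) * (t * ((‖y‖ + t) ^ (N + 1))⁻¹) := by ring
    _ ≤ _ := by
        unfold poiB
        gcongr
        · have hN : (0 : ℝ) ≤ N := Nat.cast_nonneg N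
          nlinarith
        · norm_num

lemma abs_pkt_le (y : Fin N → ℝ) (ht : 0 < t) :
    |pkt N y t| ≤ poiB N * ((‖y‖ + t) ^ (N + 1))⁻¹ := by
  have hc := poiC_pos N
  refine (abs_pkt_le_ih y ht).trans ?_
  have h := ih_pow_le (N + 1) y ht
  calc poiC N * (N + 2) * ih y t ^ (N + 1)
      ≤ poiC N * (N + 2) * (2 ^ (N + 1) * ((‖y‖ + t) ^ (N + 1))⁻¹) := by gcongr
    _ = (poiC N * (N + 2) * 2 ^ (N + 1) * 1) * ((‖y‖ + t) ^ (N + 1))⁻¹ := by ring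
    _ ≤ _ := by
        unfold poiB
        have hN : (0 : ℝ) ≤ N := Nat.cast_nonneg N
        gcongr
        · nlinarith
        · norm_num

lemma continuous_ih (ht : 0 < t) : Continuous (fun y : Fin N → ℝ => ih y t) := by
  unfold ih
  refine Continuous.inv₀ (by fun_prop) fun y => ?_
  exact (Real.sqrt_pos.2 (ssq_add_pos y ht)).ne'

lemma measurable_ih : Measurable (fun p : (Fin N → ℝ) × ℝ => ih p.1 p.2) := by
  unfold ih; fun_prop

lemma measurable_pkt : Measurable (fun p : (Fin N → ℝ) × ℝ => pkt N p.1 p.2) := by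
  have := measurable_ih (N := N)
  unfold pkt; fun_prop

lemma continuous_pkt (ht : 0 < t) : Continuous (fun y : Fin N → ℝ => pkt N y t) := by
  have := continuous_ih (N := N) ht
  unfold pkt; fun_prop

lemma continuous_pk (ht : 0 < t) : Continuous (fun y : Fin N → ℝ => pk N y t) := by
  have := continuous_ih (N := N) ht
  simp_rw [pk_eq_ih]; fun_prop

lemma abs_sqrt_sub_le (y h : Fin N → ℝ) (ht : 0 < t) :
    |√((∑ i, (y i + h i) ^ 2) + t ^ 2) - √((∑ i, y i ^ 2) + t ^ 2)| ≤ N * ‖h‖ := by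
  set D := √((∑ i, y i ^ 2) + t ^ 2) with hD
  set D' := √((∑ i, (y i + h i) ^ 2) + t ^ 2) with hD'
  have hp : 0 < D := Real.sqrt_pos.2 (ssq_add_pos y ht)
  have hp' : 0 < D' := Real.sqrt_pos.2 (ssq_add_pos (fun i => y i + h i) ht)
  have e : D ^ 2 = (∑ i, y i ^ 2) + t ^ 2 := Real.sq_sqrt (ssq_add_pos y ht).le
  have e' : D' ^ 2 = (∑ i, (y i + h i) ^ 2) + t ^ 2 :=
    Real.sq_sqrt (ssq_add_pos (fun i => y i + h i) ht).le
  have hy : ∀ i, |y i| ≤ D := fun i => by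
    refine Real.le_sqrt_of_sq_le ?_
    have := Finset.single_le_sum (f := fun i => y i ^ 2) (fun i _ => sq_nonneg _)
      (Finset.mem_univ i)
    simp only [sq_abs] at this ⊢
    nlinarith [sq_nonneg t]
  have hy' : ∀ i, |y i + h i| ≤ D' := fun i => by
    refine Real.le_sqrt_of_sq_le ?_
    have := Finset.single_le_sum (f := fun i => (y i + h i) ^ 2) (fun i _ => sq_nonneg _)
      (Finset.mem_univ i)
    simp only [sq_abs] at this ⊢
    nlinarith [sq_nonneg t]
  have h1 : (D' - D) * (D' + D) = ∑ i, h i * (y i + (y i + h i)) := by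
    have : (D' - D) * (D' + D) = D' ^ 2 - D ^ 2 := by ring
    rw [this, e, e', add_sub_add_right_eq_sub, ← Finset.sum_sub_distrib]
    exact Finset.sum_congr rfl fun i _ => by ring
  have h2 : |D' - D| * (D' + D) ≤ N * ‖h‖ * (D' + D) := by
    nth_rewrite 1 [← abs_of_pos (add_pos hp' hp)]
    rw [← abs_mul, h1]
    refine (Finset.abs_sum_le_sum_abs _ _).trans ?_
    calc ∑ i, |h i * (y i + (y i + h i))| ≤ ∑ _i : Fin N, ‖h‖ * (D' + D) := by
          refine Finset.sum_le_sum fun i _ => ?_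
          rw [abs_mul]
          refine mul_le_mul (norm_le_pi_norm h i) ?_ (abs_nonneg _) (norm_nonneg _)
          exact (abs_add_le _ _).trans (by linarith [hy i, hy' i])
      _ = _ := by simp; ring
  exact le_of_mul_le_mul_right h2 (by positivity)

lemma ih_add_le (y h : Fin N → ℝ) (ht : 0 < t) (hh : ‖h‖ ≤ t) :
    ih (y + h) t ≤ (N + 1) * ih y t := by
  have h1 := abs_sqrt_sub_le y h ht
  have hp := Real.sqrt_pos.2 (ssq_add_pos y ht)
  have hp' := Real.sqrt_pos.2 (ssq_add_pos (y + h) ht)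
  have h2 : t ≤ √((∑ i, (y + h) i ^ 2) + t ^ 2) :=
    Real.le_sqrt_of_sq_le (by linarith [ssq_nonneg (y + h)])
  unfold ih
  rw [← div_eq_mul_inv, inv_eq_one_div, div_le_div_iff₀ hp' hp]
  simp only [Pi.add_apply] at h2 hp' ⊢
  have h3 := (abs_le.1 h1).1
  have hN : (0 : ℝ) ≤ N := Nat.cast_nonneg N
  nlinarith [mul_le_mul_of_nonneg_left (hh.trans h2) hN]

lemma abs_ih_sub_le (y h : Fin N → ℝ) (ht : 0 < t) (hh : ‖h‖ ≤ t) :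
    |ih (y + h) t - ih y t| ≤ N * (N + 1) * ‖h‖ * ih y t ^ 2 := by
  have h1 := abs_sqrt_sub_le y h ht
  have hp := Real.sqrt_pos.2 (ssq_add_pos y ht)
  have hp' := Real.sqrt_pos.2 (ssq_add_pos (y + h) ht)
  have h2 := ih_add_le y h ht hh
  have e : ih (y + h) t - ih y t = -(√((∑ i, (y i + h i) ^ 2) + t ^ 2) -
      √((∑ i, y i ^ 2) + t ^ 2)) * (ih (y + h) t * ih y t) := by
    unfold ih
    simp only [Pi.add_apply] at hp' ⊢
    field_simp
    ring
  rw [e, abs_mul, abs_neg, abs_of_nonneg (mul_nonneg (ih_nonneg (y + h) t) (ih_nonneg y t))]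
  calc _ ≤ (N * ‖h‖) * ((N + 1) * ih y t * ih y t) := by
        have := ih_nonneg y t
        have := ih_nonneg (y + h) t
        gcongr
    _ = _ := by ring

lemma abs_ih_pow_sub_le (m : ℕ) (y h : Fin N → ℝ) (ht : 0 < t) (hh : ‖h‖ ≤ t) :
    |ih (y + h) t ^ m - ih y t ^ m| ≤ m * (N + 1) ^ (m + 1) * N * ‖h‖ * ih y t ^ (m + 1) := by
  have h0 := ih_nonneg y t
  have h1 := abs_ih_sub_le y h ht hh
  have h2 := ih_add_le y h ht hh
  have h0' := ih_nonneg (y + h) t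
  have hN : (0 : ℝ) ≤ N := Nat.cast_nonneg N
  rcases m with _ | m
  · simp
  have h3 := abs_pow_sub_pow_le (ih (y + h) t) (ih y t) (m + 1)
  refine h3.trans ?_
  have hmax : max |ih (y + h) t| |ih y t| ≤ (N + 1) * ih y t := by
    rw [abs_of_nonneg h0, abs_of_nonneg h0']
    exact max_le h2 (by nlinarith)
  calc _ ≤ (N * (N + 1) * ‖h‖ * ih y t ^ 2) * (m + 1 : ℕ) * ((N + 1) * ih y t) ^ m := by
        gcongr
        exact pow_le_pow_left₀ (le_max_of_le_left (abs_nonneg _)) hmax m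
    _ = (m + 1 : ℕ) * ((N + 1) ^ (m + 1)) * N * ‖h‖ * ih y t ^ (m + 1 + 1) := by
        rw [mul_pow]; ring
    _ ≤ _ := by
        gcongr
        · linarith
        · exact Nat.le_succ _

lemma abs_pkt_sub_le (N : ℕ) : ∃ C : ℝ, 0 < C ∧ ∀ (y h : Fin N → ℝ) (t : ℝ), 0 < t → ‖h‖ ≤ t →
    |t * pkt N (y + h) t - t * pkt N y t| ≤ C * ‖h‖ * ((‖y‖ + t) ^ (N + 1))⁻¹ := by
  have hc := poiC_pos N
  set A : ℝ := (N + 1 : ℕ) * (N + 1) ^ (N + 1 + 1) * N with hA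
  set B : ℝ := (N + 3 : ℕ) * (N + 1) ^ (N + 3 + 1) * N with hB
  have hA0 : 0 ≤ A := by positivity
  have hB0 : 0 ≤ B := by positivity
  refine ⟨poiC N * (A + (N + 1) * B) * 2 ^ (N + 1) + 1, by positivity, fun y h t ht hh => ?_⟩
  have h1 := abs_ih_pow_sub_le (N + 1) y h ht hh
  have h2 := abs_ih_pow_sub_le (N + 3) y h ht hh
  rw [← hA] at h1
  rw [← hB] at h2
  have h0 := ih_nonneg y t
  have e : t * pkt N (y + h) t - t * pkt N y t = poiC N * (t * (ih (y + h) t ^ (N + 1) -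
      ih y t ^ (N + 1)) - (N + 1) * t ^ 3 * (ih (y + h) t ^ (N + 3) - ih y t ^ (N + 3))) := by
    unfold pkt; ring
  have hm := mul_ih_le_one y ht
  have h3 : |t * pkt N (y + h) t - t * pkt N y t| ≤
      poiC N * (A + (N + 1) * B) * ‖h‖ * ih y t ^ (N + 1) := by
    rw [e, abs_mul, abs_of_pos hc, mul_assoc (poiC N), mul_assoc (poiC N)]
    refine mul_le_mul_of_nonneg_left ?_ hc.le
    refine (abs_sub _ _).trans ?_
    rw [abs_mul, abs_mul, abs_of_pos ht, abs_of_pos (show (0 : ℝ) < (N + 1) * t ^ 3 by positivity)]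
    calc _ ≤ t * (A * ‖h‖ * ih y t ^ (N + 1 + 1)) +
          (N + 1) * t ^ 3 * (B * ‖h‖ * ih y t ^ (N + 3 + 1)) := by gcongr
      _ = A * ‖h‖ * ih y t ^ (N + 1) * (t * ih y t) +
          (N + 1) * B * ‖h‖ * ih y t ^ (N + 1) * (t * ih y t) ^ 3 := by ring
      _ ≤ A * ‖h‖ * ih y t ^ (N + 1) * 1 + (N + 1) * B * ‖h‖ * ih y t ^ (N + 1) * 1 := by
          gcongr
          exact pow_le_one₀ (by positivity) hm
      _ = _ := by ring
  refine h3.trans ?_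
  have h4 := ih_pow_le (N + 1) y ht
  calc _ ≤ poiC N * (A + (N + 1) * B) * ‖h‖ * (2 ^ (N + 1) * ((‖y‖ + t) ^ (N + 1))⁻¹) := by
        gcongr
    _ = (poiC N * (A + (N + 1) * B) * 2 ^ (N + 1)) * ‖h‖ * ((‖y‖ + t) ^ (N + 1))⁻¹ := by ring
    _ ≤ _ := by
        gcongr
        linarith

end ih

section poisson
variable {N : ℕ}

lemma integrable_pk {t : ℝ} (ht : 0 < t) : Integrable (fun y : Fin N → ℝ => pk N y t) :=
  ((EuclideanSpace.volume_preserving_symm_measurableEquiv_toLp (Fin N)).integrable_comp_emb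
    (MeasurableEquiv.measurableEmbedding _)).1 (integrable_pk_euclidean N ht)

lemma integral_pk {t : ℝ} (ht : 0 < t) : ∫ y : Fin N → ℝ, pk N y t = 1 := by
  rw [← integral_pk_euclidean N ht]
  exact ((EuclideanSpace.volume_preserving_symm_measurableEquiv_toLp (Fin N)).integral_comp'
    (fun y : Fin N → ℝ => pk N y t)).symm

lemma integral_pk_mul_pk {a b : ℝ} (ha : 0 < a) (hb : 0 < b) (x : Fin N → ℝ) :
    ∫ y : Fin N → ℝ, pk N (x - y) a * pk N y b = pk N x (a + b) := by
  rw [← show pk N ((WithLp.toLp 2 x : EuclideanSpace ℝ (Fin N))).ofLp (a + b) =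
    pk N x (a + b) from rfl, ← integral_pk_mul_pk_euclidean N ha hb]
  exact ((EuclideanSpace.volume_preserving_symm_measurableEquiv_toLp (Fin N)).integral_comp'
    (fun y : Fin N → ℝ => pk N (x - y) a * pk N y b)).symm

lemma ih_anti (y : Fin N → ℝ) {s t : ℝ} (hs : 0 < s) (hst : s ≤ t) : ih y t ≤ ih y s := by
  unfold ih
  refine inv_anti₀ (Real.sqrt_pos.2 (ssq_add_pos y hs)) (Real.sqrt_le_sqrt ?_)
  have := pow_le_pow_left₀ hs.le hst 2
  linarith

lemma abs_pkt_le_pk (y : Fin N → ℝ) {s t : ℝ} (hs : 0 < s) (hst : s ≤ t) :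
    |pkt N y t| ≤ (N + 2) / s * pk N y s := by
  refine (abs_pkt_le_ih y (hs.trans_le hst)).trans ?_
  have h1 := pow_le_pow_left₀ (ih_nonneg y t) (ih_anti y hs hst) (N + 1)
  have hc := poiC_pos N
  rw [pk_eq_ih]
  calc poiC N * (N + 2) * ih y t ^ (N + 1) ≤ poiC N * (N + 2) * ih y s ^ (N + 1) := by gcongr
    _ = _ := by field_simp

lemma integrable_pkt {t : ℝ} (ht : 0 < t) : Integrable (fun y : Fin N → ℝ => pkt N y t) :=
  ((integrable_pk ht).const_mul ((N + 2) / t)).mono' (continuous_pkt ht).aestronglyMeasurable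
    (Eventually.of_forall fun y => abs_pkt_le_pk y ht le_rfl)

lemma abs_pkt_le_const (y : Fin N → ℝ) {s t : ℝ} (hs : 0 < s) (hst : s ≤ t) :
    |pkt N y t| ≤ poiB N * (s ^ (N + 1))⁻¹ := by
  have ht := hs.trans_le hst
  refine (abs_pkt_le y ht).trans ?_
  have := poiB_pos N
  gcongr
  linarith [norm_nonneg y]

lemma pkt_neg (y : Fin N → ℝ) (t : ℝ) : pkt N (-y) t = pkt N y t := by
  simp [pkt, ih]

lemma pkt_sub_comm (y z : Fin N → ℝ) (t : ℝ) : pkt N (y - z) t = pkt N (z - y) t := by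
  rw [← pkt_neg, neg_sub]

lemma integral_pkt {t : ℝ} (ht : 0 < t) : ∫ y : Fin N → ℝ, pkt N y t = 0 := by
  have h := hasDerivAt_integral_of_dominated_loc_of_deriv_le (μ := (volume : Measure (Fin N → ℝ)))
    (F := fun s y => pk N y s) (F' := fun s y => pkt N y s) (x₀ := t) (s := Set.Ioi (t / 2))
    (bound := fun y => (N + 2) / (t / 2) * pk N y (t / 2))
    (Ioi_mem_nhds (by linarith))
    (by filter_upwards [lt_mem_nhds ht] with s hs using (continuous_pk hs).aestronglyMeasurable)
    (integrable_pk ht) (continuous_pkt ht).aestronglyMeasurable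
    (Eventually.of_forall fun y s hs => abs_pkt_le_pk y (by positivity) (le_of_lt hs))
    ((integrable_pk (by positivity)).const_mul _)
    (Eventually.of_forall fun y s hs => hasDerivAt_pk y (lt_trans (by positivity) hs))
  refine h.2.unique ?_
  refine (hasDerivAt_const t (1 : ℝ)).congr_of_eventuallyEq ?_
  filter_upwards [lt_mem_nhds ht] with s hs using integral_pk hs

lemma integral_pkt_mul_pk {a b : ℝ} (ha : 0 < a) (hb : 0 < b) (x : Fin N → ℝ) :
    ∫ y : Fin N → ℝ, pkt N (x - y) a * pk N y b = pkt N x (a + b) := by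
  have hb' := integrable_pk (N := N) hb
  have hc : ∀ {s : ℝ}, 0 < s → Continuous fun y : Fin N → ℝ => pk N (x - y) s := fun hs =>
    (continuous_pk hs).comp (by fun_prop)
  have hc' : ∀ {s : ℝ}, 0 < s → Continuous fun y : Fin N → ℝ => pkt N (x - y) s := fun hs =>
    (continuous_pkt hs).comp (by fun_prop)
  have h := hasDerivAt_integral_of_dominated_loc_of_deriv_le (μ := (volume : Measure (Fin N → ℝ)))
    (F := fun s y => pk N (x - y) s * pk N y b) (F' := fun s y => pkt N (x - y) s * pk N y b)
    (x₀ := a) (s := Set.Ioi (a / 2))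
    (bound := fun y => poiB N * ((a / 2) ^ (N + 1))⁻¹ * pk N y b)
    (Ioi_mem_nhds (by linarith))
    (by
      filter_upwards [lt_mem_nhds ha] with s hs
      exact ((hc hs).mul (continuous_pk hb)).aestronglyMeasurable)
    (by
      refine (hb'.const_mul (poiB N * (a * (a ^ (N + 1))⁻¹))).mono'
        ((hc ha).mul (continuous_pk hb)).aestronglyMeasurable (Eventually.of_forall fun y => ?_)
      rw [norm_mul, Real.norm_of_nonneg (pk_nonneg _ ha.le), Real.norm_of_nonneg (pk_nonneg _ hb.le)]
      refine mul_le_mul_of_nonneg_right ((pk_le (x - y) ha).trans ?_) (pk_nonneg _ hb.le)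
      have := poiB_pos N
      gcongr
      linarith [norm_nonneg (x - y)])
    ((hc' ha).mul (continuous_pk hb)).aestronglyMeasurable
    (Eventually.of_forall fun y s hs => by
      rw [norm_mul, Real.norm_of_nonneg (pk_nonneg y hb.le)]
      exact mul_le_mul_of_nonneg_right (abs_pkt_le_const _ (by positivity) (le_of_lt hs))
        (pk_nonneg _ hb.le))
    (hb'.const_mul _)
    (Eventually.of_forall fun y s hs =>
      (hasDerivAt_pk (x - y) (lt_trans (by positivity) hs)).mul_const _)
  refine h.2.unique ?_
  have h2 : HasDerivAt (fun s => pk N x (s + b)) (pkt N x (a + b)) a :=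
    (hasDerivAt_pk x (add_pos ha hb)).comp_add_const a b
  refine h2.congr_of_eventuallyEq ?_
  filter_upwards [lt_mem_nhds ha] with s hs using integral_pk_mul_pk hs hb x

lemma integral_pkt_mul_pkt {a b : ℝ} (ha : 0 < a) (hb : 0 < b) (x : Fin N → ℝ) :
    ∫ y : Fin N → ℝ, pkt N (x - y) a * pkt N y b = pktt N x (a + b) := by
  have ha' : Integrable fun y : Fin N → ℝ => pkt N (x - y) a :=
    (integrable_pkt (N := N) ha).comp_sub_left x
  have hc : ∀ {s : ℝ}, 0 < s → Continuous fun y : Fin N → ℝ => pkt N (x - y) s := fun hs =>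
    (continuous_pkt hs).comp (by fun_prop)
  have h := hasDerivAt_integral_of_dominated_loc_of_deriv_le (μ := (volume : Measure (Fin N → ℝ)))
    (F := fun s y => pkt N (x - y) a * pk N y s) (F' := fun s y => pkt N (x - y) a * pkt N y s)
    (x₀ := b) (s := Set.Ioi (b / 2))
    (bound := fun y => ‖pkt N (x - y) a‖ * (poiB N * ((b / 2) ^ (N + 1))⁻¹))
    (Ioi_mem_nhds (by linarith))
    (by
      filter_upwards [lt_mem_nhds hb] with s hs
      exact ((hc ha).mul (continuous_pk hs)).aestronglyMeasurable)
    (by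
      refine (ha'.norm.mul_const (poiB N * (b * (b ^ (N + 1))⁻¹))).mono'
        ((hc ha).mul (continuous_pk hb)).aestronglyMeasurable (Eventually.of_forall fun y => ?_)
      rw [norm_mul, Real.norm_of_nonneg (pk_nonneg y hb.le)]
      refine mul_le_mul_of_nonneg_left ((pk_le y hb).trans ?_) (norm_nonneg _)
      have := poiB_pos N
      gcongr
      linarith [norm_nonneg y])
    ((hc ha).mul (continuous_pkt hb)).aestronglyMeasurable
    (Eventually.of_forall fun y s hs => by
      rw [norm_mul]
      exact mul_le_mul_of_nonneg_left (abs_pkt_le_const _ (by positivity) (le_of_lt hs))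
        (norm_nonneg _))
    (ha'.norm.mul_const _)
    (Eventually.of_forall fun y s hs =>
      (hasDerivAt_pk y (lt_trans (by positivity) hs)).const_mul _)
  refine h.2.unique ?_
  have h2 : HasDerivAt (fun s => pkt N x (a + s)) (pktt N x (a + b)) b :=
    (hasDerivAt_pkt x (add_pos ha hb)).comp_const_add a b
  refine h2.congr_of_eventuallyEq ?_
  filter_upwards [lt_mem_nhds hb] with s hs using integral_pkt_mul_pk ha hs x

/-- The antiderivative in the Calderón reproducing formula. -/
def calW (N : ℕ) (y : Fin N → ℝ) (s : ℝ) : ℝ := pk N y s - s * pkt N y s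

lemma hasDerivAt_calW (y : Fin N → ℝ) {s : ℝ} (hs : 0 < s) :
    HasDerivAt (calW N y) (-(s * pktt N y s)) s := by
  have := (hasDerivAt_pk y hs).sub ((hasDerivAt_id s).mul (hasDerivAt_pkt y hs))
  refine this.congr_deriv ?_
  simp

lemma continuousOn_pktt (y : Fin N → ℝ) : ContinuousOn (pktt N y) (Set.Ioi 0) := by
  have h : ContinuousOn (ih y) (Set.Ioi 0) := fun s hs =>
    (hasDerivAt_ih y hs).continuousAt.continuousWithinAt
  unfold pktt
  fun_prop

lemma integral_pktt {ε R : ℝ} (hε : 0 < ε) (hR : ε ≤ R) (y : Fin N → ℝ) :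
    ∫ t in Set.Ioc ε R, 4 * t * pktt N y (t + t) = calW N y (2 * ε) - calW N y (2 * R) := by
  rw [← intervalIntegral.integral_of_le hR]
  have h := intervalIntegral.integral_eq_sub_of_hasDerivAt (a := ε) (b := R)
    (f := fun t => -calW N y (2 * t)) (f' := fun t => 4 * t * pktt N y (t + t)) ?_ ?_
  · rw [h]; ring
  · intro t ht
    rw [Set.uIcc_of_le hR] at ht
    have ht0 : 0 < t := hε.trans_le ht.1
    have h1 := (((hasDerivAt_calW y (show 0 < 2 * t by positivity)).comp t
      ((hasDerivAt_id t).const_mul 2))).neg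
    refine h1.congr_deriv ?_
    simp only [mul_one, ← two_mul]
    ring
  · refine ContinuousOn.intervalIntegrable ?_
    rw [Set.uIcc_of_le hR]
    refine ContinuousOn.mul (by fun_prop) ((continuousOn_pktt y).comp (by fun_prop) ?_)
    intro t ht
    have ht0 : 0 < t := hε.trans_le ht.1
    exact Set.mem_Ioi.2 (by positivity)

lemma integrable_calW {s : ℝ} (hs : 0 < s) : Integrable (fun y : Fin N → ℝ => calW N y s) :=
  (integrable_pk hs).sub ((integrable_pkt hs).const_mul s)

lemma integral_calW {s : ℝ} (hs : 0 < s) : ∫ y : Fin N → ℝ, calW N y s = 1 := by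
  unfold calW
  rw [integral_sub (integrable_pk hs) ((integrable_pkt hs).const_mul s), integral_pk hs,
    integral_const_mul, integral_pkt hs]
  ring

lemma continuous_calW {s : ℝ} (hs : 0 < s) : Continuous (fun y : Fin N → ℝ => calW N y s) :=
  (continuous_pk hs).sub ((continuous_pkt hs).const_mul s)

lemma ih_smul (v : Fin N → ℝ) {s : ℝ} (hs : 0 < s) : ih (s • v) s = s⁻¹ * ih v 1 := by
  unfold ih
  have : (∑ i, (s • v) i ^ 2) + s ^ 2 = s ^ 2 * ((∑ i, v i ^ 2) + 1 ^ 2) := by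
    simp [mul_pow, Finset.mul_sum, mul_add]
  rw [this, Real.sqrt_mul (by positivity), Real.sqrt_sq hs.le, mul_inv]

lemma calW_smul (v : Fin N → ℝ) {s : ℝ} (hs : 0 < s) :
    s ^ N * calW N (s • v) s = calW N v 1 := by
  unfold calW
  rw [pk_eq_ih, pk_eq_ih, pkt, pkt, ih_smul v hs]
  simp only [mul_pow, inv_pow, one_pow, pow_succ]
  field_simp

lemma abs_calW_le (y : Fin N → ℝ) {s : ℝ} (hs : 0 < s) :
    |calW N y s| ≤ 2 * poiB N * (s ^ N)⁻¹ := by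
  have hB := poiB_pos N
  unfold calW
  refine (abs_sub _ _).trans ?_
  rw [abs_mul, abs_of_pos hs, abs_of_nonneg (pk_nonneg y hs.le)]
  have h1 : pk N y s ≤ poiB N * (s * (s ^ (N + 1))⁻¹) := by
    refine (pk_le y hs).trans ?_
    gcongr
    linarith [norm_nonneg y]
  have h2 := mul_le_mul_of_nonneg_left (abs_pkt_le_const y hs le_rfl) hs.le
  refine (add_le_add h1 h2).trans (le_of_eq ?_)
  rw [pow_succ]
  field_simp
  ring

end poisson

variable {N : ℕ}

lemma abs_calW_le_pk (y : Fin N → ℝ) {s : ℝ} (hs : 0 < s) :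
    |calW N y s| ≤ (N + 3) * pk N y s := by
  unfold calW
  refine (abs_sub _ _).trans ?_
  rw [abs_mul, abs_of_pos hs, abs_of_nonneg (pk_nonneg y hs.le)]
  have h := mul_le_mul_of_nonneg_left (abs_pkt_le_pk y hs le_rfl) hs.le
  have : s * ((N + 2) / s * pk N y s) = (N + 2) * pk N y s := by field_simp
  linarith

/-- Convolution with the approximate identity `calW`. -/
def calWconv (N : ℕ) (κ : (Fin N → ℝ) → ℝ) (s : ℝ) (z : Fin N → ℝ) : ℝ :=
  ∫ x, κ x * calW N (z - x) s

lemma calWconv_eq (κ : (Fin N → ℝ) → ℝ) {s : ℝ} (hs : 0 < s) (z : Fin N → ℝ) :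
    calWconv N κ s z = ∫ v, κ (z - s • v) * calW N v 1 := by
  have h1 : calWconv N κ s z = ∫ x, κ (z - x) * calW N x s := by
    unfold calWconv
    rw [← integral_sub_left_eq_self (fun x => κ x * calW N (z - x) s) volume z]
    simp
  have h2 := Measure.integral_comp_smul (volume : Measure (Fin N → ℝ))
    (fun x => κ (z - x) * calW N x s) s
  rw [Module.finrank_fin_fun, abs_of_pos (by positivity), smul_eq_mul] at h2
  rw [h1]
  calc _ = s ^ N * ∫ v, κ (z - s • v) * calW N (s • v) s := by rw [h2]; field_simp
    _ = _ := by
      rw [← integral_const_mul]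
      congr 1 with v
      rw [← calW_smul v hs]; ring

lemma abs_calWconv_le {κ : (Fin N → ℝ) → ℝ} {M : ℝ} (hM : ∀ x, |κ x| ≤ M) {s : ℝ} (hs : 0 < s)
    (z : Fin N → ℝ) : |calWconv N κ s z| ≤ M * (N + 3) := by
  have hM0 : 0 ≤ M := (abs_nonneg _).trans (hM 0)
  have h : ∫ x : Fin N → ℝ, M * ((N + 3) * pk N (z - x) s) = M * (N + 3) := by
    rw [integral_const_mul, integral_const_mul,
      integral_sub_left_eq_self (fun x : Fin N → ℝ => pk N x s) volume z, integral_pk hs, mul_one]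
  rw [← h, ← Real.norm_eq_abs]
  unfold calWconv
  have hi : Integrable fun x : Fin N → ℝ => M * ((N + 3) * pk N (z - x) s) :=
    (((integrable_pk (N := N) hs).comp_sub_left z).const_mul _).const_mul _
  refine norm_integral_le_of_norm_le hi (Eventually.of_forall fun x => ?_)
  rw [Real.norm_eq_abs, abs_mul]
  gcongr
  · exact hM x
  · exact abs_calW_le_pk _ hs

lemma tendsto_calWconv_zero {κ : (Fin N → ℝ) → ℝ} (hκ : Integrable κ) {M : ℝ}
    (hM : ∀ x, |κ x| ≤ M) {z : Fin N → ℝ} (hz : ContinuousAt κ z) :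
    Tendsto (fun s => calWconv N κ s z) (𝓝[>] 0) (𝓝 (κ z)) := by
  have h : Tendsto (fun s : ℝ => ∫ v, κ (z - s • v) * calW N v 1) (𝓝[>] 0)
      (𝓝 (∫ v, κ z * calW N v 1)) := by
    refine tendsto_integral_filter_of_dominated_convergence (fun v => M * |calW N v 1|) ?_ ?_ ?_ ?_
    · filter_upwards [self_mem_nhdsWithin] with s hs
      have h1 : Integrable (fun v => κ (z - s • v)) :=
        (hκ.comp_sub_left z).comp_smul (ne_of_gt hs)
      exact h1.1.mul (continuous_calW one_pos).aestronglyMeasurable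
    · refine Eventually.of_forall fun s => Eventually.of_forall fun v => ?_
      rw [Real.norm_eq_abs, abs_mul]
      gcongr
      exact hM _
    · exact (integrable_calW one_pos).abs.const_mul _
    · refine Eventually.of_forall fun v => Tendsto.mul_const _ ?_
      refine hz.tendsto.comp ?_
      have : Tendsto (fun s : ℝ => z - s • v) (𝓝 0) (𝓝 (z - (0 : ℝ) • v)) :=
        Continuous.tendsto (by fun_prop) 0
      rw [zero_smul, sub_zero] at this
      exact this.mono_left nhdsWithin_le_nhds
  rw [integral_const_mul, integral_calW one_pos, mul_one] at h
  refine h.congr' ?_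
  filter_upwards [self_mem_nhdsWithin] with s hs
  rw [calWconv_eq κ hs]

lemma tendsto_calWconv_atTop (hN : 0 < N) {κ : (Fin N → ℝ) → ℝ} (hκ : Integrable κ)
    (z : Fin N → ℝ) : Tendsto (fun s => calWconv N κ s z) atTop (𝓝 0) := by
  have hb : Tendsto (fun s : ℝ => 2 * poiB N * (s ^ N)⁻¹ * ∫ x, |κ x|) atTop (𝓝 0) := by
    have := ((tendsto_pow_atTop (α := ℝ) hN.ne').inv_tendsto_atTop.const_mul
      (2 * poiB N)).mul_const (∫ x, |κ x|)
    simpa using this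
  refine squeeze_zero_norm' ?_ hb
  filter_upwards [eventually_gt_atTop 0] with s hs
  unfold calWconv
  rw [← integral_const_mul]
  refine norm_integral_le_of_norm_le (hκ.abs.const_mul _) (Eventually.of_forall fun x => ?_)
  rw [Real.norm_eq_abs, abs_mul, mul_comm]
  gcongr
  exact abs_calW_le _ hs

/-- The hyperbolic measure `dy dt / t` on the upper half-space. -/
def hm (N : ℕ) : Measure ((Fin N → ℝ) × ℝ) :=
  (volume.prod (volume.restrict (Set.Ioi 0))).withDensity fun p => ENNReal.ofReal p.2⁻¹

/-- `t ∂_t` of the Poisson extension of `f`. -/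
def qint (f : (Fin N → ℝ) → ℝ) (p : (Fin N → ℝ) × ℝ) : ℝ :=
  ∫ z, f z * (p.2 * pkt N (p.1 - z) p.2)

lemma lintegral_hm (F : (Fin N → ℝ) × ℝ → ℝ≥0∞) :
    ∫⁻ p, F p ∂hm N = ∫⁻ p, ENNReal.ofReal p.2⁻¹ * F p
      ∂((volume : Measure (Fin N → ℝ)).prod (volume.restrict (Set.Ioi 0))) := by
  unfold hm
  rw [lintegral_withDensity_eq_lintegral_mul_non_measurable _ (by fun_prop) (by simp)]
  rfl

section Truncated

variable {f κ : (Fin N → ℝ) → ℝ} {ε R : ℝ}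

/-- Lebesgue measure on a horizontal slab of the upper half-space. -/
abbrev slab (N : ℕ) (ε R : ℝ) : Measure ((Fin N → ℝ) × ℝ) :=
  volume.prod (volume.restrict (Set.Ioc ε R))

lemma ae_mem_Ioc_prod : ∀ᵐ p : (Fin N → ℝ) × ℝ ∂slab N ε R, p.2 ∈ Set.Ioc ε R :=
  Measure.quasiMeasurePreserving_snd.ae (ae_restrict_mem measurableSet_Ioc)

lemma abs_kernel_prod_le (hε : 0 < ε) (z x : Fin N → ℝ) {p : (Fin N → ℝ) × ℝ}
    (hp : p.2 ∈ Set.Ioc ε R) :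
    |4 * p.2 * (pkt N (p.1 - z) p.2 * pkt N (p.1 - x) p.2)| ≤
      4 * R * (((N + 2) / ε * pk N (p.1 - z) ε) * (poiB N * (ε ^ (N + 1))⁻¹)) := by
  have h0 : 0 < p.2 := hε.trans hp.1
  rw [abs_mul, abs_mul, abs_mul, abs_of_pos h0, abs_of_pos (by norm_num : (0:ℝ) < 4)]
  have := pk_nonneg (p.1 - z) hε.le
  have := poiB_pos N
  gcongr
  · linarith [hp.2]
  · exact hp.2
  · exact abs_pkt_le_pk _ hε hp.1.le
  · exact abs_pkt_le_const _ hε hp.1.le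

lemma integrable_pk_Ioc (hε : 0 < ε) (z : Fin N → ℝ) :
    Integrable (fun p : (Fin N → ℝ) × ℝ => pk N (p.1 - z) ε) (slab N ε R) := by
  have h := ((integrable_pk (N := N) hε).comp_sub_right z).mul_prod
    (integrable_const (μ := volume.restrict (Set.Ioc ε R)) (1 : ℝ))
  simpa using h

lemma integral_pk_Ioc (hε : 0 < ε) (hR : ε ≤ R) (z : Fin N → ℝ) :
    ∫ p : (Fin N → ℝ) × ℝ, pk N (p.1 - z) ε ∂slab N ε R = R - ε := by
  have h := integral_prod_mul (μ := (volume : Measure (Fin N → ℝ)))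
    (ν := volume.restrict (Set.Ioc ε R)) (fun y => pk N (y - z) ε) (fun _ => (1 : ℝ))
  simp only [mul_one] at h
  rw [h, integral_sub_right_eq_self (fun x => pk N x ε) z, integral_pk hε]
  simp [hR]

lemma measurable_kernel_prod : Measurable fun q : ((Fin N → ℝ) × ℝ) × (Fin N → ℝ) × (Fin N → ℝ) =>
    4 * q.1.2 * (pkt N (q.1.1 - q.2.1) q.1.2 * pkt N (q.1.1 - q.2.2) q.1.2) := by
  have h1 : Measurable fun q : ((Fin N → ℝ) × ℝ) × (Fin N → ℝ) × (Fin N → ℝ) =>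
      pkt N (q.1.1 - q.2.1) q.1.2 :=
    measurable_pkt.comp (f := fun q : ((Fin N → ℝ) × ℝ) × (Fin N → ℝ) × (Fin N → ℝ) =>
      (q.1.1 - q.2.1, q.1.2)) (by fun_prop)
  have h2 : Measurable fun q : ((Fin N → ℝ) × ℝ) × (Fin N → ℝ) × (Fin N → ℝ) =>
      pkt N (q.1.1 - q.2.2) q.1.2 :=
    measurable_pkt.comp (f := fun q : ((Fin N → ℝ) × ℝ) × (Fin N → ℝ) × (Fin N → ℝ) =>
      (q.1.1 - q.2.2, q.1.2)) (by fun_prop)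
  fun_prop

lemma integrable_kernel_prod (hε : 0 < ε) (z x : Fin N → ℝ) :
    Integrable (fun p : (Fin N → ℝ) × ℝ =>
      4 * p.2 * (pkt N (p.1 - z) p.2 * pkt N (p.1 - x) p.2)) (slab N ε R) := by
  refine Integrable.mono' (g := fun p => 4 * R * (((N + 2) / ε * pk N (p.1 - z) ε) *
    (poiB N * (ε ^ (N + 1))⁻¹))) ?_ ?_ ?_
  · exact (((integrable_pk_Ioc hε z).const_mul _).mul_const _).const_mul _
  · exact (measurable_kernel_prod.comp
      (measurable_id.prodMk (measurable_const (a := (z, x))))).aestronglyMeasurable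
  · filter_upwards [ae_mem_Ioc_prod] with p hp
    exact abs_kernel_prod_le hε z x hp

lemma integral_kernel_prod (hε : 0 < ε) (hR : ε ≤ R) (z x : Fin N → ℝ) :
    ∫ p : (Fin N → ℝ) × ℝ, 4 * p.2 * (pkt N (p.1 - z) p.2 * pkt N (p.1 - x) p.2) ∂slab N ε R =
      calW N (z - x) (2 * ε) - calW N (z - x) (2 * R) := by
  rw [integral_prod_symm _ (integrable_kernel_prod hε z x), ← integral_pktt hε hR]
  refine setIntegral_congr_fun measurableSet_Ioc fun t ht => ?_
  have ht0 : 0 < t := hε.trans ht.1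
  simp only
  rw [integral_const_mul, ← integral_pkt_mul_pkt ht0 ht0,
    ← integral_add_right_eq_self _ x]
  congr 2 with y
  rw [pkt_sub_comm]
  congr 2 <;> abel_nf

lemma integrable_quad (hε : 0 < ε) (hR : ε ≤ R) (hf : Integrable f) (hκ : Integrable κ) :
    Integrable (fun q : ((Fin N → ℝ) × ℝ) × (Fin N → ℝ) × (Fin N → ℝ) =>
      (f q.2.1 * κ q.2.2) *
        (4 * q.1.2 * (pkt N (q.1.1 - q.2.1) q.1.2 * pkt N (q.1.1 - q.2.2) q.1.2)))
      ((slab N ε R).prod (volume.prod volume)) := by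
  have hfk := hf.mul_prod hκ
  have hm : AEStronglyMeasurable (fun q : ((Fin N → ℝ) × ℝ) × (Fin N → ℝ) × (Fin N → ℝ) =>
      (f q.2.1 * κ q.2.2) *
        (4 * q.1.2 * (pkt N (q.1.1 - q.2.1) q.1.2 * pkt N (q.1.1 - q.2.2) q.1.2)))
      ((slab N ε R).prod (volume.prod volume)) :=
    (hfk.1.comp_snd).mul measurable_kernel_prod.aestronglyMeasurable
  rw [integrable_prod_iff' hm]
  refine ⟨Eventually.of_forall fun q =>
    (integrable_kernel_prod (R := R) hε q.1 q.2).const_mul (f q.1 * κ q.2), ?_⟩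
  refine Integrable.mono' (g := fun q => ‖f q.1 * κ q.2‖ *
    (4 * R * (((N + 2) / ε * (R - ε)) * (poiB N * (ε ^ (N + 1))⁻¹)))) (hfk.norm.mul_const _)
    hm.norm.prod_swap.integral_prod_right' (Eventually.of_forall fun q => ?_)
  rw [Real.norm_eq_abs, abs_of_nonneg (integral_nonneg fun _ => norm_nonneg _)]
  simp only [norm_mul (f q.1 * κ q.2)]
  rw [integral_const_mul ‖f q.1 * κ q.2‖, ← integral_pk_Ioc hε hR q.1,
    ← integral_const_mul ((N + 2) / ε), ← integral_mul_const, ← integral_const_mul (4 * R)]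
  refine mul_le_mul_of_nonneg_left (integral_mono_ae (integrable_kernel_prod hε q.1 q.2).norm
    ((((integrable_pk_Ioc hε q.1).const_mul _).mul_const _).const_mul _) ?_) (norm_nonneg _)
  filter_upwards [ae_mem_Ioc_prod] with p hp
  exact abs_kernel_prod_le hε _ _ hp

lemma integrable_calW_quad (hf : Integrable f) (hκ : Integrable κ) {s : ℝ} (hs : 0 < s) :
    Integrable (fun q : (Fin N → ℝ) × (Fin N → ℝ) => (f q.1 * κ q.2) * calW N (q.1 - q.2) s) := by
  refine (hf.mul_prod hκ).mul_bdd (c := 2 * poiB N * (s ^ N)⁻¹)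
    ((continuous_calW hs).comp (by fun_prop)).aestronglyMeasurable
    (Eventually.of_forall fun q => ?_)
  exact abs_calW_le _ hs

lemma integral_calW_quad (hf : Integrable f) (hκ : Integrable κ) {s : ℝ} (hs : 0 < s) :
    ∫ q : (Fin N → ℝ) × (Fin N → ℝ), (f q.1 * κ q.2) * calW N (q.1 - q.2) s =
      ∫ z, f z * calWconv N κ s z := by
  refine (integral_prod _ (integrable_calW_quad hf hκ hs)).trans ?_
  unfold calWconv
  congr 1 with z
  rw [← integral_const_mul]
  congr 1 with x
  ring

lemma integral_qint_mul_qint (hε : 0 < ε) (hR : ε ≤ R) (hf : Integrable f) (hκ : Integrable κ) :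
    ∫ p : (Fin N → ℝ) × ℝ, 4 * p.2⁻¹ * (qint f p * qint κ p) ∂slab N ε R =
      (∫ z, f z * calWconv N κ (2 * ε) z) - ∫ z, f z * calWconv N κ (2 * R) z := by
  have hR0 := hε.trans_le hR
  have hI := integrable_quad hε hR hf hκ
  rw [← integral_calW_quad hf hκ (by positivity), ← integral_calW_quad hf hκ (by positivity),
    ← integral_sub (integrable_calW_quad hf hκ (by positivity))
    (integrable_calW_quad hf hκ (by positivity))]
  calc _ = ∫ p : (Fin N → ℝ) × ℝ, (∫ q : (Fin N → ℝ) × (Fin N → ℝ), (f q.1 * κ q.2) *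
        (4 * p.2 * (pkt N (p.1 - q.1) p.2 * pkt N (p.1 - q.2) p.2))) ∂slab N ε R := by
        refine integral_congr_ae ?_
        filter_upwards [ae_mem_Ioc_prod] with p hp
        have h0 : p.2 ≠ 0 := (hε.trans hp.1).ne'
        unfold qint
        rw [← integral_prod_mul, ← integral_const_mul]
        refine integral_congr_ae (Eventually.of_forall fun q => ?_)
        simp only
        field_simp
    _ = _ := by
        refine (integral_integral_swap (f := fun (p : (Fin N → ℝ) × ℝ)
          (q : (Fin N → ℝ) × (Fin N → ℝ)) => (f q.1 * κ q.2) *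
          (4 * p.2 * (pkt N (p.1 - q.1) p.2 * pkt N (p.1 - q.2) p.2))) hI).trans ?_
        refine integral_congr_ae (Eventually.of_forall fun q => ?_)
        simp only
        rw [integral_const_mul, integral_kernel_prod hε hR]
        ring

lemma enorm_calWconv_sub_le (hε : 0 < ε) (hR : ε ≤ R) (hf : Integrable f) (hκ : Integrable κ) :
    ‖(∫ z, f z * calWconv N κ (2 * ε) z) - ∫ z, f z * calWconv N κ (2 * R) z‖ₑ ≤
      4 * ∫⁻ p, ‖qint κ p‖ₑ * ‖qint f p‖ₑ ∂hm N := by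
  rw [← integral_qint_mul_qint hε hR hf hκ, lintegral_hm,
    ← lintegral_const_mul' _ _ (by norm_num)]
  refine (enorm_integral_le_lintegral_enorm _).trans ?_
  refine (lintegral_mono_ae ?_).trans (lintegral_mono'
    (Measure.prod_mono le_rfl (Measure.restrict_mono (s' := Set.Ioi 0) (fun t ht => hε.trans ht.1) le_rfl)) le_rfl)
  filter_upwards [ae_mem_Ioc_prod] with p hp
  have h0 : 0 < p.2 := hε.trans hp.1
  rw [enorm_mul, enorm_mul, enorm_mul, Real.enorm_eq_ofReal (inv_pos.2 h0).le,
    Real.enorm_eq_ofReal (by norm_num : (0 : ℝ) ≤ 4)]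
  simp only [ENNReal.ofReal_ofNat]
  rw [mul_assoc, mul_comm ‖qint f p‖ₑ]

end Truncated

/-- A Calderón reproducing inequality. -/
lemma enorm_integral_mul_le_qint (hN : 0 < N) {f κ : (Fin N → ℝ) → ℝ} (hf : Integrable f)
    (hκ : Integrable κ) {M : ℝ} (hM : ∀ x, |κ x| ≤ M) (hc : ∀ᵐ x, ContinuousAt κ x) :
    ‖∫ z, f z * κ z‖ₑ ≤ 4 * ∫⁻ p, ‖qint κ p‖ₑ * ‖qint f p‖ₑ ∂hm N := by
  have hmeas : ∀ {s : ℝ}, 0 < s → AEStronglyMeasurable (fun z => f z * calWconv N κ s z) := by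
    intro s hs
    have := (integrable_calW_quad hf hκ hs).integral_prod_left
    refine this.1.congr (Eventually.of_forall fun z => ?_)
    unfold calWconv
    simp only
    rw [← integral_const_mul]
    congr 1 with x
    ring
  have key : ∀ {l : Filter ℝ} [l.IsCountablyGenerated] (g : (Fin N → ℝ) → ℝ), (∀ᶠ s in l, 0 < s) →
      (∀ᵐ z, Tendsto (fun s => calWconv N κ s z) l (𝓝 (g z))) →
      Tendsto (fun s => ∫ z, f z * calWconv N κ s z) l (𝓝 (∫ z, f z * g z)) := by
    intro l _ g hl hg
    refine tendsto_integral_filter_of_dominated_convergence (fun z => |f z| * (M * (N + 3)))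
      ?_ ?_ ?_ ?_
    · filter_upwards [hl] with s hs using hmeas hs
    · filter_upwards [hl] with s hs
      refine Eventually.of_forall fun z => ?_
      rw [Real.norm_eq_abs, abs_mul]
      gcongr
      exact abs_calWconv_le hM hs z
    · exact hf.abs.mul_const _
    · filter_upwards [hg] with z hz using hz.const_mul _
  have h0 := key (l := 𝓝[>] 0) κ self_mem_nhdsWithin
    (by filter_upwards [hc] with z hz using tendsto_calWconv_zero hκ hM hz)
  have h1 := key (l := atTop) (fun _ => 0) (eventually_gt_atTop 0)
    (Eventually.of_forall fun z => tendsto_calWconv_atTop hN hκ z)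
  have ha : Tendsto (fun m : ℕ => 2 * (1 / ((m : ℝ) + 1))) atTop (𝓝[>] 0) := by
    refine tendsto_nhdsWithin_iff.2 ⟨?_, Eventually.of_forall fun m => ?_⟩
    · simpa using (tendsto_one_div_add_atTop_nhds_zero_nat (𝕜 := ℝ)).const_mul 2
    · simp only [Set.mem_Ioi]; positivity
  have hb : Tendsto (fun m : ℕ => 2 * ((m : ℝ) + 1)) atTop atTop :=
    (tendsto_atTop_add_const_right _ _ tendsto_natCast_atTop_atTop).const_mul_atTop (by norm_num)
  have h2 := ((h0.comp ha).sub (h1.comp hb)).enorm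
  simp only [mul_zero, integral_zero, sub_zero] at h2
  refine le_of_tendsto h2 (Eventually.of_forall fun m => ?_)
  refine enorm_calWconv_sub_le (by positivity) ?_ hf hκ
  rw [div_le_iff₀ (by positivity)]
  nlinarith [(Nat.cast_nonneg m : (0 : ℝ) ≤ m)]

/-! ### Dyadic cubes -/

lemma mem_dcube_comm {c : Fin N → ℝ} {k : ℤ} {x z : Fin N → ℝ} :
    z ∈ dcube c k x ↔ x ∈ dcube c k z := by
  simp only [dcube, Set.mem_setOf_eq, eq_comm]

lemma mem_dcube_self (c : Fin N → ℝ) (k : ℤ) (x : Fin N → ℝ) : x ∈ dcube c k x := fun _ => rfl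

lemma dcube_eq_of_mem {c : Fin N → ℝ} {k : ℤ} {x z : Fin N → ℝ} (h : z ∈ dcube c k x) :
    dcube c k z = dcube c k x := by
  ext w
  simp only [dcube, Set.mem_setOf_eq] at h ⊢
  exact forall_congr' fun i => by rw [h i]

lemma dcube_eq_pi (c : Fin N → ℝ) (k : ℤ) (x : Fin N → ℝ) :
    dcube c k x = Set.univ.pi fun i => Set.Ico (c i + (2 : ℝ) ^ k * ⌊(x i - c i) / (2 : ℝ) ^ k⌋)
      (c i + (2 : ℝ) ^ k * (⌊(x i - c i) / (2 : ℝ) ^ k⌋ + 1)) := by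
  have h2 : (0 : ℝ) < 2 ^ k := by positivity
  ext y
  simp only [dcube, Set.mem_setOf_eq, Set.mem_univ_pi, Set.mem_Ico, Int.floor_eq_iff]
  refine forall_congr' fun i => and_congr ?_ ?_
  · rw [le_div_iff₀ h2, mul_comm, le_sub_iff_add_le']
  · rw [div_lt_iff₀ h2, mul_comm, sub_lt_iff_lt_add']

lemma measurableSet_dcube (c : Fin N → ℝ) (k : ℤ) (x : Fin N → ℝ) :
    MeasurableSet (dcube c k x) := by
  rw [dcube_eq_pi]
  exact MeasurableSet.univ_pi fun i => measurableSet_Ico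

lemma volume_dcube (c : Fin N → ℝ) (k : ℤ) (x : Fin N → ℝ) :
    volume (dcube c k x) = ENNReal.ofReal (((2 : ℝ) ^ k) ^ N) := by
  rw [dcube_eq_pi, Real.volume_pi_Ico]
  simp only [mul_add, mul_one, add_sub_add_left_eq_sub, add_sub_cancel_left]
  rw [Finset.prod_const, Finset.card_univ, Fintype.card_fin, ENNReal.ofReal_pow (by positivity)]

lemma norm_sub_le_of_mem_dcube {c : Fin N → ℝ} {k : ℤ} {x z : Fin N → ℝ} (h : z ∈ dcube c k x) :
    ‖x - z‖ ≤ 2 ^ k := by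
  have h2 : (0 : ℝ) < 2 ^ k := by positivity
  rw [pi_norm_le_iff_of_nonneg h2.le]
  intro i
  have hz := h
  have hx := mem_dcube_self c k x
  rw [dcube_eq_pi] at hz hx
  have h1 := hz i trivial
  have h3 := hx i trivial
  simp only [Set.mem_Ico] at h1 h3
  rw [Pi.sub_apply, Real.norm_eq_abs, abs_le]
  constructor <;> linarith

lemma volume_frontier_dcube (c : Fin N → ℝ) (k : ℤ) (x : Fin N → ℝ) :
    volume (frontier (dcube c k x)) = 0 := by
  refine Convex.addHaar_frontier _ ?_
  rw [dcube_eq_pi]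
  exact convex_pi fun i _ => convex_Ico _ _

/-! ### The random offsets -/

/-- The integer whose binary digits are the first `K` digits of `v`. -/
def digitSum (K : ℕ) (v : ℝ) : ℝ :=
  ∑ j ∈ Finset.range K, (if ⌊v * 2 ^ (j + 1)⌋ % 2 = 1 then (2 : ℝ) ^ j else 0)

lemma randOffset1_eq (u v : ℝ) (k : ℤ) : randOffset1 u v k = u - 1 - digitSum k.toNat v := rfl

@[fun_prop]
lemma measurable_digitSum (K : ℕ) : Measurable (digitSum K) := by
  refine Finset.measurable_fun_sum _ fun j _ => Measurable.ite ?_ measurable_const measurable_const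
  have h : Measurable fun v : ℝ => ⌊v * 2 ^ (j + 1)⌋ :=
    Int.measurable_floor.comp (by fun_prop)
  exact h (MeasurableSet.of_discrete (s := {m : ℤ | m % 2 = 1}))

lemma digitSum_half (K : ℕ) {v : ℝ} (hv : v ∈ Set.Ico (0 : ℝ) 1) :
    digitSum (K + 1) (v / 2) = 2 * digitSum K v := by
  unfold digitSum
  rw [Finset.sum_range_succ', Finset.mul_sum]
  have h0 : ⌊v / 2 * 2 ^ (0 + 1)⌋ = 0 := by
    rw [Int.floor_eq_zero_iff]; simpa using hv
  rw [h0]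
  simp only [EuclideanDomain.zero_mod, zero_ne_one, if_false, add_zero]
  refine Finset.sum_congr rfl fun j _ => ?_
  rw [show v / 2 * 2 ^ (j + 1 + 1) = v * 2 ^ (j + 1) by ring]
  split_ifs <;> ring

lemma digitSum_half_add (K : ℕ) {v : ℝ} (hv : v ∈ Set.Ico (0 : ℝ) 1) :
    digitSum (K + 1) ((1 + v) / 2) = 1 + 2 * digitSum K v := by
  unfold digitSum
  rw [Finset.sum_range_succ', Finset.mul_sum, add_comm]
  have h0 : ⌊(1 + v) / 2 * 2 ^ (0 + 1)⌋ = 1 := by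
    rw [Int.floor_eq_iff]
    have := hv.1; have := hv.2
    constructor <;> norm_num <;> linarith
  rw [h0]
  congr 1
  refine Finset.sum_congr rfl fun j _ => ?_
  have : ⌊(1 + v) / 2 * 2 ^ (j + 1 + 1)⌋ = ⌊v * 2 ^ (j + 1)⌋ + 2 * 2 ^ j := by
    rw [show (1 + v) / 2 * 2 ^ (j + 1 + 1) = v * 2 ^ (j + 1) + ((2 * 2 ^ j : ℤ) : ℝ) by
      push_cast; ring, Int.floor_add_intCast]
  rw [this, Int.add_mul_emod_self_left]
  split_ifs <;> ring

lemma sum_range_two_mul {M : Type*} [AddCommMonoid M] (φ : ℕ → M) (m : ℕ) :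
    ∑ d ∈ Finset.range (2 * m), φ d = ∑ d ∈ Finset.range m, (φ (2 * d) + φ (2 * d + 1)) := by
  induction m with
  | zero => simp
  | succ m ih =>
    rw [Finset.sum_range_succ, ← ih, show 2 * (m + 1) = 2 * m + 1 + 1 by ring,
      Finset.sum_range_succ, Finset.sum_range_succ, add_assoc]

lemma setLIntegral_Ico_comp_half (φ : ℝ → ℝ≥0∞) (hφ : Measurable φ) (a : ℝ) :
    ∫⁻ v in Set.Ico (a / 2) ((a + 1) / 2), φ v =
      2⁻¹ * ∫⁻ v in Set.Ico (0 : ℝ) 1, φ ((a + v) / 2) := by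
  have h : Measure.map (fun v : ℝ => (a + v) / 2) volume = ENNReal.ofReal 2 • volume := by
    have h1 := Real.map_volume_mul_left (a := (2 : ℝ)⁻¹) (by norm_num)
    have h2 : (fun v : ℝ => (a + v) / 2) = (fun v => 2⁻¹ * v) ∘ (fun v => a + v) := by
      ext v; simp only [Function.comp]; ring
    rw [h2, ← Measure.map_map (by fun_prop) (by fun_prop), map_add_left_eq_self, h1]
    norm_num
  have h3 : ∫⁻ v in Set.Ico (0 : ℝ) 1, φ ((a + v) / 2) =
      2 * ∫⁻ v in Set.Ico (a / 2) ((a + 1) / 2), φ v := by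
    have hpre : (fun v : ℝ => (a + v) / 2) ⁻¹' Set.Ico (a / 2) ((a + 1) / 2) = Set.Ico 0 1 := by
      ext v
      simp only [Set.mem_preimage, Set.mem_Ico]
      constructor <;> rintro ⟨h1, h2⟩ <;> constructor <;> linarith
    rw [← hpre, ← setLIntegral_map measurableSet_Ico hφ (by fun_prop), h,
      Measure.restrict_smul, lintegral_smul_measure]
    simp
  rw [h3, ← mul_assoc, ENNReal.inv_mul_cancel (by norm_num) (by norm_num), one_mul]

lemma lintegral_digitSum (K : ℕ) (φ : ℝ → ℝ≥0∞) (hφ : Measurable φ) :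
    ∫⁻ v in Set.Ico (0 : ℝ) 1, φ (digitSum K v) =
      2⁻¹ ^ K * ∑ d ∈ Finset.range (2 ^ K), φ d := by
  induction K generalizing φ with
  | zero => simp [digitSum]
  | succ K ih =>
    have hsplit : Set.Ico (0 : ℝ) 1 = Set.Ico (0 / 2) ((0 + 1) / 2) ∪ Set.Ico (1 / 2) ((1 + 1) / 2) := by
      norm_num
    have hmeas : Measurable fun v => φ (digitSum (K + 1) v) := hφ.comp (measurable_digitSum _)
    rw [hsplit, lintegral_union measurableSet_Ico (by
      refine Set.disjoint_left.2 fun v h1 h2 => ?_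
      have := h1.2; have := h2.1; linarith),
      setLIntegral_Ico_comp_half _ hmeas, setLIntegral_Ico_comp_half _ hmeas]
    have e0 : ∫⁻ v in Set.Ico (0 : ℝ) 1, φ (digitSum (K + 1) ((0 + v) / 2)) =
        ∫⁻ v in Set.Ico (0 : ℝ) 1, φ (2 * digitSum K v) :=
      setLIntegral_congr_fun measurableSet_Ico fun v hv => by
        simp only [zero_add]; rw [digitSum_half K hv]
    have e1 : ∫⁻ v in Set.Ico (0 : ℝ) 1, φ (digitSum (K + 1) ((1 + v) / 2)) =
        ∫⁻ v in Set.Ico (0 : ℝ) 1, φ (1 + 2 * digitSum K v) :=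
      setLIntegral_congr_fun measurableSet_Ico fun v hv => by
        rw [digitSum_half_add K hv]
    rw [e0, e1, ih (fun s => φ (2 * s)) (by fun_prop), ih (fun s => φ (1 + 2 * s)) (by fun_prop),
      ← mul_add, ← mul_add, ← Finset.sum_add_distrib, ← mul_assoc, pow_succ' 2 K,
      sum_range_two_mul (fun d => φ d), pow_succ']
    congr 1
    refine Finset.sum_congr rfl fun d _ => ?_
    push_cast
    rw [add_comm (1 : ℝ)]

/-- In a window of length `h`, the shifts of `hℤ` separating `a` and `b` have measure at most
`b - a`. -/
lemma volume_separating_le {a b h : ℝ} (hh : 0 < h) (hab : a ≤ b) (c : ℝ) :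
    volume ({s : ℝ | ⌊(a - s) / h⌋ ≠ ⌊(b - s) / h⌋} ∩ Set.Ico c (c + h)) ≤
      ENNReal.ofReal (b - a) := by
  obtain ⟨m, a', b', ha, hb, hac, hac'⟩ : ∃ (m : ℤ) (a' b' : ℝ), a = a' + m * h ∧ b = b' + m * h ∧
      c ≤ a' ∧ a' < c + h := by
    refine ⟨⌊(a - c) / h⌋, a - ⌊(a - c) / h⌋ * h, b - ⌊(a - c) / h⌋ * h, by ring, by ring, ?_, ?_⟩
    · have := Int.floor_le ((a - c) / h)
      rw [le_div_iff₀ hh] at this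
      linarith
    · have := Int.lt_floor_add_one ((a - c) / h)
      rw [div_lt_iff₀ hh] at this
      linarith
  have hsub : {s : ℝ | ⌊(a - s) / h⌋ ≠ ⌊(b - s) / h⌋} ∩ Set.Ico c (c + h) ⊆
      Set.Icc c (b' - h) ∪ Set.Ioc a' (min b' (c + h)) := by
    rintro s ⟨hs, hs1, hs2⟩
    have e1 : (a - s) / h = (a' - s) / h + m := by rw [ha]; field_simp; ring
    have e2 : (b - s) / h = (b' - s) / h + m := by rw [hb]; field_simp; ring
    simp only [Set.mem_setOf_eq, e1, e2, Int.floor_add_intCast, ne_eq, add_left_inj] at hs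
    rcases le_or_gt s a' with h1 | h1
    · left
      refine ⟨hs1, ?_⟩
      by_contra! h2
      apply hs
      rw [Int.floor_eq_zero_iff.2, Int.floor_eq_zero_iff.2]
      · exact ⟨div_nonneg (by linarith) hh.le, (div_lt_one hh).2 (by linarith)⟩
      · exact ⟨div_nonneg (by linarith) hh.le, (div_lt_one hh).2 (by linarith)⟩
    · right
      refine ⟨h1, le_min ?_ hs2.le⟩
      by_contra! h2
      apply hs
      have : ∀ {r : ℝ}, r < s → s - r ≤ h → ⌊(r - s) / h⌋ = -1 := fun {r} hr1 hr2 => by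
        rw [Int.floor_eq_iff]
        push_cast
        rw [le_div_iff₀ hh, div_lt_iff₀ hh]
        constructor <;> linarith
      rw [this h1 (by linarith), this h2 (by linarith)]
  refine (measure_mono hsub).trans ((measure_union_le _ _).trans ?_)
  rw [Real.volume_Icc, Real.volume_Ioc]
  rcases le_total b' (c + h) with h1 | h1
  · rw [min_eq_left h1, ENNReal.ofReal_of_nonpos (by linarith), zero_add]
    exact ENNReal.ofReal_le_ofReal (by linarith)
  · rw [min_eq_right h1, ← ENNReal.ofReal_add (by linarith) (by linarith)]
    exact ENNReal.ofReal_le_ofReal (by linarith)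

lemma measurableSet_separating (a b h : ℝ) :
    MeasurableSet {s : ℝ | ⌊(a - s) / h⌋ ≠ ⌊(b - s) / h⌋} := by
  have h1 : ∀ a : ℝ, Measurable fun s : ℝ => ⌊(a - s) / h⌋ := fun a =>
    Int.measurable_floor.comp (by fun_prop)
  exact (measurableSet_eq_fun (h1 a) (h1 b)).compl

lemma volume_separating_mul_le {a b h : ℝ} (hh : 0 < h) (hab : a ≤ b) (c : ℝ) (m : ℕ) :
    volume ({s : ℝ | ⌊(a - s) / h⌋ ≠ ⌊(b - s) / h⌋} ∩ Set.Ico c (c + m * h)) ≤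
      m * ENNReal.ofReal (b - a) := by
  induction m with
  | zero => simp
  | succ m ih =>
    have : Set.Ico c (c + (m + 1 : ℕ) * h) ⊆
        Set.Ico c (c + m * h) ∪ Set.Ico (c + m * h) (c + m * h + h) := by
      intro s hs
      rcases lt_or_ge s (c + m * h) with h1 | h1
      · exact Or.inl ⟨hs.1, h1⟩
      · refine Or.inr ⟨h1, hs.2.trans_le ?_⟩
        push_cast; linarith
    refine (measure_mono (Set.inter_subset_inter_right _ this)).trans ?_
    rw [Set.inter_union_distrib_left]
    refine (measure_union_le _ _).trans ?_
    push_cast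
    rw [add_mul, one_mul]
    exact add_le_add ih (volume_separating_le hh hab _)

lemma lintegral_randOffset1 (k : ℤ) (B : Set ℝ) (hB : MeasurableSet B) :
    ((volume.restrict (Set.Ico (0 : ℝ) 1)).prod (volume.restrict (Set.Ico (0 : ℝ) 1)))
      {w | randOffset1 w.1 w.2 k ∈ B} =
      2⁻¹ ^ k.toNat * volume (B ∩ Set.Ico (-(2 ^ k.toNat : ℕ) : ℝ) 0) := by
  have hm : Measurable fun w : ℝ × ℝ => randOffset1 w.1 w.2 k := by
    simp only [randOffset1_eq]; fun_prop
  rw [Measure.prod_apply (s := {w | randOffset1 w.1 w.2 k ∈ B}) (hm hB)]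
  have hind : Measurable (B.indicator (1 : ℝ → ℝ≥0∞)) := measurable_one.indicator hB
  have h1 : ∀ u : ℝ, (volume.restrict (Set.Ico (0 : ℝ) 1))
      (Prod.mk u ⁻¹' {w | randOffset1 w.1 w.2 k ∈ B}) =
      2⁻¹ ^ k.toNat * ∑ d ∈ Finset.range (2 ^ k.toNat), B.indicator 1 (u - 1 - d) := by
    intro u
    rw [← lintegral_digitSum _ (fun s => B.indicator 1 (u - 1 - s)) (by fun_prop),
      ← lintegral_indicator_one (measurable_prodMk_left
        (show MeasurableSet {w : ℝ × ℝ | randOffset1 w.1 w.2 k ∈ B} from hm hB))]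
    rfl
  simp only [h1]
  rw [lintegral_const_mul _ (by fun_prop), lintegral_finset_sum _ (fun d _ => by fun_prop)]
  congr 1
  have h2 : ∀ d : ℕ, ∫⁻ u in Set.Ico (0 : ℝ) 1, B.indicator (1 : ℝ → ℝ≥0∞) (u - 1 - d) =
      volume (B ∩ Set.Ico (-(d + 1 : ℕ) : ℝ) (-d)) := by
    intro d
    have hmp : MeasurePreserving (fun u : ℝ => u - 1 - d) volume volume := by
      simpa only [sub_sub] using measurePreserving_sub_right volume ((1 : ℝ) + d)
    have hpre : (fun u : ℝ => u - 1 - d) ⁻¹' Set.Ico (-(d + 1 : ℕ) : ℝ) (-d) = Set.Ico 0 1 := by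
      ext u
      simp only [Set.mem_preimage, Set.mem_Ico]
      push_cast
      constructor <;> rintro ⟨h1, h2⟩ <;> constructor <;> linarith
    rw [← hpre, hmp.setLIntegral_comp_preimage measurableSet_Ico hind,
      lintegral_indicator_one hB, Measure.restrict_apply hB]
  simp only [h2]
  generalize 2 ^ k.toNat = m
  induction m with
  | zero => simp
  | succ m ih =>
    rw [Finset.sum_range_succ, ih, ← measure_union
      (by
        refine Set.disjoint_left.2 fun s h1 h2 => ?_
        have := h1.2.1; have := h2.2.2; linarith)
      (hB.inter measurableSet_Ico), ← Set.inter_union_distrib_left, Set.union_comm,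
      Set.Ico_union_Ico_eq_Ico (by push_cast; linarith) (by simp)]

/-- The probability that `a` and `b` are separated by a random dyadic interval. -/
lemma measure_separated_le (k : ℤ) (a b : ℝ) :
    ((volume.restrict (Set.Ico (0 : ℝ) 1)).prod (volume.restrict (Set.Ico (0 : ℝ) 1)))
      {w | ⌊(a - randOffset1 w.1 w.2 k) / (2 : ℝ) ^ k⌋ ≠
        ⌊(b - randOffset1 w.1 w.2 k) / (2 : ℝ) ^ k⌋} ≤
      ENNReal.ofReal (|a - b| / 2 ^ k) := by
  wlog hab : a ≤ b generalizing a b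
  · have := this b a (not_le.1 hab).le
    simpa only [ne_comm, abs_sub_comm] using this
  have h2 : (0 : ℝ) < 2 ^ k := by positivity
  have h := lintegral_randOffset1 k _ (measurableSet_separating a b (2 ^ k))
  simp only [Set.mem_setOf_eq] at h
  rw [h, abs_sub_comm, abs_of_nonneg (by linarith)]
  rcases le_total 0 k with hk | hk
  · lift k to ℕ using hk
    simp only [Int.toNat_natCast, zpow_natCast] at *
    have := volume_separating_le (h := (2 : ℝ) ^ k) h2 hab (-(2 ^ k : ℕ))
    push_cast at this ⊢
    rw [neg_add_cancel] at this
    refine (mul_le_mul_right this _).trans ?_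
    rw [div_eq_inv_mul, ENNReal.ofReal_mul (by positivity), ← inv_pow,
      ENNReal.ofReal_pow (by norm_num), ENNReal.ofReal_inv_of_pos (by norm_num)]
    simp
  · obtain ⟨m, rfl⟩ : ∃ m : ℕ, k = -m := ⟨(-k).toNat, by omega⟩
    have hz : (-(m : ℤ)).toNat = 0 := by omega
    rw [hz]
    have := volume_separating_mul_le (h := (2 : ℝ) ^ (-(m : ℤ))) h2 hab (-1) (2 ^ m)
    simp only [zpow_neg, zpow_natCast] at *
    push_cast at this ⊢
    rw [mul_inv_cancel₀ (by positivity), neg_add_cancel] at this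
    simp only [pow_zero, one_mul]
    refine this.trans (le_of_eq ?_)
    rw [div_inv_eq_mul, mul_comm, ENNReal.ofReal_mul (by linarith), ENNReal.ofReal_pow (by norm_num)]
    simp

instance : IsProbabilityMeasure (volume.restrict (Set.Ico (0 : ℝ) 1)) :=
  ⟨by simp⟩

instance (N : ℕ) : IsProbabilityMeasure (randMeasure N) := by
  unfold randMeasure; infer_instance

lemma measure_notMem_dcube_le (k : ℤ) (y z : Fin N → ℝ) :
    randMeasure N {ω | z ∉ dcube (randOffset ω k) k y} ≤
      ENNReal.ofReal (N * ‖z - y‖ / 2 ^ k) := by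
  have h2 : (0 : ℝ) < 2 ^ k := by positivity
  let B : Fin N → Set (ℝ × ℝ) := fun i => {w | ⌊(z i - randOffset1 w.1 w.2 k) / (2 : ℝ) ^ k⌋ ≠
        ⌊(y i - randOffset1 w.1 w.2 k) / (2 : ℝ) ^ k⌋}
  have hsub : {ω : RSpace N | z ∉ dcube (randOffset ω k) k y} ⊆
      ⋃ i, Function.eval i ⁻¹' B i := by
    intro ω hω
    simp only [dcube, Set.mem_setOf_eq, not_forall] at hω
    obtain ⟨i, hi⟩ := hω
    exact Set.mem_iUnion.2 ⟨i, hi⟩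
  have hB : ∀ i, MeasurableSet (B i) := fun i => by
    have hm : Measurable fun w : ℝ × ℝ => randOffset1 w.1 w.2 k := by
      simp only [randOffset1_eq]; fun_prop
    exact hm (measurableSet_separating (z i) (y i) (2 ^ k))
  refine (measure_mono hsub).trans ((measure_iUnion_fintype_le _ _).trans ?_)
  have h1 : ∀ i, randMeasure N (Function.eval i ⁻¹' B i) ≤ ENNReal.ofReal (‖z - y‖ / 2 ^ k) := by
    intro i
    unfold randMeasure
    rw [(measurePreserving_eval _ i).measure_preimage (hB i).nullMeasurableSet]
    refine (measure_separated_le k _ _).trans (ENNReal.ofReal_le_ofReal ?_)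
    gcongr
    exact norm_le_pi_norm (z - y) i
  refine (Finset.sum_le_sum fun i _ => h1 i).trans (le_of_eq ?_)
  rw [Finset.sum_const, Finset.card_univ, Fintype.card_fin, mul_div_assoc,
    ENNReal.ofReal_mul (by positivity)]
  simp

lemma measurable_randOffset (k : ℤ) : Measurable fun ω : RSpace N => randOffset ω k := by
  refine measurable_pi_lambda _ fun i => ?_
  simp only [randOffset, randOffset1_eq]
  fun_prop

lemma measurableSet_mem_dcube (k : ℤ) : MeasurableSet
    {q : (Fin N → ℝ) × (Fin N → ℝ) × (Fin N → ℝ) | q.2.2 ∈ dcube q.1 k q.2.1} := by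
  have : {q : (Fin N → ℝ) × (Fin N → ℝ) × (Fin N → ℝ) | q.2.2 ∈ dcube q.1 k q.2.1} =
      ⋂ i, {q | ⌊(q.2.2 i - q.1 i) / (2 : ℝ) ^ k⌋ = ⌊(q.2.1 i - q.1 i) / (2 : ℝ) ^ k⌋} := by
    ext q; simp [dcube]
  rw [this]
  refine MeasurableSet.iInter fun i => measurableSet_eq_fun ?_ ?_
  · exact Int.measurable_floor.comp (by fun_prop)
  · exact Int.measurable_floor.comp (by fun_prop)

/-! ### The maximal function -/

/-- The centred Hardy–Littlewood maximal function over cubes with dyadic radii. -/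
def mfun (h : (Fin N → ℝ) → ℝ≥0∞) (x : Fin N → ℝ) : ℝ≥0∞ :=
  ⨆ i : ℤ, (ENNReal.ofReal (((2 : ℝ) ^ i) ^ N))⁻¹ * ∫⁻ y in Metric.ball x ((2 : ℝ) ^ i), h y

lemma measurable_mfun {h : (Fin N → ℝ) → ℝ≥0∞} (hh : Measurable h) : Measurable (mfun h) := by
  unfold mfun
  refine Measurable.iSup fun i => Measurable.const_mul ?_ _
  have h1 : ∀ x : Fin N → ℝ, ∫⁻ y in Metric.ball x ((2 : ℝ) ^ i), h y =
      ∫⁻ y, {q : (Fin N → ℝ) × (Fin N → ℝ) | dist q.2 q.1 < 2 ^ i}.indicator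
        (fun q => h q.2) (x, y) := by
    intro x
    rw [← lintegral_indicator Metric.isOpen_ball.measurableSet]
    rfl
  simp only [h1]
  refine Measurable.lintegral_prod_right' (Measurable.indicator (by fun_prop) ?_)
  exact measurableSet_lt (by fun_prop) measurable_const

lemma lintegral_ball_zpow_le (h : (Fin N → ℝ) → ℝ≥0∞) (x : Fin N → ℝ) (i : ℤ) :
    ∫⁻ y in Metric.ball x ((2 : ℝ) ^ i), h y ≤ ENNReal.ofReal (((2 : ℝ) ^ i) ^ N) * mfun h x := by
  have h0 : ENNReal.ofReal (((2 : ℝ) ^ i) ^ N) ≠ 0 := by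
    rw [ne_eq, ENNReal.ofReal_eq_zero, not_le]; positivity
  have h1 := le_iSup (fun i : ℤ => (ENNReal.ofReal (((2 : ℝ) ^ i) ^ N))⁻¹ *
    ∫⁻ y in Metric.ball x ((2 : ℝ) ^ i), h y) i
  calc _ = ENNReal.ofReal (((2 : ℝ) ^ i) ^ N) * ((ENNReal.ofReal (((2 : ℝ) ^ i) ^ N))⁻¹ *
        ∫⁻ y in Metric.ball x ((2 : ℝ) ^ i), h y) := by
        rw [← mul_assoc, ENNReal.mul_inv_cancel h0 ENNReal.ofReal_ne_top, one_mul]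
    _ ≤ _ := by unfold mfun; gcongr

lemma lintegral_ball_le (h : (Fin N → ℝ) → ℝ≥0∞) (x : Fin N → ℝ) {R : ℝ} (hR : 0 < R) :
    ∫⁻ y in Metric.ball x R, h y ≤ ENNReal.ofReal ((2 * R) ^ N) * mfun h x := by
  obtain ⟨i, hi1, hi2⟩ := exists_mem_Ioc_zpow hR (one_lt_two (α := ℝ))
  refine (lintegral_mono_set (Metric.ball_subset_ball hi2)).trans
    ((lintegral_ball_zpow_le h x (i + 1)).trans ?_)
  gcongr
  rw [zpow_add_one₀ (by norm_num)]
  linarith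

lemma mfun_le_of_le {h : (Fin N → ℝ) → ℝ≥0∞} {c : ℝ≥0∞} (hc : ∀ y, h y ≤ c) (x : Fin N → ℝ) :
    mfun h x ≤ 2 ^ N * c := by
  unfold mfun
  refine iSup_le fun i => ?_
  have h0 : ENNReal.ofReal (((2 : ℝ) ^ i) ^ N) ≠ 0 := by
    rw [ne_eq, ENNReal.ofReal_eq_zero, not_le]; positivity
  calc _ ≤ (ENNReal.ofReal (((2 : ℝ) ^ i) ^ N))⁻¹ * ∫⁻ y in Metric.ball x ((2 : ℝ) ^ i), c := by
        gcongr; exact hc _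
    _ = (ENNReal.ofReal (((2 : ℝ) ^ i) ^ N))⁻¹ * ENNReal.ofReal (((2 : ℝ) ^ i) ^ N) *
        (2 ^ N * c) := by
      rw [setLIntegral_const, Real.volume_pi_ball _ (by positivity), Fintype.card_fin,
        mul_pow 2 ((2 : ℝ) ^ i) N, ENNReal.ofReal_mul (by positivity),
        ENNReal.ofReal_pow (by norm_num : (0 : ℝ) ≤ 2) N, ENNReal.ofReal_ofNat]
      ring
    _ = _ := by rw [ENNReal.inv_mul_cancel h0 ENNReal.ofReal_ne_top, one_mul]

lemma mfun_add_le {h g : (Fin N → ℝ) → ℝ≥0∞} (hh : Measurable h) (x : Fin N → ℝ) :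
    mfun (fun y => h y + g y) x ≤ mfun h x + mfun g x := by
  unfold mfun
  refine iSup_le fun i => ?_
  rw [lintegral_add_left hh, mul_add]
  exact add_le_add (le_iSup (fun i : ℤ => (ENNReal.ofReal (((2 : ℝ) ^ i) ^ N))⁻¹ *
    ∫⁻ y in Metric.ball x ((2 : ℝ) ^ i), h y) i) (le_iSup (fun i : ℤ =>
    (ENNReal.ofReal (((2 : ℝ) ^ i) ^ N))⁻¹ * ∫⁻ y in Metric.ball x ((2 : ℝ) ^ i), g y) i)

/-- Weak type `(1,1)` of the maximal function. -/
lemma mul_volume_mfun_gt_le (hN : 0 < N) (h : (Fin N → ℝ) → ℝ≥0∞) {l : ℝ} (hl : 0 < l) :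
    ENNReal.ofReal l * volume {x | ENNReal.ofReal l < mfun h x} ≤ 10 ^ N * ∫⁻ y, h y := by
  by_cases hfin : ∫⁻ y, h y = ⊤
  · rw [hfin, ENNReal.mul_top (by simp)]; exact le_top
  set t := {x | ENNReal.ofReal l < mfun h x} with ht
  have hex : ∀ x, ∃ i : ℤ, x ∈ t → ENNReal.ofReal (l * ((2 : ℝ) ^ i) ^ N) ≤
      ∫⁻ y in Metric.closedBall x ((2 : ℝ) ^ i), h y := by
    intro x
    by_cases hx : x ∈ t
    · have hx' : ENNReal.ofReal l < mfun h x := hx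
      unfold mfun at hx'
      obtain ⟨i, hi⟩ := lt_iSup_iff.1 hx'
      refine ⟨i, fun _ => ?_⟩
      rw [mul_comm, ← div_eq_mul_inv] at hi
      have := (ENNReal.lt_div_iff_mul_lt (Or.inl (by
        rw [ne_eq, ENNReal.ofReal_eq_zero, not_le]; positivity))
        (Or.inl ENNReal.ofReal_ne_top)).1 hi
      rw [ENNReal.ofReal_mul hl.le]
      exact this.le.trans (lintegral_mono_set Metric.ball_subset_closedBall)
    · exact ⟨0, fun h => absurd h hx⟩
  choose i hi using hex
  have hbdd : ∀ x ∈ t, (2 : ℝ) ^ i x ≤ max 1 ((∫⁻ y, h y).toReal / l) := by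
    intro x hx
    rcases le_total ((2 : ℝ) ^ i x) 1 with h1 | h1
    · exact h1.trans (le_max_left _ _)
    · refine le_trans ?_ (le_max_right _ _)
      rw [le_div_iff₀ hl, mul_comm]
      have h2 := (hi x hx).trans (setLIntegral_le_lintegral _ _)
      rw [ENNReal.ofReal_le_iff_le_toReal hfin] at h2
      refine le_trans ?_ h2
      gcongr
      exact le_self_pow₀ h1 hN.ne'
  obtain ⟨u, hut, hdis, hcov⟩ := Vitali.exists_disjoint_subfamily_covering_enlargement_closedBall
    t (fun x => x) (fun x => (2 : ℝ) ^ i x) _ hbdd 5 (by norm_num)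
  have hcount : u.Countable := by
    refine hdis.countable_of_nonempty_interior fun x _ => ?_
    refine ⟨x, Metric.ball_subset_interior_closedBall (Metric.mem_ball_self (by positivity))⟩
  have hsub : t ⊆ ⋃ b ∈ u, Metric.closedBall b (5 * (2 : ℝ) ^ i b) := by
    intro x hx
    obtain ⟨b, hb, hb'⟩ := hcov x hx
    exact Set.mem_iUnion₂.2 ⟨b, hb, hb' (Metric.mem_closedBall_self (by positivity))⟩
  have := hcount.to_subtype
  calc ENNReal.ofReal l * volume t
      ≤ ENNReal.ofReal l * ∑' b : u, volume (Metric.closedBall (b : Fin N → ℝ) (5 * 2 ^ i b)) := by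
        gcongr
        exact (measure_mono hsub).trans (measure_biUnion_le _ hcount _)
    _ = ∑' b : u, 10 ^ N * ENNReal.ofReal (l * ((2 : ℝ) ^ i b) ^ N) := by
        rw [← ENNReal.tsum_mul_left]
        congr 1 with b
        rw [Real.volume_pi_closedBall _ (by positivity), Fintype.card_fin, ← mul_assoc, mul_pow,
          ENNReal.ofReal_mul (by positivity), ENNReal.ofReal_mul hl.le,
          ENNReal.ofReal_pow (by norm_num)]
        norm_num
        ring
    _ ≤ ∑' b : u, 10 ^ N * ∫⁻ y in Metric.closedBall (b : Fin N → ℝ) ((2 : ℝ) ^ i b), h y := by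
        gcongr with b
        exact hi b (hut b.2)
    _ = 10 ^ N * ∫⁻ y in ⋃ b ∈ u, Metric.closedBall b ((2 : ℝ) ^ i b), h y := by
        rw [ENNReal.tsum_mul_left, lintegral_biUnion hcount
          (fun b _ => Metric.isClosed_closedBall.measurableSet) hdis]
    _ ≤ _ := mul_le_mul_right (setLIntegral_le_lintegral _ _) _

lemma setLIntegral_rpow_Ioo {s v : ℝ} (hs : 0 < s) (hv : 0 ≤ v) :
    ∫⁻ l in Set.Ioo 0 v, ENNReal.ofReal (l ^ (s - 1)) = ENNReal.ofReal (v ^ s / s) := by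
  have h := integral_rpow (a := 0) (b := v) (r := s - 1) (Or.inl (by linarith))
  rw [sub_add_cancel, Real.zero_rpow hs.ne', sub_zero] at h
  have hi : IntegrableOn (fun l : ℝ => l ^ (s - 1)) (Set.Ioc 0 v) :=
    (intervalIntegrable_iff_integrableOn_Ioc_of_le hv).1
      (intervalIntegral.intervalIntegrable_rpow' (by linarith))
  rw [← h, intervalIntegral.integral_of_le hv, ofReal_integral_eq_lintegral_ofReal hi,
    ← restrict_Ioo_eq_restrict_Ioc]
  filter_upwards [ae_restrict_mem measurableSet_Ioc] with l hl
  exact Real.rpow_nonneg hl.1.le _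

/-- Layer cake for powers of an extended nonnegative number. -/
lemma setLIntegral_rpow_lt {s : ℝ} (hs : 0 < s) (v : ℝ≥0∞) :
    ∫⁻ l in Set.Ioi (0 : ℝ), {l | ENNReal.ofReal l < v}.indicator
      (fun l => ENNReal.ofReal (l ^ (s - 1))) l = ENNReal.ofReal s⁻¹ * v ^ s := by
  have hset : MeasurableSet {l : ℝ | ENNReal.ofReal l < v} :=
    measurableSet_lt (by fun_prop) measurable_const
  rw [lintegral_indicator hset, Measure.restrict_restrict hset]
  induction v using ENNReal.recTopCoe with
  | top =>
    rw [ENNReal.top_rpow_of_pos hs, ENNReal.mul_top (by simpa using hs), eq_top_iff]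
    have hlim : Tendsto (fun m : ℕ => ENNReal.ofReal ((m : ℝ) ^ s / s)) atTop (𝓝 ⊤) :=
      ENNReal.tendsto_ofReal_atTop.comp
        (((tendsto_rpow_atTop hs).comp tendsto_natCast_atTop_atTop).atTop_div_const hs)
    refine le_of_tendsto hlim (Eventually.of_forall fun m => ?_)
    rw [← setLIntegral_rpow_Ioo hs (Nat.cast_nonneg m)]
    exact lintegral_mono_set fun l hl => ⟨ENNReal.ofReal_lt_top, hl.1⟩
  | coe v =>
    have : {l : ℝ | ENNReal.ofReal l < v} ∩ Set.Ioi 0 = Set.Ioo 0 (v : ℝ) := by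
      ext l
      simp only [Set.mem_inter_iff, Set.mem_setOf_eq, Set.mem_Ioi, Set.mem_Ioo]
      constructor
      · rintro ⟨h1, h2⟩
        refine ⟨h2, ?_⟩
        rw [← ENNReal.ofReal_coe_nnreal] at h1
        exact (ENNReal.ofReal_lt_ofReal_iff_of_nonneg h2.le).1 h1
      · rintro ⟨h1, h2⟩
        refine ⟨?_, h1⟩
        rw [← ENNReal.ofReal_coe_nnreal]
        exact (ENNReal.ofReal_lt_ofReal_iff_of_nonneg h1.le).2 h2
    rw [this, setLIntegral_rpow_Ioo hs v.coe_nonneg, div_eq_inv_mul,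
      ENNReal.ofReal_mul (by positivity), ← ENNReal.ofReal_rpow_of_nonneg v.coe_nonneg hs.le, ENNReal.ofReal_coe_nnreal]

/-- Strong type `(p,p)` of the maximal function. -/
lemma lintegral_mfun_rpow_le (hN : 0 < N) {p : ℝ} (hp : 1 < p) :
    ∃ C : ℝ≥0∞, C ≠ ⊤ ∧ ∀ h : (Fin N → ℝ) → ℝ≥0∞, Measurable h →
      ∫⁻ x, mfun h x ^ p ≤ C * ∫⁻ x, h x ^ p := by
  have hp0 : 0 < p := by linarith
  refine ⟨ENNReal.ofReal p * (2 * 10 ^ N * (ENNReal.ofReal (p - 1)⁻¹ * (2 ^ (N + 1)) ^ (p - 1))),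
    ?_, fun h hh => ?_⟩
  · finiteness
  have hweak : ∀ l : ℝ, 0 < l → ENNReal.ofReal l * volume {x | ENNReal.ofReal l < mfun h x} ≤
      2 * 10 ^ N * ∫⁻ y, {y | ENNReal.ofReal l < 2 ^ (N + 1) * h y}.indicator h y := by
    intro l hl
    set A := {y | ENNReal.ofReal l < 2 ^ (N + 1) * h y} with hA
    have hAm : MeasurableSet A := measurableSet_lt measurable_const (by fun_prop)
    have hsub : {x | ENNReal.ofReal l < mfun h x} ⊆
        {x | ENNReal.ofReal (l / 2) < mfun (A.indicator h) x} := by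
      intro x hx
      by_contra hcon
      simp only [Set.mem_setOf_eq, not_lt] at hx hcon
      have h1 : mfun (Aᶜ.indicator h) x ≤ ENNReal.ofReal (l / 2) := by
        refine (mfun_le_of_le (c := ENNReal.ofReal l / 2 ^ (N + 1)) (fun y => ?_) x).trans ?_
        · by_cases hy : y ∈ A
          · simp [hy]
          · rw [Set.indicator_of_mem (by simpa using hy), ENNReal.le_div_iff_mul_le (by simp) (by simp),
              mul_comm]
            exact not_lt.1 hy
        · rw [ENNReal.ofReal_div_of_pos (by norm_num), ENNReal.ofReal_ofNat, pow_succ,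
            ENNReal.div_eq_inv_mul, ENNReal.mul_inv (by simp) (by simp), ← mul_assoc, ← mul_assoc,
            ENNReal.mul_inv_cancel (by simp) (by simp), one_mul, ENNReal.div_eq_inv_mul]
      have h2 : h = fun y => A.indicator h y + Aᶜ.indicator h y := by
        ext y; exact (congrFun (Set.indicator_self_add_compl A h) y).symm
      have h3 := mfun_add_le (g := Aᶜ.indicator h) (hh.indicator hAm) x
      rw [← h2] at h3
      have h4 := h3.trans (add_le_add hcon h1)
      rw [← ENNReal.ofReal_add (by positivity) (by positivity), add_halves] at h4
      exact absurd hx (not_lt.2 h4)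
    have h5 := mul_volume_mfun_gt_le hN (A.indicator h) (half_pos hl)
    calc _ ≤ ENNReal.ofReal l * volume {x | ENNReal.ofReal (l / 2) < mfun (A.indicator h) x} := by
          gcongr
      _ = 2 * (ENNReal.ofReal (l / 2) *
          volume {x | ENNReal.ofReal (l / 2) < mfun (A.indicator h) x}) := by
          rw [← mul_assoc, ← ENNReal.ofReal_ofNat, ← ENNReal.ofReal_mul (by norm_num)]
          congr 2; ring
      _ ≤ _ := by rw [mul_assoc]; gcongr
  have hjoint : ∀ g : (Fin N → ℝ) → ℝ≥0∞, Measurable g →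
      MeasurableSet {q : (Fin N → ℝ) × ℝ | ENNReal.ofReal q.2 < g q.1} := fun g hg =>
    measurableSet_lt (by fun_prop) (by fun_prop)
  have hV := measurable_mfun hh
  have e1 : ∀ x, mfun h x ^ p = ENNReal.ofReal p * ∫⁻ l in Set.Ioi (0 : ℝ),
      {l | ENNReal.ofReal l < mfun h x}.indicator (fun l => ENNReal.ofReal (l ^ (p - 1))) l := by
    intro x
    rw [setLIntegral_rpow_lt hp0, ← mul_assoc, ← ENNReal.ofReal_mul hp0.le,
      mul_inv_cancel₀ hp0.ne', ENNReal.ofReal_one, one_mul]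
  have hm1 : Measurable fun q : (Fin N → ℝ) × ℝ => {l | ENNReal.ofReal l < mfun h q.1}.indicator
      (fun l => ENNReal.ofReal (l ^ (p - 1))) q.2 :=
    Measurable.indicator (s := {q : (Fin N → ℝ) × ℝ | ENNReal.ofReal q.2 < mfun h q.1})
      (f := fun q : (Fin N → ℝ) × ℝ => ENNReal.ofReal (q.2 ^ (p - 1))) (by fun_prop) (hjoint _ hV)
  have hg2 : Measurable fun y => 2 ^ (N + 1) * h y := by fun_prop
  have hm2 : Measurable fun q : ℝ × (Fin N → ℝ) => ENNReal.ofReal (q.1 ^ (p - 1 - 1)) *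
      {y | ENNReal.ofReal q.1 < 2 ^ (N + 1) * h y}.indicator h q.2 :=
    Measurable.mul (by fun_prop) (Measurable.indicator
      (s := {q : ℝ × (Fin N → ℝ) | ENNReal.ofReal q.1 < 2 ^ (N + 1) * h q.2})
      (f := fun q : ℝ × (Fin N → ℝ) => h q.2) (by fun_prop)
      (measurableSet_lt (by fun_prop) (by fun_prop)))
  calc ∫⁻ x, mfun h x ^ p
      = ENNReal.ofReal p * ∫⁻ l in Set.Ioi (0 : ℝ), ∫⁻ x,
        {l | ENNReal.ofReal l < mfun h x}.indicator (fun l => ENNReal.ofReal (l ^ (p - 1))) l := by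
        simp only [e1]
        rw [lintegral_const_mul _ hm1.lintegral_prod_right', lintegral_lintegral_swap hm1.aemeasurable]
    _ ≤ ENNReal.ofReal p * ∫⁻ l in Set.Ioi (0 : ℝ), 2 * 10 ^ N * ∫⁻ y,
        ENNReal.ofReal (l ^ (p - 1 - 1)) *
        {y | ENNReal.ofReal l < 2 ^ (N + 1) * h y}.indicator h y := by
        gcongr ENNReal.ofReal p * ?_
        refine setLIntegral_mono' measurableSet_Ioi fun l hl => ?_
        have hl : 0 < l := hl
        have e2 : ∀ x, {l | ENNReal.ofReal l < mfun h x}.indicator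
            (fun l => ENNReal.ofReal (l ^ (p - 1))) l = {x | ENNReal.ofReal l < mfun h x}.indicator
            (fun _ => ENNReal.ofReal (l ^ (p - 1))) x := fun x => rfl
        simp only [e2]
        rw [lintegral_indicator_const (measurableSet_lt measurable_const hV),
          lintegral_const_mul' _ _ ENNReal.ofReal_ne_top, mul_left_comm]
        have e3 : l ^ (p - 1) = l ^ (p - 1 - 1) * l := by
          rw [← Real.rpow_add_one hl.ne']; congr 1; ring
        rw [e3, ENNReal.ofReal_mul (by positivity), mul_assoc]
        exact mul_le_mul_right (hweak l hl) _
    _ = ENNReal.ofReal p * (2 * 10 ^ N * ∫⁻ y, ∫⁻ l in Set.Ioi (0 : ℝ),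
        ENNReal.ofReal (l ^ (p - 1 - 1)) *
        {y | ENNReal.ofReal l < 2 ^ (N + 1) * h y}.indicator h y) := by
        rw [lintegral_const_mul _ hm2.lintegral_prod_right', lintegral_lintegral_swap hm2.aemeasurable]
    _ = ENNReal.ofReal p * (2 * 10 ^ N * ∫⁻ y,
        (ENNReal.ofReal (p - 1)⁻¹ * (2 ^ (N + 1)) ^ (p - 1)) * h y ^ p) := by
        congr 3 with y
        have e4 : ∀ l : ℝ, ENNReal.ofReal (l ^ (p - 1 - 1)) *
            {y | ENNReal.ofReal l < 2 ^ (N + 1) * h y}.indicator h y =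
            {l | ENNReal.ofReal l < 2 ^ (N + 1) * h y}.indicator
              (fun l => ENNReal.ofReal (l ^ (p - 1 - 1))) l * h y := by
          intro l
          by_cases hl : ENNReal.ofReal l < 2 ^ (N + 1) * h y <;> simp [hl]
        simp only [e4]
        rw [lintegral_mul_const _ (Measurable.indicator (by fun_prop)
          (measurableSet_lt (by fun_prop) measurable_const)), setLIntegral_rpow_lt (by linarith),
          ENNReal.mul_rpow_of_nonneg _ _ (by linarith), mul_assoc, mul_assoc, mul_assoc]
        congr 2
        nth_rw 2 [← ENNReal.rpow_one (h y)]
        rcases eq_or_ne (h y) 0 with h0 | h0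
        · rw [h0, ENNReal.zero_rpow_of_pos hp0, ENNReal.zero_rpow_of_pos one_pos, mul_zero]
        · rw [← ENNReal.rpow_add_of_nonneg _ _ (by linarith) (by norm_num), sub_add_cancel]
    _ = _ := by
        rw [lintegral_const_mul _ (by fun_prop)]
        ring

/-! ### Integration against radially decreasing kernels -/

/-- The constant in `lintegral_decay_le`. -/
def decC (N : ℕ) (a : ℝ) : ℝ := 4 ^ N * 2 ^ a / (1 - (2 : ℝ) ^ (-a))

lemma decay_le (M : ℝ) (hM : 0 ≤ M) {L d : ℝ} (hL : 0 < L) (hd : 0 ≤ d) :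
    ENNReal.ofReal ((L + d) ^ (-M)) ≤ ∑' m : ℕ, (Set.Iio (2 ^ m * L)).indicator
      (fun _ => ENNReal.ofReal ((2 ^ m * L / 2) ^ (-M))) d := by
  have hex : ∃ m : ℕ, d < 2 ^ m * L := by
    obtain ⟨m, hm⟩ := pow_unbounded_of_one_lt (d / L) one_lt_two
    exact ⟨m, by rwa [div_lt_iff₀ hL] at hm⟩
  classical
  have h1 := Nat.find_spec hex
  refine le_trans ?_ (ENNReal.le_tsum (Nat.find hex))
  rw [Set.indicator_of_mem (by exact h1)]
  refine ENNReal.ofReal_le_ofReal (Real.rpow_le_rpow_of_nonpos (by positivity) ?_ (by linarith))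
  rcases Nat.eq_zero_or_pos (Nat.find hex) with h0 | h0
  · rw [h0]; linarith
  · have h2 := Nat.find_min hex (Nat.sub_lt h0 one_pos)
    obtain ⟨m, hm⟩ := Nat.exists_eq_succ_of_ne_zero h0.ne'
    rw [hm] at h2 ⊢
    simp only [Nat.succ_eq_add_one, add_tsub_cancel_right, not_lt, pow_succ] at h2 ⊢
    linarith

lemma lintegral_decay_le {a : ℝ} (ha : 0 < a) {h : (Fin N → ℝ) → ℝ≥0∞} (hh : Measurable h)
    (x : Fin N → ℝ) {L : ℝ} (hL : 0 < L) :
    ∫⁻ y, ENNReal.ofReal ((L + ‖x - y‖) ^ (-(N + a))) * h y ≤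
      ENNReal.ofReal (decC N a * L ^ (-a)) * mfun h x := by
  have hr1 : (2 : ℝ) ^ (-a) < 1 := Real.rpow_lt_one_of_one_lt_of_neg (by norm_num) (by linarith)
  have hr0 : (0 : ℝ) < 2 ^ (-a) := by positivity
  have hball : ∀ m : ℕ, MeasurableSet (Metric.ball x (2 ^ m * L)) := fun m =>
    Metric.isOpen_ball.measurableSet
  calc _ ≤ ∫⁻ y, ∑' m : ℕ, ENNReal.ofReal ((2 ^ m * L / 2) ^ (-((N : ℝ) + a))) *
        (Metric.ball x (2 ^ m * L)).indicator h y := by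
        refine lintegral_mono fun y => ?_
        refine (mul_le_mul_left (decay_le (N + a) (by positivity) hL (norm_nonneg (x - y)))
          (h y)).trans (le_of_eq ?_)
        rw [← ENNReal.tsum_mul_right]
        congr 1 with m
        by_cases hm : ‖x - y‖ < 2 ^ m * L
        · rw [Set.indicator_of_mem (by exact hm), Set.indicator_of_mem
            (by rwa [Metric.mem_ball, dist_comm, dist_eq_norm])]
        · rw [Set.indicator_of_notMem (by exact hm), Set.indicator_of_notMem
            (by rwa [Metric.mem_ball, dist_comm, dist_eq_norm]), zero_mul, mul_zero]
    _ = ∑' m : ℕ, ENNReal.ofReal ((2 ^ m * L / 2) ^ (-((N : ℝ) + a))) *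
        ∫⁻ y in Metric.ball x (2 ^ m * L), h y := by
        rw [lintegral_tsum fun m => ((hh.indicator (hball m)).const_mul _).aemeasurable]
        congr 1 with m
        rw [lintegral_const_mul _ (hh.indicator (hball m)), lintegral_indicator (hball m)]
    _ ≤ ∑' m : ℕ, ENNReal.ofReal (4 ^ N * 2 ^ a * L ^ (-a) * (2 ^ (-a)) ^ m) * mfun h x := by
        refine ENNReal.tsum_le_tsum fun m => ?_
        refine (mul_le_mul_right (lintegral_ball_le h x (by positivity)) _).trans ?_
        rw [← mul_assoc, ← ENNReal.ofReal_mul (by positivity)]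
        refine mul_le_mul_left (ENNReal.ofReal_le_ofReal (le_of_eq ?_)) _
        have e1 : ((2 : ℝ) ^ (-a)) ^ m = ((2 : ℝ) ^ m) ^ (-a) := by
          rw [← Real.rpow_natCast, ← Real.rpow_natCast, ← Real.rpow_mul (by norm_num),
            ← Real.rpow_mul (by norm_num), mul_comm]
        have hZ : (0 : ℝ) < 2 ^ m := by positivity
        rw [e1]
        generalize (2 : ℝ) ^ m = Z at hZ
        have e2 : (2 * (Z * L)) ^ N = (Z * L / 2) ^ N * 4 ^ N := by rw [← mul_pow]; ring
        have e3 : (Z * L / 2) ^ (-a) = Z ^ (-a) * L ^ (-a) * 2 ^ a := by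
          rw [Real.div_rpow (by positivity) (by norm_num), Real.mul_rpow hZ.le hL.le,
            Real.rpow_neg (by norm_num : (0 : ℝ) ≤ 2) a, div_inv_eq_mul]
        rw [neg_add, Real.rpow_add (by positivity), Real.rpow_neg (by positivity) (N : ℝ),
          Real.rpow_natCast, e2, e3]
        field_simp
    _ = _ := by
        rw [ENNReal.tsum_mul_right]
        congr 1
        rw [← ENNReal.ofReal_tsum_of_nonneg (fun m => by positivity)
          ((summable_geometric_of_lt_one hr0.le hr1).mul_left _), tsum_mul_left,
          tsum_geometric_of_lt_one hr0.le hr1]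
        congr 1
        unfold decC
        rw [div_eq_mul_inv]
        ring

/-- The integral of a decaying kernel. -/
lemma lintegral_decay_one_le {a : ℝ} (ha : 0 < a) (x : Fin N → ℝ) {L : ℝ} (hL : 0 < L) :
    ∫⁻ y, ENNReal.ofReal ((L + ‖x - y‖) ^ (-(N + a))) ≤
      ENNReal.ofReal (decC N a * L ^ (-a)) * 2 ^ N := by
  have h := lintegral_decay_le ha (h := fun _ => 1) measurable_const x hL
  simp only [mul_one] at h
  refine h.trans ?_
  gcongr
  simpa using mfun_le_of_le (h := fun _ => 1) (c := 1) (fun _ => le_rfl) x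

/-! ### Dyadic kernels and their Poisson transforms -/

/-- The kernel of the averaging operator over the cubes `dcube a k`. -/
def aker (a : Fin N → ℝ) (k : ℤ) (x z : Fin N → ℝ) : ℝ :=
  (dcube a k x).indicator (fun _ => (((2 : ℝ) ^ k) ^ N)⁻¹) z

/-- The kernel of the random martingale difference operator at scale `k`. -/
def kerT (ω : RSpace N) (k : ℤ) (x z : Fin N → ℝ) : ℝ :=
  aker (randOffset ω (k - 1)) (k - 1) x z - aker (randOffset ω k) k x z

lemma abs_aker_le (a : Fin N → ℝ) (k : ℤ) (x z : Fin N → ℝ) :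
    |aker a k x z| ≤ (((2 : ℝ) ^ k) ^ N)⁻¹ := by
  unfold aker
  by_cases h : z ∈ dcube a k x
  · rw [Set.indicator_of_mem h, abs_of_pos (by positivity)]
  · rw [Set.indicator_of_notMem h, abs_zero]; positivity

lemma volume_dcube_lt_top (a : Fin N → ℝ) (k : ℤ) (x : Fin N → ℝ) : volume (dcube a k x) < ⊤ := by
  rw [volume_dcube]; exact ENNReal.ofReal_lt_top

lemma integrable_aker (a : Fin N → ℝ) (k : ℤ) (x : Fin N → ℝ) : Integrable (aker a k x) := by
  unfold aker
  rw [integrable_indicator_iff (measurableSet_dcube a k x)]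
  exact integrableOn_const (volume_dcube_lt_top a k x).ne

lemma ae_continuousAt_aker (a : Fin N → ℝ) (k : ℤ) (x : Fin N → ℝ) :
    ∀ᵐ z, ContinuousAt (aker a k x) z := by
  have h : ∀ᵐ z, z ∉ frontier (dcube a k x) :=
    measure_eq_zero_iff_ae_notMem.1 (volume_frontier_dcube a k x)
  filter_upwards [h] with z hz
  exact continuousOn_const.continuousAt_indicator hz

lemma abs_kerT_le (ω : RSpace N) (k : ℤ) (x z : Fin N → ℝ) :
    |kerT ω k x z| ≤ (((2 : ℝ) ^ (k - 1)) ^ N)⁻¹ + (((2 : ℝ) ^ k) ^ N)⁻¹ :=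
  (abs_sub _ _).trans (add_le_add (abs_aker_le _ _ _ _) (abs_aker_le _ _ _ _))

lemma integrable_kerT (ω : RSpace N) (k : ℤ) (x : Fin N → ℝ) : Integrable (kerT ω k x) :=
  (integrable_aker _ _ _).sub (integrable_aker _ _ _)

lemma ae_continuousAt_kerT (ω : RSpace N) (k : ℤ) (x : Fin N → ℝ) :
    ∀ᵐ z, ContinuousAt (kerT ω k x) z := by
  filter_upwards [ae_continuousAt_aker (randOffset ω (k - 1)) (k - 1) x,
    ae_continuousAt_aker (randOffset ω k) k x] with z h1 h2
  exact h1.sub h2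

lemma measurable_aker (k : ℤ) : Measurable fun q : RSpace N × (Fin N → ℝ) × (Fin N → ℝ) =>
    aker (randOffset q.1 k) k q.2.1 q.2.2 := by
  have h : MeasurableSet {q : RSpace N × (Fin N → ℝ) × (Fin N → ℝ) |
      q.2.2 ∈ dcube (randOffset q.1 k) k q.2.1} :=
    (((measurable_randOffset k).comp measurable_fst).prodMk measurable_snd)
      (measurableSet_mem_dcube k)
  exact Measurable.indicator (f := fun _ => (((2 : ℝ) ^ k) ^ N)⁻¹) measurable_const h

lemma measurable_kerT_right (k : ℤ) :
    Measurable fun q : RSpace N × (Fin N → ℝ) × (Fin N → ℝ) => kerT q.1 k q.2.1 q.2.2 := by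
  unfold kerT
  exact (measurable_aker (k - 1)).sub (measurable_aker k)

lemma measurable_kerT : Measurable fun q : (RSpace N × ℤ) × (Fin N → ℝ) × (Fin N → ℝ) =>
    kerT q.1.1 q.1.2 q.2.1 q.2.2 := by
  have h2 : Measurable (fun q : ℤ × (RSpace N × (Fin N → ℝ) × (Fin N → ℝ)) =>
      kerT q.2.1 q.1 q.2.2.1 q.2.2.2) := measurable_from_prod_countable_right measurable_kerT_right
  have h3 : Measurable (fun q : (RSpace N × ℤ) × (Fin N → ℝ) × (Fin N → ℝ) =>
    (q.1.2, (q.1.1, q.2))) := by fun_prop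
  have h4 := h2.comp h3
  simp only [Function.comp_def] at h4
  exact h4

lemma integrable_mul_pkt {κ : (Fin N → ℝ) → ℝ} (hκ : Integrable κ) (y : Fin N → ℝ) {t : ℝ}
    (ht : 0 < t) : Integrable fun z => κ z * (t * pkt N (y - z) t) := by
  refine Integrable.mul_bdd (c := t * (poiB N * (t ^ (N + 1))⁻¹)) hκ ?_
    (Eventually.of_forall fun z => ?_)
  · exact (((continuous_pkt ht).comp (continuous_const.sub continuous_id)).const_mul
      t).aestronglyMeasurable
  · rw [Real.norm_eq_abs, abs_mul, abs_of_pos ht]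
    gcongr
    exact abs_pkt_le_const _ ht le_rfl

lemma qint_sub {κ κ' : (Fin N → ℝ) → ℝ} (hκ : Integrable κ) (hκ' : Integrable κ')
    (y : Fin N → ℝ) {t : ℝ} (ht : 0 < t) :
    qint (fun z => κ z - κ' z) (y, t) = qint κ (y, t) - qint κ' (y, t) := by
  unfold qint
  rw [← integral_sub (integrable_mul_pkt hκ y ht) (integrable_mul_pkt hκ' y ht)]
  congr 1 with z
  ring

lemma qint_kerT (ω : RSpace N) (k : ℤ) (x y : Fin N → ℝ) {t : ℝ} (ht : 0 < t) :
    qint (kerT ω k x) (y, t) = qint (aker (randOffset ω (k - 1)) (k - 1) x) (y, t) -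
      qint (aker (randOffset ω k) k x) (y, t) :=
  qint_sub (integrable_aker _ _ _) (integrable_aker _ _ _) y ht

lemma qint_aker (a : Fin N → ℝ) (k : ℤ) (x y : Fin N → ℝ) (t : ℝ) :
    qint (aker a k x) (y, t) =
      (((2 : ℝ) ^ k) ^ N)⁻¹ * ∫ z in dcube a k x, t * pkt N (y - z) t := by
  unfold qint aker
  rw [← integral_indicator (measurableSet_dcube a k x), ← integral_const_mul]
  congr 1 with z
  by_cases h : z ∈ dcube a k x
  · simp [h]
  · simp [h]

lemma integrable_mul_pkt_sub (y : Fin N → ℝ) {t : ℝ} (ht : 0 < t) :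
    Integrable fun z => t * pkt N (y - z) t :=
  (((integrable_pkt (N := N) ht).comp_sub_left y)).const_mul _

lemma abs_qint_aker_sub_le {a : Fin N → ℝ} {k : ℤ} {x y : Fin N → ℝ} {t m A : ℝ} (ht : 0 < t)
    (h : ∀ z ∈ dcube a k x, |t * pkt N (y - z) t - m| ≤ A) :
    |qint (aker a k x) (y, t) - m| ≤ A := by
  have h2 : (0 : ℝ) < ((2 : ℝ) ^ k) ^ N := by positivity
  have hv : volume.real (dcube a k x) = ((2 : ℝ) ^ k) ^ N := by
    rw [Measure.real, volume_dcube, ENNReal.toReal_ofReal h2.le]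
  have h1 : qint (aker a k x) (y, t) - m =
      (((2 : ℝ) ^ k) ^ N)⁻¹ * ∫ z in dcube a k x, (t * pkt N (y - z) t - m) := by
    rw [integral_sub (integrable_mul_pkt_sub y ht).integrableOn
      (integrableOn_const (volume_dcube_lt_top a k x).ne), setIntegral_const, hv, mul_sub,
      ← qint_aker, smul_eq_mul, ← mul_assoc, inv_mul_cancel₀ h2.ne', one_mul]
  rw [h1, abs_mul, abs_of_pos (by positivity), inv_mul_le_iff₀ h2, ← Real.norm_eq_abs, mul_comm,
    ← hv]
  exact norm_setIntegral_le_of_norm_le_const (volume_dcube_lt_top a k x) h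

lemma abs_qint_aker_le (a : Fin N → ℝ) (k : ℤ) (x y : Fin N → ℝ) {t : ℝ} (ht : 0 < t) :
    |qint (aker a k x) (y, t)| ≤ (N + 2) * (((2 : ℝ) ^ k) ^ N)⁻¹ := by
  rw [qint_aker, abs_mul, abs_of_pos (by positivity), mul_comm]
  gcongr
  have hi : Integrable fun z => (N + 2) * pk N (y - z) t :=
    (((integrable_pk (N := N) ht).comp_sub_left y)).const_mul _
  have h1 : ∀ z, |t * pkt N (y - z) t| ≤ (N + 2) * pk N (y - z) t := by
    intro z
    rw [abs_mul, abs_of_pos ht]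
    refine (mul_le_mul_of_nonneg_left (abs_pkt_le_pk (y - z) ht le_rfl) ht.le).trans
      (le_of_eq ?_)
    field_simp
  rw [← Real.norm_eq_abs]
  calc ‖∫ z in dcube a k x, t * pkt N (y - z) t‖
      ≤ ∫ z in dcube a k x, (N + 2) * pk N (y - z) t :=
        norm_integral_le_of_norm_le hi.integrableOn (Eventually.of_forall h1)
    _ ≤ ∫ z, (N + 2) * pk N (y - z) t := by
        refine setIntegral_le_integral hi (Eventually.of_forall fun z => ?_)
        have := pk_nonneg (y - z) ht.le
        positivity
    _ = N + 2 := by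
        rw [integral_const_mul, integral_sub_left_eq_self (fun x : Fin N → ℝ => pk N x t) volume y,
          integral_pk ht, mul_one]

/-- Size of the Poisson transform of an averaging kernel, up to a scale-independent term. -/
lemma exists_qint_aker_le (N : ℕ) : ∃ C : ℝ, 0 < C ∧ ∀ (D : ℝ) (x y : Fin N → ℝ) (t : ℝ), 0 < t →
    ∃ m : ℝ, ∀ (a : Fin N → ℝ) (k : ℤ), 2 ^ k ≤ D → D ≤ 2 * 2 ^ k →
      |qint (aker a k x) (y, t) - m| ≤ C * D * ((t + D + ‖x - y‖) ^ (N + 1))⁻¹ := by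
  obtain ⟨C₁, hC₁, hlip⟩ := abs_pkt_sub_le N
  have hB := poiB_pos N
  refine ⟨C₁ * 2 ^ (N + 1) + poiB N * 4 ^ (N + 1) + (N + 2) * 2 ^ N * 4 ^ (N + 1), by positivity,
    fun D x y t ht => ?_⟩
  by_cases htD : D ≤ t
  · refine ⟨t * pkt N (y - x) t, fun a k hk hk' => ?_⟩
    have hk0 : (0 : ℝ) < 2 ^ k := by positivity
    have hD : 0 < D := hk0.trans_le hk
    refine (abs_qint_aker_sub_le (A := C₁ * 2 ^ (N + 1) * D * ((t + D + ‖x - y‖) ^ (N + 1))⁻¹) ht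
      fun z hz => ?_).trans ?_
    · have hz' : ‖x - z‖ ≤ D := (norm_sub_le_of_mem_dcube hz).trans hk
      have h1 := hlip (y - x) (x - z) t ht (hz'.trans htD)
      rw [sub_add_sub_cancel] at h1
      refine h1.trans ?_
      have h2 : (t + D + ‖x - y‖) ≤ 2 * (‖y - x‖ + t) := by
        rw [norm_sub_rev y x]; linarith [norm_nonneg (x - y)]
      have h3 : (t + D + ‖x - y‖) ^ (N + 1) ≤ 2 ^ (N + 1) * (‖y - x‖ + t) ^ (N + 1) := by
        rw [← mul_pow]
        exact pow_le_pow_left₀ (by positivity) h2 _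
      have h4 : ((‖y - x‖ + t) ^ (N + 1))⁻¹ ≤ 2 ^ (N + 1) * ((t + D + ‖x - y‖) ^ (N + 1))⁻¹ := by
        rw [← div_eq_mul_inv, inv_eq_one_div, div_le_div_iff₀ (by positivity) (by positivity)]
        linarith
      calc _ ≤ C₁ * D * (2 ^ (N + 1) * ((t + D + ‖x - y‖) ^ (N + 1))⁻¹) := by gcongr
        _ = _ := by ring
    · gcongr
      have h5 : 0 ≤ poiB N * 4 ^ (N + 1) := by positivity
      have h6 : (0 : ℝ) ≤ (N + 2) * 2 ^ N * 4 ^ (N + 1) := by positivity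
      linarith
  · rw [not_le] at htD
    refine ⟨0, fun a k hk hk' => ?_⟩
    have hk0 : (0 : ℝ) < 2 ^ k := by positivity
    have hD : 0 < D := hk0.trans_le hk
    by_cases hxy : 2 * D < ‖x - y‖
    · refine (abs_qint_aker_sub_le (A := poiB N * 4 ^ (N + 1) * D *
        ((t + D + ‖x - y‖) ^ (N + 1))⁻¹) ht fun z hz => ?_).trans ?_
      · have hz' : ‖x - z‖ ≤ D := (norm_sub_le_of_mem_dcube hz).trans hk
        have h0 : ‖x - y‖ ≤ ‖x - z‖ + ‖y - z‖ := by
          rw [norm_sub_rev y z]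
          exact norm_sub_le_norm_sub_add_norm_sub x z y
        have h2 : (t + D + ‖x - y‖) ≤ 4 * (‖y - z‖ + t) := by linarith
        have h3 : (t + D + ‖x - y‖) ^ (N + 1) ≤ 4 ^ (N + 1) * (‖y - z‖ + t) ^ (N + 1) := by
          rw [← mul_pow]
          exact pow_le_pow_left₀ (by positivity) h2 _
        have h4 : ((‖y - z‖ + t) ^ (N + 1))⁻¹ ≤ 4 ^ (N + 1) * ((t + D + ‖x - y‖) ^ (N + 1))⁻¹ := by
          rw [← div_eq_mul_inv, inv_eq_one_div, div_le_div_iff₀ (by positivity) (by positivity)]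
          linarith
        rw [sub_zero, abs_mul, abs_of_pos ht]
        calc _ ≤ D * (poiB N * (4 ^ (N + 1) * ((t + D + ‖x - y‖) ^ (N + 1))⁻¹)) := by
              refine mul_le_mul htD.le ((abs_pkt_le _ ht).trans ?_) (abs_nonneg _) hD.le
              gcongr
          _ = _ := by ring
      · gcongr
        have h5 : 0 ≤ C₁ * 2 ^ (N + 1) := by positivity
        have h6 : (0 : ℝ) ≤ (N + 2) * 2 ^ N * 4 ^ (N + 1) := by positivity
        linarith
    · rw [not_lt] at hxy
      rw [sub_zero]
      refine (abs_qint_aker_le a k x y ht).trans ?_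
      have h2 : (t + D + ‖x - y‖) ≤ 4 * D := by linarith
      have h3 : (t + D + ‖x - y‖) ^ (N + 1) ≤ 4 ^ (N + 1) * D ^ (N + 1) := by
        rw [← mul_pow]
        exact pow_le_pow_left₀ (by positivity) h2 _
      have h4 : D ^ N ≤ 2 ^ N * (2 ^ k) ^ N := by
        rw [← mul_pow]
        exact pow_le_pow_left₀ (by positivity) hk' _
      have h5 : (((2 : ℝ) ^ k) ^ N)⁻¹ ≤ 2 ^ N * 4 ^ (N + 1) * D * ((t + D + ‖x - y‖) ^ (N + 1))⁻¹ := by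
        rw [← div_eq_mul_inv, inv_eq_one_div, div_le_div_iff₀ (by positivity) (by positivity),
          one_mul]
        calc _ ≤ 4 ^ (N + 1) * D ^ (N + 1) := h3
          _ = 4 ^ (N + 1) * D * D ^ N := by ring
          _ ≤ 4 ^ (N + 1) * D * (2 ^ N * (2 ^ k) ^ N) := by gcongr
          _ = _ := by ring
      calc _ ≤ (N + 2) * (2 ^ N * 4 ^ (N + 1) * D * ((t + D + ‖x - y‖) ^ (N + 1))⁻¹) := by gcongr
        _ = (N + 2) * 2 ^ N * 4 ^ (N + 1) * D * ((t + D + ‖x - y‖) ^ (N + 1))⁻¹ := by ring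
        _ ≤ _ := by
          gcongr
          have h6 : 0 ≤ C₁ * 2 ^ (N + 1) + poiB N * 4 ^ (N + 1) := by positivity
          linarith

lemma abs_qint_kerT_le (N : ℕ) : ∃ C : ℝ, 0 < C ∧ ∀ (ω : RSpace N) (k : ℤ) (x y : Fin N → ℝ)
    (t : ℝ), 0 < t →
    |qint (kerT ω k x) (y, t)| ≤ C * 2 ^ k * ((t + 2 ^ k + ‖x - y‖) ^ (N + 1))⁻¹ := by
  obtain ⟨C, hC, h⟩ := exists_qint_aker_le N
  refine ⟨2 * C, by positivity, fun ω k x y t ht => ?_⟩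
  have hk0 : (0 : ℝ) < 2 ^ k := by positivity
  have hk1 : (2 : ℝ) * 2 ^ (k - 1) = 2 ^ k := by
    rw [← zpow_one_add₀ (by norm_num)]; congr 1; ring
  obtain ⟨m, hm⟩ := h (2 ^ k) x y t ht
  rw [qint_kerT ω k x y ht]
  have h1 := hm (randOffset ω (k - 1)) (k - 1) (by linarith) (by linarith)
  have h2 := hm (randOffset ω k) k le_rfl (by linarith)
  rw [show ∀ u v : ℝ, u - v = (u - m) - (v - m) by intros; ring]
  refine (abs_sub _ _).trans ((add_le_add h1 h2).trans (le_of_eq ?_))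
  ring

lemma aker_comm (a : Fin N → ℝ) (k : ℤ) (x z : Fin N → ℝ) : aker a k x z = aker a k z x := by
  unfold aker
  by_cases h : z ∈ dcube a k x
  · rw [Set.indicator_of_mem h, Set.indicator_of_mem (mem_dcube_comm.1 h)]
  · rw [Set.indicator_of_notMem h, Set.indicator_of_notMem (fun h' => h (mem_dcube_comm.1 h'))]

lemma lintegral_enorm_aker (a : Fin N → ℝ) (k : ℤ) (x : Fin N → ℝ) :
    ∫⁻ z, ‖aker a k x z‖ₑ = 1 := by
  have h2 : (0 : ℝ) < ((2 : ℝ) ^ k) ^ N := by positivity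
  have h1 : ∀ z, ‖aker a k x z‖ₑ =
      (dcube a k x).indicator (fun _ => ENNReal.ofReal (((2 : ℝ) ^ k) ^ N)⁻¹) z := by
    intro z
    unfold aker
    rw [enorm_indicator_eq_indicator_enorm, Real.enorm_of_nonneg (by positivity)]
  simp only [h1]
  rw [lintegral_indicator_const (measurableSet_dcube a k x), volume_dcube,
    ← ENNReal.ofReal_mul (by positivity), inv_mul_cancel₀ h2.ne', ENNReal.ofReal_one]

lemma aker_eq_of_mem {a : Fin N → ℝ} {k : ℤ} {y z : Fin N → ℝ} (h : z ∈ dcube a k y)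
    (x : Fin N → ℝ) : aker a k x z = aker a k x y := by
  rw [aker_comm a k x z, aker_comm a k x y]
  unfold aker
  rw [dcube_eq_of_mem h]

lemma measurable_aker_left (a : Fin N → ℝ) (k : ℤ) (z : Fin N → ℝ) :
    Measurable fun x => aker a k x z := by
  simp only [fun x => aker_comm a k x z]
  unfold aker
  exact measurable_const.indicator (measurableSet_dcube a k z)

lemma lintegral_enorm_aker_sub_le (a : Fin N → ℝ) (k : ℤ) (y z : Fin N → ℝ) :
    ∫⁻ x, ‖aker a k x z - aker a k x y‖ₑ ≤ {z | z ∉ dcube a k y}.indicator (fun _ => 2) z := by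
  by_cases h : z ∈ dcube a k y
  · simp [aker_eq_of_mem h]
  · rw [Set.indicator_of_mem (by exact h)]
    calc _ ≤ ∫⁻ x, (‖aker a k z x‖ₑ + ‖aker a k y x‖ₑ) := by
          refine lintegral_mono fun x => ?_
          rw [aker_comm a k x z, aker_comm a k x y]
          exact enorm_sub_le
      _ = 2 := by
          rw [lintegral_add_left (by
            simp only [aker_comm a k z]; exact (measurable_aker_left a k z).enorm),
            lintegral_enorm_aker, lintegral_enorm_aker, one_add_one_eq_two]

lemma enorm_qint_aker_le (a : Fin N → ℝ) (k : ℤ) (x y : Fin N → ℝ) {t : ℝ} (ht : 0 < t) :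
    ‖qint (aker a k x) (y, t)‖ₑ ≤
      ∫⁻ z, ‖t * pkt N (y - z) t‖ₑ * ‖aker a k x z - aker a k x y‖ₑ := by
  have h0 : ∫ z, aker a k x y * (t * pkt N (y - z) t) = 0 := by
    rw [integral_const_mul, integral_const_mul,
      integral_sub_left_eq_self (fun x : Fin N → ℝ => pkt N x t) volume y, integral_pkt ht]
    simp
  have h1 : qint (aker a k x) (y, t) =
      ∫ z, (t * pkt N (y - z) t) * (aker a k x z - aker a k x y) := by
    rw [← sub_zero (qint _ _), ← h0]
    unfold qint
    rw [← integral_sub (integrable_mul_pkt (integrable_aker a k x) y ht)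
      ((integrable_mul_pkt_sub y ht).const_mul _)]
    congr 1 with z
    ring
  rw [h1]
  refine (enorm_integral_le_lintegral_enorm _).trans (le_of_eq ?_)
  simp only [enorm_mul]

/-- Two points are separated at scale `2 ^ k` with probability at most `(N |y - z| / 2 ^ k) ^ (1 / 2)`. -/
lemma measure_notMem_dcube_le_sqrt (k : ℤ) (y z : Fin N → ℝ) :
    randMeasure N {ω | z ∉ dcube (randOffset ω k) k y} ≤
      ENNReal.ofReal ((N * ‖z - y‖ / 2 ^ k) ^ (1 / 2 : ℝ)) := by
  have h0 : 0 ≤ N * ‖z - y‖ / 2 ^ k := by positivity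
  rcases le_total (N * ‖z - y‖ / 2 ^ k) 1 with h | h
  · refine (measure_notMem_dcube_le k y z).trans (ENNReal.ofReal_le_ofReal ?_)
    exact Real.self_le_rpow_of_le_one h0 h (by norm_num)
  · refine prob_le_one.trans ?_
    rw [ENNReal.one_le_ofReal]
    exact Real.one_le_rpow h (by norm_num)

lemma lintegral_qint_aker_le (N : ℕ) : ∃ C : ℝ, 0 < C ∧ ∀ (k : ℤ) (y : Fin N → ℝ) (t : ℝ), 0 < t →
    ∫⁻ ω, ∫⁻ x, ‖qint (aker (randOffset ω k) k x) (y, t)‖ₑ ∂volume ∂randMeasure N ≤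
      ENNReal.ofReal (C * (t / 2 ^ k) ^ (1 / 2 : ℝ)) := by
  have hB := poiB_pos N
  have hdec : 0 ≤ decC N (1 / 2) := by
    unfold decC
    have hr1 : (2 : ℝ) ^ (-(1 / 2 : ℝ)) < 1 :=
      Real.rpow_lt_one_of_one_lt_of_neg (by norm_num) (by norm_num)
    have : 0 < 1 - (2 : ℝ) ^ (-(1 / 2 : ℝ)) := by linarith
    positivity
  refine ⟨2 * poiB N * (N : ℝ) ^ (1 / 2 : ℝ) * decC N (1 / 2) * 2 ^ N + 1, by positivity,
    fun k y t ht => ?_⟩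
  have hk0 : (0 : ℝ) < 2 ^ k := by positivity
  have hpk : Measurable fun z : Fin N → ℝ => ‖t * pkt N (y - z) t‖ₑ :=
    (((continuous_pkt ht).comp (continuous_const.sub continuous_id)).const_mul t).measurable.enorm
  have hm : Measurable fun q : RSpace N × (Fin N → ℝ) × (Fin N → ℝ) =>
      ‖t * pkt N (y - q.2.2) t‖ₑ *
        ‖aker (randOffset q.1 k) k q.2.1 q.2.2 - aker (randOffset q.1 k) k q.2.1 y‖ₑ := by
    refine (hpk.comp (measurable_snd.comp measurable_snd)).mul (Measurable.enorm ?_)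
    have h3 : Measurable (fun q : RSpace N × (Fin N → ℝ) × (Fin N → ℝ) => (q.1, (q.2.1, y))) := by
      fun_prop
    have h4 := (measurable_aker (N := N) k).comp h3
    simp only [Function.comp_def] at h4
    exact (measurable_aker k).sub h4
  have hset : Measurable fun q : RSpace N × (Fin N → ℝ) =>
      {z | z ∉ dcube (randOffset q.1 k) k y}.indicator (fun _ => (2 : ℝ≥0∞)) q.2 := by
    have h5 : Measurable fun q : RSpace N × (Fin N → ℝ) => (randOffset q.1 k, (y, q.2)) :=
      ((measurable_randOffset k).comp measurable_fst).prodMk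
        (measurable_const.prodMk measurable_snd)
    exact Measurable.indicator (s := {q : RSpace N × (Fin N → ℝ) |
      q.2 ∉ dcube (randOffset q.1 k) k y}) (f := fun _ => (2 : ℝ≥0∞)) measurable_const
      (h5 (measurableSet_mem_dcube k)).compl
  calc ∫⁻ ω, ∫⁻ x, ‖qint (aker (randOffset ω k) k x) (y, t)‖ₑ ∂volume ∂randMeasure N
      ≤ ∫⁻ ω, ∫⁻ x, ∫⁻ z, ‖t * pkt N (y - z) t‖ₑ *
        ‖aker (randOffset ω k) k x z - aker (randOffset ω k) k x y‖ₑ ∂volume ∂volume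
          ∂randMeasure N := by
        gcongr with ω x
        exact enorm_qint_aker_le _ _ _ _ ht
    _ ≤ ∫⁻ ω, ∫⁻ z, ‖t * pkt N (y - z) t‖ₑ *
        {z | z ∉ dcube (randOffset ω k) k y}.indicator (fun _ => 2) z ∂volume
          ∂randMeasure N := by
        refine lintegral_mono fun ω => ?_
        beta_reduce
        have h6 := hm.comp (measurable_prodMk_left (x := ω))
        simp only [Function.comp_def] at h6
        rw [lintegral_lintegral_swap h6.aemeasurable]
        refine lintegral_mono fun z => ?_
        rw [lintegral_const_mul' _ _ enorm_ne_top]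
        exact mul_le_mul_right (lintegral_enorm_aker_sub_le _ _ _ _) _
    _ = ∫⁻ z, ‖t * pkt N (y - z) t‖ₑ *
        (2 * randMeasure N {ω | z ∉ dcube (randOffset ω k) k y}) := by
        rw [lintegral_lintegral_swap ((hpk.comp measurable_snd).mul hset).aemeasurable]
        congr 1 with z
        rw [lintegral_const_mul' _ _ enorm_ne_top]
        congr 1
        have h5 : Measurable fun ω : RSpace N => (randOffset ω k, (y, z)) :=
          (measurable_randOffset k).prodMk measurable_const
        exact lintegral_indicator_const (s := {ω | z ∉ dcube (randOffset ω k) k y})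
          (h5 (measurableSet_mem_dcube k)).compl 2
    _ ≤ ∫⁻ z, ENNReal.ofReal (2 * poiB N * (N : ℝ) ^ (1 / 2 : ℝ) * t * (2 ^ k) ^ (-(1 / 2 : ℝ))) *
        ENNReal.ofReal ((t + ‖y - z‖) ^ (-((N : ℝ) + 1 / 2))) := by
        refine lintegral_mono fun z => ?_
        calc _ ≤ ENNReal.ofReal (t * (poiB N * ((‖y - z‖ + t) ^ (N + 1))⁻¹)) *
              (ENNReal.ofReal 2 * ENNReal.ofReal ((N * ‖z - y‖ / 2 ^ k) ^ (1 / 2 : ℝ))) := by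
              refine mul_le_mul' ?_ (mul_le_mul' ?_ (measure_notMem_dcube_le_sqrt k y z))
              · rw [Real.enorm_eq_ofReal_abs, abs_mul, abs_of_pos ht]
                exact ENNReal.ofReal_le_ofReal
                  (mul_le_mul_of_nonneg_left (abs_pkt_le _ ht) ht.le)
              · simp
          _ ≤ _ := by
              rw [← ENNReal.ofReal_mul (by norm_num), ← ENNReal.ofReal_mul (by positivity),
                ← ENNReal.ofReal_mul (by positivity)]
              apply ENNReal.ofReal_le_ofReal
              have hL : 0 < t + ‖y - z‖ := by positivity
              have e1 : (t + ‖y - z‖) ^ (-((N : ℝ) + 1 / 2)) =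
                  ((t + ‖y - z‖) ^ (N + 1))⁻¹ * (t + ‖y - z‖) ^ (1 / 2 : ℝ) := by
                rw [← Real.rpow_natCast, ← Real.rpow_neg hL.le, ← Real.rpow_add hL]
                congr 1; push_cast; ring
              rw [e1, Real.div_rpow (by positivity) hk0.le,
                Real.mul_rpow (by positivity) (norm_nonneg _), norm_sub_rev z y,
                Real.rpow_neg hk0.le, add_comm ‖y - z‖ t]
              have e2 : ‖y - z‖ ^ (1 / 2 : ℝ) ≤ (t + ‖y - z‖) ^ (1 / 2 : ℝ) :=
                Real.rpow_le_rpow (norm_nonneg _) (by linarith) (by norm_num)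
              calc _ = 2 * poiB N * (N : ℝ) ^ (1 / 2 : ℝ) * t * ((2 ^ k) ^ (1 / 2 : ℝ))⁻¹ *
                    (((t + ‖y - z‖) ^ (N + 1))⁻¹ * ‖y - z‖ ^ (1 / 2 : ℝ)) := by
                    rw [div_eq_mul_inv]; ring
                _ ≤ _ := by gcongr
    _ ≤ ENNReal.ofReal (2 * poiB N * (N : ℝ) ^ (1 / 2 : ℝ) * t * (2 ^ k) ^ (-(1 / 2 : ℝ))) *
        (ENNReal.ofReal (decC N (1 / 2) * t ^ (-(1 / 2 : ℝ))) * 2 ^ N) := by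
        rw [lintegral_const_mul' _ _ ENNReal.ofReal_ne_top]
        exact mul_le_mul_right (lintegral_decay_one_le (by norm_num) y ht) _
    _ ≤ _ := by
        rw [show (2 : ℝ≥0∞) ^ N = ENNReal.ofReal (2 ^ N) by
          rw [ENNReal.ofReal_pow (by norm_num), ENNReal.ofReal_ofNat],
          ← ENNReal.ofReal_mul (by positivity), ← ENNReal.ofReal_mul (by positivity)]
        apply ENNReal.ofReal_le_ofReal
        have e3 : (t / 2 ^ k) ^ (1 / 2 : ℝ) = t * (2 ^ k) ^ (-(1 / 2 : ℝ)) * t ^ (-(1 / 2 : ℝ)) := by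
          rw [Real.div_rpow ht.le hk0.le, Real.rpow_neg hk0.le, div_eq_mul_inv,
            show (1 / 2 : ℝ) = 1 + -(1 / 2) by norm_num, Real.rpow_add ht, Real.rpow_one]
          norm_num
          ring
        rw [e3]
        have : 0 ≤ t * (2 ^ k) ^ (-(1 / 2 : ℝ)) * t ^ (-(1 / 2 : ℝ)) := by positivity
        nlinarith

/-- The auxiliary weight in the Schur test between dyadic and continuous scales. -/
def rho (k : ℤ) (t : ℝ) : ℝ := (t / (t + 2 ^ k)) ^ (1 / 4 : ℝ)

lemma rho_pos (k : ℤ) {t : ℝ} (ht : 0 < t) : 0 < rho k t := by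
  unfold rho; positivity

lemma decC_nonneg (N : ℕ) {a : ℝ} (ha : 0 < a) : 0 ≤ decC N a := by
  unfold decC
  have hr1 : (2 : ℝ) ^ (-a) < 1 :=
    Real.rpow_lt_one_of_one_lt_of_neg (by norm_num) (by linarith)
  have : 0 < 1 - (2 : ℝ) ^ (-a) := by linarith
  positivity

lemma rho_inv_le (k : ℤ) {t : ℝ} (ht : 0 < t) :
    (rho k t)⁻¹ ≤ 2 * (max 1 (2 ^ k / t)) ^ (1 / 4 : ℝ) := by
  have hk0 : (0 : ℝ) < 2 ^ k := by positivity
  unfold rho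
  rw [← Real.inv_rpow (by positivity), inv_div]
  have h1 : (t + 2 ^ k) / t ≤ 2 * max 1 (2 ^ k / t) := by
    rw [add_div, div_self ht.ne', two_mul]
    exact add_le_add (le_max_left _ _) (le_max_right _ _)
  have h2 : (2 : ℝ) ^ (1 / 4 : ℝ) ≤ 2 := by
    conv_rhs => rw [← Real.rpow_one 2]
    exact Real.rpow_le_rpow_of_exponent_le (by norm_num) (by norm_num)
  have h3 : (0 : ℝ) < max 1 (2 ^ k / t) := lt_max_of_lt_left one_pos
  calc _ ≤ (2 * max 1 (2 ^ k / t)) ^ (1 / 4 : ℝ) :=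
        Real.rpow_le_rpow (by positivity) h1 (by norm_num)
    _ = 2 ^ (1 / 4 : ℝ) * (max 1 (2 ^ k / t)) ^ (1 / 4 : ℝ) :=
        Real.mul_rpow (by norm_num) h3.le
    _ ≤ _ := by gcongr

lemma lintegral_qint_kerT_le (N : ℕ) : ∃ C : ℝ, 0 < C ∧ ∀ (k : ℤ) (y : Fin N → ℝ) (t : ℝ), 0 < t →
    (∫⁻ ω, ∫⁻ x, ‖qint (kerT ω k x) (y, t)‖ₑ ∂volume ∂randMeasure N) *
      ENNReal.ofReal (rho k t)⁻¹ ≤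
      ENNReal.ofReal (C * (min (2 ^ k / t) (t / 2 ^ k)) ^ (1 / 4 : ℝ)) := by
  obtain ⟨C₁, hC₁, h₁⟩ := abs_qint_kerT_le N
  obtain ⟨C₂, hC₂, h₂⟩ := lintegral_qint_aker_le N
  have hdec := decC_nonneg N one_pos
  refine ⟨C₁ * decC N 1 * 2 ^ N * 2 + C₂ * 3 * 2, by positivity, fun k y t ht => ?_⟩
  have hk0 : (0 : ℝ) < 2 ^ k := by positivity
  have hrho := rho_inv_le k ht
  rcases le_total ((2 : ℝ) ^ k) t with hkt | hkt
  · have hr1 : (2 : ℝ) ^ k / t ≤ 1 := (div_le_one ht).2 hkt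
    have hr2 : 1 ≤ t / (2 : ℝ) ^ k := (one_le_div hk0).2 hkt
    rw [max_eq_left hr1, Real.one_rpow, mul_one] at hrho
    rw [min_eq_left (hr1.trans hr2)]
    have hb : ∀ ω : RSpace N, ∫⁻ x, ‖qint (kerT ω k x) (y, t)‖ₑ ≤
        ENNReal.ofReal (C₁ * decC N 1 * 2 ^ N * (2 ^ k / t)) := by
      intro ω
      calc _ ≤ ∫⁻ x, ENNReal.ofReal (C₁ * 2 ^ k) *
            ENNReal.ofReal ((t + 2 ^ k + ‖y - x‖) ^ (-((N : ℝ) + 1))) := by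
            refine lintegral_mono fun x => ?_
            rw [Real.enorm_eq_ofReal_abs, ← ENNReal.ofReal_mul (by positivity)]
            refine ENNReal.ofReal_le_ofReal ((h₁ ω k x y t ht).trans (le_of_eq ?_))
            rw [Real.rpow_neg (by positivity), norm_sub_rev x y, ← Real.rpow_natCast]
            push_cast; rfl
        _ ≤ ENNReal.ofReal (C₁ * 2 ^ k) *
            (ENNReal.ofReal (decC N 1 * (t + 2 ^ k) ^ (-1 : ℝ)) * 2 ^ N) := by
            rw [lintegral_const_mul' _ _ ENNReal.ofReal_ne_top]
            exact mul_le_mul_right (lintegral_decay_one_le one_pos y (by positivity)) _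
        _ ≤ _ := by
            rw [show (2 : ℝ≥0∞) ^ N = ENNReal.ofReal (2 ^ N) by
              rw [ENNReal.ofReal_pow (by norm_num), ENNReal.ofReal_ofNat],
              ← ENNReal.ofReal_mul (by positivity), ← ENNReal.ofReal_mul (by positivity)]
            apply ENNReal.ofReal_le_ofReal
            have e : (t + 2 ^ k : ℝ) ^ (-1 : ℝ) ≤ t⁻¹ := by
              rw [Real.rpow_neg_one]
              gcongr
              linarith
            calc _ ≤ C₁ * 2 ^ k * (decC N 1 * t⁻¹ * 2 ^ N) := by gcongr
              _ = _ := by rw [div_eq_mul_inv]; ring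
    calc _ ≤ (∫⁻ _ : RSpace N, ENNReal.ofReal (C₁ * decC N 1 * 2 ^ N * (2 ^ k / t)) ∂randMeasure N) *
          ENNReal.ofReal 2 :=
          mul_le_mul' (lintegral_mono hb) (ENNReal.ofReal_le_ofReal hrho)
      _ ≤ _ := by
          rw [lintegral_const, measure_univ, mul_one, ← ENNReal.ofReal_mul (by positivity)]
          apply ENNReal.ofReal_le_ofReal
          have e : (2 : ℝ) ^ k / t ≤ (2 ^ k / t) ^ (1 / 4 : ℝ) :=
            Real.self_le_rpow_of_le_one (by positivity) hr1 (by norm_num)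
          calc _ = C₁ * decC N 1 * 2 ^ N * 2 * (2 ^ k / t) := by ring
            _ ≤ (C₁ * decC N 1 * 2 ^ N * 2 + C₂ * 3 * 2) * (2 ^ k / t) ^ (1 / 4 : ℝ) := by
              gcongr
              linarith
  · have hr1 : t / (2 : ℝ) ^ k ≤ 1 := (div_le_one hk0).2 hkt
    have hr2 : 1 ≤ (2 : ℝ) ^ k / t := (one_le_div ht).2 hkt
    rw [max_eq_right hr2] at hrho
    rw [min_eq_right (hr1.trans hr2)]
    have hk1 : (2 : ℝ) * 2 ^ (k - 1) = 2 ^ k := by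
      rw [← zpow_one_add₀ (by norm_num)]; congr 1; ring
    have hk10 : (0 : ℝ) < 2 ^ (k - 1) := by positivity
    have hmq : ∀ j : ℤ, Measurable fun q : RSpace N × (Fin N → ℝ) =>
        ‖qint (aker (randOffset q.1 j) j q.2) (y, t)‖ₑ := by
      intro j
      refine Measurable.enorm (StronglyMeasurable.measurable ?_)
      unfold qint
      refine StronglyMeasurable.integral_prod_right'
        (f := fun q : (RSpace N × (Fin N → ℝ)) × (Fin N → ℝ) =>
          aker (randOffset q.1.1 j) j q.1.2 q.2 * (t * pkt N (y - q.2) t)) (Measurable.stronglyMeasurable ?_)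
      have h3 : Measurable (fun q : (RSpace N × (Fin N → ℝ)) × (Fin N → ℝ) =>
        (q.1.1, (q.1.2, q.2))) := by fun_prop
      have h4 := (measurable_aker (N := N) j).comp h3
      simp only [Function.comp_def] at h4
      exact h4.mul ((((continuous_pkt ht).measurable.comp
        (measurable_const.sub measurable_snd))).const_mul t)
    have hsum : ∫⁻ ω, ∫⁻ x, ‖qint (kerT ω k x) (y, t)‖ₑ ∂volume ∂randMeasure N ≤
        ENNReal.ofReal (C₂ * 3 * (t / 2 ^ k) ^ (1 / 2 : ℝ)) := by
      calc _ ≤ ∫⁻ ω, ((∫⁻ x, ‖qint (aker (randOffset ω (k - 1)) (k - 1) x) (y, t)‖ₑ) +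
            ∫⁻ x, ‖qint (aker (randOffset ω k) k x) (y, t)‖ₑ) ∂randMeasure N := by
            refine lintegral_mono fun ω => ?_
            have hx := (hmq (k - 1)).comp (measurable_prodMk_left (x := ω))
            simp only [Function.comp_def] at hx
            rw [← lintegral_add_left hx]
            refine lintegral_mono fun x => ?_
            rw [qint_kerT ω k x y ht]
            exact enorm_sub_le
        _ ≤ ENNReal.ofReal (C₂ * (t / 2 ^ (k - 1)) ^ (1 / 2 : ℝ)) +
            ENNReal.ofReal (C₂ * (t / 2 ^ k) ^ (1 / 2 : ℝ)) := by
            rw [lintegral_add_left (hmq (k - 1)).lintegral_prod_right']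
            exact add_le_add (h₂ _ _ _ ht) (h₂ _ _ _ ht)
        _ ≤ _ := by
            rw [← ENNReal.ofReal_add (by positivity) (by positivity)]
            apply ENNReal.ofReal_le_ofReal
            have e1 : t / 2 ^ (k - 1) = 2 * (t / 2 ^ k) := by rw [← hk1]; field_simp
            have e2 : (2 : ℝ) ^ (1 / 2 : ℝ) ≤ 2 := by
              conv_rhs => rw [← Real.rpow_one 2]
              exact Real.rpow_le_rpow_of_exponent_le (by norm_num) (by norm_num)
            rw [e1, Real.mul_rpow (by norm_num) (by positivity)]
            have e3 : 0 ≤ (t / 2 ^ k) ^ (1 / 2 : ℝ) := by positivity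
            calc _ ≤ C₂ * (2 * (t / 2 ^ k) ^ (1 / 2 : ℝ)) + C₂ * (t / 2 ^ k) ^ (1 / 2 : ℝ) := by
                  gcongr
              _ = _ := by ring
    refine (mul_le_mul' hsum (ENNReal.ofReal_le_ofReal hrho)).trans ?_
    rw [← ENNReal.ofReal_mul (by positivity)]
    apply ENNReal.ofReal_le_ofReal
    have e1 : (t / 2 ^ k) ^ (1 / 2 : ℝ) * (2 ^ k / t) ^ (1 / 4 : ℝ) = (t / 2 ^ k) ^ (1 / 4 : ℝ) := by
      rw [← inv_div t, Real.inv_rpow (by positivity), ← Real.rpow_neg (by positivity),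
        ← Real.rpow_add (by positivity)]
      norm_num
    calc _ = C₂ * 3 * 2 * ((t / 2 ^ k) ^ (1 / 2 : ℝ) * (2 ^ k / t) ^ (1 / 4 : ℝ)) := by ring
      _ ≤ _ := by
        rw [e1]
        gcongr
        have : 0 ≤ C₁ * decC N 1 * 2 ^ N * 2 := by positivity
        linarith

lemma tsum_min_zpow_le : ∃ K : ℝ≥0∞, K ≠ ⊤ ∧ ∀ t : ℝ, 0 < t →
    ∑' k : ℤ, ENNReal.ofReal ((min (2 ^ k / t) (t / 2 ^ k)) ^ (1 / 4 : ℝ)) ≤ K := by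
  set r : ℝ := (2⁻¹ : ℝ) ^ (1 / 4 : ℝ) with hr
  have hr0 : 0 ≤ r := by positivity
  have hr1 : r < 1 := Real.rpow_lt_one (by norm_num) (by norm_num) (by norm_num)
  have hs : Summable fun m : ℤ => 2 * r ^ m.natAbs := by
    refine Summable.mul_left _ (Summable.of_nat_of_neg ?_ ?_)
    · simpa using summable_geometric_of_lt_one hr0 hr1
    · simpa using summable_geometric_of_lt_one hr0 hr1
  refine ⟨∑' m : ℤ, ENNReal.ofReal (2 * r ^ m.natAbs), hs.tsum_ofReal_ne_top, fun t ht => ?_⟩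
  obtain ⟨k₀, hk1, hk2⟩ := exists_mem_Ioc_zpow ht (one_lt_two (α := ℝ))
  rw [← (Equiv.addLeft k₀).tsum_eq]
  refine ENNReal.tsum_le_tsum fun m => ENNReal.ofReal_le_ofReal ?_
  have hm : min (2 ^ (k₀ + m) / t) (t / 2 ^ (k₀ + m)) ≤ 2 * (2⁻¹) ^ m.natAbs := by
    have h0 : (0 : ℝ) < 2 ^ k₀ := by positivity
    rw [zpow_add_one₀ (by norm_num)] at hk2
    obtain ⟨a, rfl | rfl⟩ := m.eq_nat_or_neg
    · refine (min_le_right _ _).trans ?_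
      rw [zpow_add₀ (by norm_num), Int.natAbs_natCast, zpow_natCast, inv_pow,
        div_le_iff₀ (by positivity)]
      refine hk2.trans (le_of_eq ?_)
      field_simp
    · refine (min_le_left _ _).trans ?_
      rw [zpow_add₀ (by norm_num), Int.natAbs_neg, Int.natAbs_natCast, zpow_neg, zpow_natCast,
        inv_pow, div_le_iff₀ ht, mul_comm]
      have : (0 : ℝ) < (2 ^ a)⁻¹ := by positivity
      nlinarith
  have h2 : (2 : ℝ) ^ (1 / 4 : ℝ) ≤ 2 := by
    conv_rhs => rw [← Real.rpow_one 2]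
    exact Real.rpow_le_rpow_of_exponent_le (by norm_num) (by norm_num)
  calc (min (2 ^ (k₀ + m) / t) (t / 2 ^ (k₀ + m))) ^ (1 / 4 : ℝ)
      ≤ (2 * (2⁻¹) ^ m.natAbs) ^ (1 / 4 : ℝ) :=
        Real.rpow_le_rpow (by positivity) hm (by norm_num)
    _ = 2 ^ (1 / 4 : ℝ) * r ^ m.natAbs := by
        rw [Real.mul_rpow (by norm_num) (by positivity), hr, ← Real.rpow_natCast,
          ← Real.rpow_natCast, ← Real.rpow_mul (by norm_num), ← Real.rpow_mul (by norm_num),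
          mul_comm (1 / 4 : ℝ)]
    _ ≤ _ := by gcongr

lemma tsum_qint_kerT_le (N : ℕ) : ∃ C : ℝ≥0∞, C ≠ ⊤ ∧ ∀ (y : Fin N → ℝ) (t : ℝ), 0 < t →
    ∑' k : ℤ, (∫⁻ ω, ∫⁻ x, ‖qint (kerT ω k x) (y, t)‖ₑ ∂volume ∂randMeasure N) *
      ENNReal.ofReal (rho k t)⁻¹ ≤ C := by
  obtain ⟨C, hC, h⟩ := lintegral_qint_kerT_le N
  obtain ⟨K, hK, hK'⟩ := tsum_min_zpow_le
  refine ⟨ENNReal.ofReal C * K, ENNReal.mul_ne_top ENNReal.ofReal_ne_top hK, fun y t ht => ?_⟩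
  refine (ENNReal.tsum_le_tsum fun k => h k y t ht).trans ?_
  simp only [ENNReal.ofReal_mul hC.le]
  rw [ENNReal.tsum_mul_left]
  exact mul_le_mul_right (hK' t ht) _

/-! ### Dyadic weights -/

lemma ennreal_div_sqrt_step {a s s' : ℝ≥0∞} (h : s = a + s') (hs : s ≠ ⊤) :
    a / s ^ (1 / 2 : ℝ) + 2 * s' ^ (1 / 2 : ℝ) ≤ 2 * s ^ (1 / 2 : ℝ) := by
  have ha : a ≠ ⊤ := fun h' => hs (by rw [h, h']; simp)
  have hs' : s' ≠ ⊤ := fun h' => hs (by rw [h, h']; simp)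
  rcases eq_or_ne s 0 with h0 | h0
  · have : a = 0 ∧ s' = 0 := by rw [h0] at h; simpa using h.symm
    rw [this.1, this.2, h0]; simp
  lift a to NNReal using ha
  lift s' to NNReal using hs'
  lift s to NNReal using hs
  have h2 : s = a + s' := by exact_mod_cast h
  have hpos : 0 < s := by
    rw [pos_iff_ne_zero]; exact_mod_cast h0
  have hrt : ∀ x : NNReal, (x : ℝ≥0∞) ^ (1 / 2 : ℝ) = (x.sqrt : NNReal) := by
    intro x
    rw [NNReal.sqrt_eq_rpow, ENNReal.coe_rpow_of_nonneg _ (by norm_num)]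
  rw [hrt, hrt]
  have hu : s.sqrt ≠ 0 := by simpa using hpos.ne'
  have e1 : (s.sqrt : ℝ) * s.sqrt = s := by exact_mod_cast NNReal.mul_self_sqrt s
  have e2 : (s'.sqrt : ℝ) * s'.sqrt = s' := by exact_mod_cast NNReal.mul_self_sqrt s'
  have h3 : (s : ℝ) = a + s' := by exact_mod_cast h2
  have hu' : 0 < (s.sqrt : ℝ) := by exact_mod_cast pos_iff_ne_zero.mpr hu
  generalize s.sqrt = u at *
  generalize s'.sqrt = v at *
  rw [← ENNReal.coe_div hu]
  norm_cast
  rw [← NNReal.coe_le_coe]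
  push_cast
  have h4 : (a : ℝ) = u * u - v * v := by linarith
  have h5 : (a : ℝ) / u ≤ 2 * u - 2 * v := by
    rw [h4, div_le_iff₀ hu']; nlinarith [sq_nonneg ((u : ℝ) - v)]
  linarith

lemma tsum_div_sqrt_le {a s : ℤ → ℝ≥0∞} {M : ℝ≥0∞} (h : ∀ j, s j = a j + s (j + 1))
    (hM : ∀ j, s j ≤ M) : ∑' j, a j / s j ^ (1 / 2 : ℝ) ≤ 2 * M ^ (1 / 2 : ℝ) := by
  rcases eq_or_ne M ⊤ with rfl | hMt
  · simp
  have hs : ∀ j, s j ≠ ⊤ := fun j => ((hM j).trans_lt hMt.lt_top).ne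
  have key : ∀ (m : ℕ) (j : ℤ), ∑ i ∈ Finset.range m, a (j + i) / s (j + i) ^ (1 / 2 : ℝ) +
      2 * s (j + m) ^ (1 / 2 : ℝ) ≤ 2 * s j ^ (1 / 2 : ℝ) := by
    intro m j
    induction m with
    | zero => simp
    | succ m ih =>
      rw [Finset.sum_range_succ, add_assoc]
      refine le_trans ?_ ih
      gcongr
      have := ennreal_div_sqrt_step (h (j + m)) (hs _)
      push_cast
      rwa [← add_assoc]
  rw [ENNReal.tsum_eq_iSup_sum]
  refine iSup_le fun F => ?_
  obtain ⟨m, hm⟩ : ∃ m : ℕ, ∀ j ∈ F, |j| < m := by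
    refine ⟨F.sup Int.natAbs + 1, fun j hj => ?_⟩
    have h1 := Finset.le_sup (f := Int.natAbs) hj
    rw [Int.abs_eq_natAbs]
    exact_mod_cast Nat.lt_succ_of_le h1
  have hsub : F ⊆ (Finset.range (2 * m)).image fun i : ℕ => -(m : ℤ) + i := by
    intro j hj
    have := abs_lt.mp (hm j hj)
    refine Finset.mem_image.mpr ⟨(j + m).toNat, ?_, ?_⟩
    · rw [Finset.mem_range]; omega
    · omega
  calc ∑ j ∈ F, a j / s j ^ (1 / 2 : ℝ)
      ≤ ∑ j ∈ (Finset.range (2 * m)).image fun i : ℕ => -(m : ℤ) + i, a j / s j ^ (1 / 2 : ℝ) :=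
        Finset.sum_le_sum_of_subset hsub
    _ = ∑ i ∈ Finset.range (2 * m), a (-(m : ℤ) + i) / s (-(m : ℤ) + i) ^ (1 / 2 : ℝ) := by
        rw [Finset.sum_image]; intro i _ i' _ hii; simpa using hii
    _ ≤ 2 * s (-(m : ℤ)) ^ (1 / 2 : ℝ) := le_trans le_self_add (key _ _)
    _ ≤ 2 * M ^ (1 / 2 : ℝ) := by
        gcongr; exact hM _

/-- The range of heights attached to the dyadic cubes of sidelength `2^j`. -/
def tset (N : ℕ) (j : ℤ) : Set ℝ := Set.Ioc (N * (2 : ℝ) ^ j) (N * (2 : ℝ) ^ (j + 1))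

lemma measurableSet_tset (N : ℕ) (j : ℤ) : MeasurableSet (tset N j) := measurableSet_Ioc

lemma tset_pairwiseDisjoint (N : ℕ) : Pairwise (Function.onFun Disjoint (tset N)) := by
  have : ∀ i j : ℤ, i < j → Disjoint (tset N i) (tset N j) := by
    intro i j hij
    rw [Set.disjoint_left]
    intro t h1 h2
    have : (N : ℝ) * 2 ^ (i + 1) ≤ N * 2 ^ j := by gcongr; norm_num; omega
    linarith [h1.2, h2.1]
  intro i j hij
  rcases lt_or_gt_of_ne hij with h | h
  · exact this i j h
  · exact (this j i h).symm

lemma iUnion_tset (hN : 0 < N) : ⋃ j, tset N j = Set.Ioi 0 := by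
  have hN' : (0 : ℝ) < N := by exact_mod_cast hN
  ext t
  simp only [Set.mem_iUnion, Set.mem_Ioi]
  constructor
  · rintro ⟨j, hj⟩
    exact lt_of_le_of_lt (by positivity) hj.1
  · intro ht
    obtain ⟨j, hj⟩ := exists_mem_Ioc_zpow (x := t / N) (y := (2 : ℝ)) (by positivity) (by norm_num)
    refine ⟨j, ?_, ?_⟩
    · have := hj.1; rw [lt_div_iff₀ hN'] at this; linarith
    · have := hj.2; rw [div_le_iff₀ hN'] at this; linarith

lemma mem_dcube_of_le {c : Fin N → ℝ} {j : ℤ} {x z : Fin N → ℝ} (m : ℕ) (h : z ∈ dcube c j x) :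
    z ∈ dcube c (j + m) x := by
  intro i
  have e : ∀ u : ℝ, ⌊u / (2 : ℝ) ^ (j + (m : ℤ))⌋ = ⌊u / (2 : ℝ) ^ j⌋ / ((2 ^ m : ℕ) : ℤ) := by
    intro u
    rw [← Int.floor_div_natCast, zpow_add₀ (by norm_num), ← div_div]
    simp
  rw [e, e, h i]

/-- The density `G(y,t) t^{-(N+1)}`, integrated over a dyadic cube of sidelength `2^j` and the
heights in `tset N j`. -/
def wa (G : (Fin N → ℝ) × ℝ → ℝ≥0∞) (j : ℤ) (y : Fin N → ℝ) : ℝ≥0∞ :=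
  ∫⁻ z in dcube 0 j y, ∫⁻ t in tset N j, G (z, t) * ENNReal.ofReal ((t ^ (N + 1))⁻¹)

/-- The sum of `wa` over all dyadic cubes containing the cube of sidelength `2^j` at `y`. -/
def ws (G : (Fin N → ℝ) × ℝ → ℝ≥0∞) (j : ℤ) (y : Fin N → ℝ) : ℝ≥0∞ :=
  ∑' m : ℕ, wa G (j + m) y

/-- The square of the conical square function with density `G`. -/
def conesq (G : (Fin N → ℝ) × ℝ → ℝ≥0∞) (x : Fin N → ℝ) : ℝ≥0∞ :=
  ∫⁻ p in {p : (Fin N → ℝ) × ℝ | Real.sqrt (∑ i, (p.1 i - x i) ^ 2) < p.2},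
    G p * ENNReal.ofReal ((p.2 ^ (N + 1))⁻¹)

lemma wa_eq_of_mem (G : (Fin N → ℝ) × ℝ → ℝ≥0∞) {j : ℤ} {y z : Fin N → ℝ}
    (h : z ∈ dcube 0 j y) (m : ℕ) : wa G (j + m) z = wa G (j + m) y := by
  unfold wa
  rw [dcube_eq_of_mem (mem_dcube_of_le m h)]

lemma ws_eq_of_mem (G : (Fin N → ℝ) × ℝ → ℝ≥0∞) {j : ℤ} {y z : Fin N → ℝ}
    (h : z ∈ dcube 0 j y) : ws G j z = ws G j y := by
  unfold ws
  exact tsum_congr fun m => wa_eq_of_mem G h m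

lemma ws_succ (G : (Fin N → ℝ) × ℝ → ℝ≥0∞) (j : ℤ) (y : Fin N → ℝ) :
    ws G j y = wa G j y + ws G (j + 1) y := by
  unfold ws
  rw [tsum_eq_zero_add' ENNReal.summable]
  congr 1
  · simp
  · refine tsum_congr fun m => ?_
    congr 1; push_cast; ring

lemma sqrt_sum_sq_le (v : Fin N → ℝ) {M : ℝ} (hM : ‖v‖ ≤ M) : Real.sqrt (∑ i, v i ^ 2) ≤ N * M := by
  have hM0 : 0 ≤ M := (norm_nonneg _).trans hM
  have h1 : ∑ i, v i ^ 2 ≤ ∑ _i : Fin N, M ^ 2 := by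
    refine Finset.sum_le_sum fun i _ => ?_
    have := (norm_le_pi_norm v i).trans hM
    rw [Real.norm_eq_abs] at this
    exact sq_le_sq' (by linarith [abs_le.mp this]) (abs_le.mp this).2
  refine Real.sqrt_le_iff.mpr ⟨by positivity, h1.trans ?_⟩
  simp only [Finset.sum_const, Finset.card_univ, Fintype.card_fin, nsmul_eq_mul]
  rw [mul_pow]
  refine mul_le_mul_of_nonneg_right ?_ (sq_nonneg M)
  rcases Nat.eq_zero_or_pos N with rfl | h
  · simp
  · have : (1 : ℝ) ≤ N := by exact_mod_cast h
    nlinarith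

lemma measurableSet_cone : MeasurableSet {q : (Fin N → ℝ) × ((Fin N → ℝ) × ℝ) |
    Real.sqrt (∑ i, (q.2.1 i - q.1 i) ^ 2) < q.2.2} := by
  refine measurableSet_lt ?_ (by fun_prop)
  fun_prop

lemma measurable_conesq {G : (Fin N → ℝ) × ℝ → ℝ≥0∞} (hG : Measurable G) :
    Measurable (conesq G) := by
  have h : conesq G = fun x => ∫⁻ p : (Fin N → ℝ) × ℝ,
      {q : (Fin N → ℝ) × ((Fin N → ℝ) × ℝ) |
        Real.sqrt (∑ i, (q.2.1 i - q.1 i) ^ 2) < q.2.2}.indicator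
        (fun q => G q.2 * ENNReal.ofReal ((q.2.2 ^ (N + 1))⁻¹)) (x, p) := by
    funext x
    unfold conesq
    have h1 : MeasurableSet {p : (Fin N → ℝ) × ℝ | Real.sqrt (∑ i, (p.1 i - x i) ^ 2) < p.2} :=
      measurableSet_cone.preimage measurable_prodMk_left
    rw [← lintegral_indicator h1]
    rfl
  rw [h]
  refine Measurable.lintegral_prod_right' (Measurable.indicator ?_ measurableSet_cone)
  exact (hG.comp measurable_snd).mul (by fun_prop)

lemma measurableSet_mem_dcube_zero (j : ℤ) :
    MeasurableSet {q : (Fin N → ℝ) × (Fin N → ℝ) | q.2 ∈ dcube 0 j q.1} := by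
  have h := (measurableSet_mem_dcube (N := N) j).preimage
    (measurable_prodMk_left (x := (0 : Fin N → ℝ)))
  exact h

lemma measurable_wa_inner {G : (Fin N → ℝ) × ℝ → ℝ≥0∞} (hG : Measurable G) (T : Set ℝ) :
    Measurable fun z : Fin N → ℝ =>
      ∫⁻ t in T, G (z, t) * ENNReal.ofReal ((t ^ (N + 1))⁻¹) := by
  refine Measurable.lintegral_prod_right' (f := fun p : (Fin N → ℝ) × ℝ =>
    G p * ENNReal.ofReal ((p.2 ^ (N + 1))⁻¹)) ?_
  exact hG.mul (by fun_prop)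

lemma measurable_wa {G : (Fin N → ℝ) × ℝ → ℝ≥0∞} (hG : Measurable G) (j : ℤ) :
    Measurable (wa G j) := by
  have h : wa G j = fun y => ∫⁻ z,
      {q : (Fin N → ℝ) × (Fin N → ℝ) | q.2 ∈ dcube 0 j q.1}.indicator
        (fun q => ∫⁻ t in tset N j, G (q.2, t) * ENNReal.ofReal ((t ^ (N + 1))⁻¹)) (y, z) := by
    funext y
    unfold wa
    rw [← lintegral_indicator (measurableSet_dcube 0 j y)]
    rfl
  rw [h]
  refine Measurable.lintegral_prod_right'
    (Measurable.indicator ?_ (measurableSet_mem_dcube_zero j))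
  exact (measurable_wa_inner hG _).comp measurable_snd

lemma measurable_ws {G : (Fin N → ℝ) × ℝ → ℝ≥0∞} (hG : Measurable G) (j : ℤ) :
    Measurable (ws G j) :=
  Measurable.ennreal_tsum fun _ => measurable_wa hG _

lemma wa_eq_lintegral_prod {G : (Fin N → ℝ) × ℝ → ℝ≥0∞} (hG : Measurable G) (j : ℤ)
    (y : Fin N → ℝ) : wa G j y =
      ∫⁻ p in dcube 0 j y ×ˢ tset N j, G p * ENNReal.ofReal ((p.2 ^ (N + 1))⁻¹) := by
  rw [Measure.volume_eq_prod, ← Measure.prod_restrict, lintegral_prod]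
  · rfl
  · exact (hG.mul (by fun_prop)).aemeasurable

lemma ws_le_conesq {G : (Fin N → ℝ) × ℝ → ℝ≥0∞} (hG : Measurable G) (j : ℤ)
    (y : Fin N → ℝ) : ws G j y ≤ conesq G y := by
  unfold ws
  simp_rw [wa_eq_lintegral_prod hG]
  rw [← lintegral_iUnion]
  · refine lintegral_mono_set ?_
    intro p hp
    obtain ⟨m, hm⟩ := Set.mem_iUnion.mp hp
    have h1 : ‖p.1 - y‖ ≤ 2 ^ (j + (m : ℤ)) := by
      rw [norm_sub_rev]; exact norm_sub_le_of_mem_dcube hm.1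
    exact lt_of_le_of_lt (sqrt_sum_sq_le (p.1 - y) h1) hm.2.1
  · exact fun m => (measurableSet_dcube _ _ _).prod (measurableSet_tset _ _)
  · intro m m' hmm
    refine Set.disjoint_left.mpr fun p hp hp' => ?_
    exact Set.disjoint_left.mp (tset_pairwiseDisjoint N
      (show j + (m : ℤ) ≠ j + m' by simpa using hmm)) hp.2 hp'.2

/-- The weight: constant on each dyadic cell `Q × tset N j`. -/
def ww (G : (Fin N → ℝ) × ℝ → ℝ≥0∞) (p : (Fin N → ℝ) × ℝ) : ℝ≥0∞ :=
  (∑' j, (tset N j).indicator (fun _ => ws G j p.1) p.2) ^ (1 / 2 : ℝ)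

lemma ww_eq (G : (Fin N → ℝ) × ℝ → ℝ≥0∞) {j : ℤ} {t : ℝ} (ht : t ∈ tset N j) (y : Fin N → ℝ) :
    ww G (y, t) = ws G j y ^ (1 / 2 : ℝ) := by
  unfold ww
  rw [tsum_eq_single j]
  · rw [Set.indicator_of_mem ht]
  · intro i hi
    rw [Set.indicator_of_notMem]
    exact fun h => Set.disjoint_left.mp (tset_pairwiseDisjoint N hi) h ht

lemma measurable_ww {G : (Fin N → ℝ) × ℝ → ℝ≥0∞} (hG : Measurable G) : Measurable (ww G) := by
  refine Measurable.pow_const (Measurable.ennreal_tsum fun j => ?_) _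
  have : (fun p : (Fin N → ℝ) × ℝ => (tset N j).indicator (fun _ => ws G j p.1) p.2) =
      (Prod.snd ⁻¹' tset N j).indicator fun p => ws G j p.1 := by
    funext p; rfl
  rw [this]
  exact ((measurable_ws hG j).comp measurable_fst).indicator
    (measurable_snd (measurableSet_tset N j))

lemma setLIntegral_ww_le {G : (Fin N → ℝ) × ℝ → ℝ≥0∞} (hG : Measurable G) (j : ℤ) :
    ∫⁻ p in Set.univ ×ˢ tset N j, ENNReal.ofReal p.2⁻¹ * (G p / ww G p) ≤
      ENNReal.ofReal ((2 * N) ^ N) * ∫⁻ y, wa G j y / ws G j y ^ (1 / 2 : ℝ) := by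
  set H : (Fin N → ℝ) → ℝ≥0∞ := fun z =>
    ∫⁻ t in tset N j, G (z, t) * ENNReal.ofReal ((t ^ (N + 1))⁻¹) with hH
  have hHm : Measurable H := measurable_wa_inner hG _
  have hwsm : Measurable fun y => (ws G j y ^ (1 / 2 : ℝ))⁻¹ := ((measurable_ws hG j).pow_const _).inv
  have hm : Measurable fun p : (Fin N → ℝ) × ℝ => ENNReal.ofReal p.2⁻¹ * (G p / ww G p) :=
    Measurable.mul (by fun_prop) (hG.div (measurable_ww hG))
  have h2 : (0 : ℝ) < 2 ^ j := by positivity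
  -- reduce to an integral over cubes
  have step1 : ∫⁻ p in Set.univ ×ˢ tset N j, ENNReal.ofReal p.2⁻¹ * (G p / ww G p) ≤
      ∫⁻ z, ENNReal.ofReal ((2 * N) ^ N * (2 ^ j) ^ N) * (H z * (ws G j z ^ (1 / 2 : ℝ))⁻¹) := by
    rw [Measure.volume_eq_prod, ← Measure.prod_restrict, Measure.restrict_univ,
      lintegral_prod _ hm.aemeasurable]
    refine lintegral_mono fun z => ?_
    beta_reduce
    rw [hH]
    beta_reduce
    have hGz : Measurable fun t => G (z, t) * ENNReal.ofReal ((t ^ (N + 1))⁻¹) :=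
      (hG.comp measurable_prodMk_left).mul (by fun_prop)
    rw [← lintegral_mul_const _ hGz, ← lintegral_const_mul' _ _ ENNReal.ofReal_ne_top]
    refine setLIntegral_mono' (measurableSet_tset N j) fun t ht => ?_
    rw [ww_eq G ht, div_eq_mul_inv, ← mul_assoc, ← mul_assoc]
    refine mul_le_mul_left ?_ _
    rw [mul_left_comm, mul_comm]
    refine mul_le_mul_right ?_ _
    rw [← ENNReal.ofReal_mul (by positivity)]
    refine ENNReal.ofReal_le_ofReal ?_
    have ht0 : 0 < t := lt_of_le_of_lt (by positivity) ht.1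
    have ht1 : t ≤ 2 * N * 2 ^ j := by
      have := ht.2
      rw [zpow_add_one₀ (by norm_num)] at this
      linarith
    rw [← mul_pow]
    have h4 : t ^ N ≤ (2 * N * 2 ^ j) ^ N := by gcongr
    calc t⁻¹ = t ^ N * (t ^ (N + 1))⁻¹ := by
          rw [pow_succ]; field_simp
      _ ≤ _ := by gcongr
  refine step1.trans ?_
  have step2 : ∀ z, ENNReal.ofReal ((2 * N) ^ N * (2 ^ j) ^ N) * (H z * (ws G j z ^ (1 / 2 : ℝ))⁻¹)
      = ENNReal.ofReal ((2 * N) ^ N) * ∫⁻ y, (dcube 0 j z).indicator 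
        (fun y => H z * (ws G j y ^ (1 / 2 : ℝ))⁻¹) y := by
    intro z
    rw [lintegral_indicator (measurableSet_dcube _ _ _), setLIntegral_congr_fun
      (g := fun _ => H z * (ws G j z ^ (1 / 2 : ℝ))⁻¹) (measurableSet_dcube _ _ _)]
    · rw [setLIntegral_const, volume_dcube, ENNReal.ofReal_mul (by positivity)]
      ring
    · intro y hy
      beta_reduce
      rw [ws_eq_of_mem G hy]
  simp_rw [step2]
  rw [lintegral_const_mul' _ _ ENNReal.ofReal_ne_top, lintegral_lintegral_swap]
  · refine mul_le_mul_right (lintegral_mono fun y => ?_) _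
    beta_reduce
    have : ∀ z, (dcube 0 j z).indicator (fun y => H z * (ws G j y ^ (1 / 2 : ℝ))⁻¹) y =
      (dcube 0 j y).indicator (fun z => H z * (ws G j y ^ (1 / 2 : ℝ))⁻¹) z := by
      intro z
      by_cases h : y ∈ dcube 0 j z
      · rw [Set.indicator_of_mem h, Set.indicator_of_mem (mem_dcube_comm.mp h)]
      · rw [Set.indicator_of_notMem h, Set.indicator_of_notMem (mt mem_dcube_comm.mp h)]
    simp_rw [this]
    rw [lintegral_indicator (measurableSet_dcube _ _ _), lintegral_mul_const _ hHm]
    rfl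
  · have : (Function.uncurry fun z y => (dcube 0 j z).indicator
        (fun y => H z * (ws G j y ^ (1 / 2 : ℝ))⁻¹) y) =
      {q : (Fin N → ℝ) × (Fin N → ℝ) | q.2 ∈ dcube 0 j q.1}.indicator
        (fun q => H q.1 * (ws G j q.2 ^ (1 / 2 : ℝ))⁻¹) := by
      funext q; rfl
    rw [this]
    exact (((hHm.comp measurable_fst).mul (hwsm.comp measurable_snd)).indicator
      (measurableSet_mem_dcube_zero j)).aemeasurable

lemma lintegral_div_ww_le (hN : 0 < N) {G : (Fin N → ℝ) × ℝ → ℝ≥0∞} (hG : Measurable G) :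
    ∫⁻ p, G p / ww G p ∂hm N ≤
      ENNReal.ofReal ((2 * N) ^ N) * (2 * ∫⁻ x, conesq G x ^ (1 / 2 : ℝ)) := by
  rw [lintegral_hm]
  have e : (volume : Measure (Fin N → ℝ)).prod (volume.restrict (Set.Ioi (0 : ℝ))) =
      (volume : Measure ((Fin N → ℝ) × ℝ)).restrict (⋃ j, Set.univ ×ˢ tset N j) := by
    rw [← Set.prod_iUnion, iUnion_tset hN, Measure.volume_eq_prod, ← Measure.prod_restrict,
      Measure.restrict_univ]
  rw [e, lintegral_iUnion (fun j => MeasurableSet.univ.prod (measurableSet_tset N j))]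
  · calc _ ≤ ∑' j : ℤ, ENNReal.ofReal ((2 * N) ^ N) *
          ∫⁻ y, wa G j y / ws G j y ^ (1 / 2 : ℝ) :=
        ENNReal.tsum_le_tsum fun j => setLIntegral_ww_le hG j
      _ = ENNReal.ofReal ((2 * N) ^ N) * ∫⁻ y, ∑' j : ℤ, wa G j y / ws G j y ^ (1 / 2 : ℝ) := by
        rw [ENNReal.tsum_mul_left, lintegral_tsum]
        exact fun j => ((measurable_wa hG j).div ((measurable_ws hG j).pow_const _)).aemeasurable
      _ ≤ _ := by
        refine mul_le_mul_right ?_ _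
        rw [← lintegral_const_mul _ ((measurable_conesq hG).pow_const _)]
        refine lintegral_mono fun y => ?_
        exact tsum_div_sqrt_le (fun j => ws_succ G j y) fun j => ws_le_conesq hG j y
  · intro i j hij
    refine Set.disjoint_left.mpr fun p hp hp' => ?_
    exact Set.disjoint_left.mp (tset_pairwiseDisjoint N hij) hp.2 hp'.2

/-! ### The weighted kernel estimate -/

lemma ae_hm_pos (N : ℕ) : ∀ᵐ p ∂hm N, 0 < p.2 := by
  have h1 : ∀ᵐ p ∂((volume : Measure (Fin N → ℝ)).prod (volume.restrict (Set.Ioi (0 : ℝ)))),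
      0 < p.2 :=
    Measure.quasiMeasurePreserving_snd.ae (ae_restrict_mem measurableSet_Ioi)
  exact (withDensity_absolutelyContinuous _ _).ae_le h1

lemma lintegral_hm_le {F K : (Fin N → ℝ) × ℝ → ℝ≥0∞} (hK : Measurable K)
    (h : ∀ y t, 0 < t → ENNReal.ofReal t⁻¹ * F (y, t) ≤ K (y, t)) :
    ∫⁻ p, F p ∂hm N ≤ ∫⁻ t in Set.Ioi 0, ∫⁻ y, K (y, t) := by
  rw [lintegral_hm, ← lintegral_prod_symm' _ hK]
  refine lintegral_mono_ae ?_
  have h1 : ∀ᵐ p ∂((volume : Measure (Fin N → ℝ)).prod (volume.restrict (Set.Ioi (0 : ℝ)))),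
      0 < p.2 :=
    Measure.quasiMeasurePreserving_snd.ae (ae_restrict_mem measurableSet_Ioi)
  filter_upwards [h1] with p hp
  exact h p.1 p.2 hp

lemma lintegral_rpow_mul_rpow_le {d : ℝ} (hd : 0 < d) :
    ∫⁻ t in Set.Ioi 0, ENNReal.ofReal (d * t ^ (-(7 / 8 : ℝ)) * (t + d) ^ (-(9 / 8 : ℝ))) ≤ 8 := by
  set g : ℝ → ℝ := fun t => 8 * (t / (t + d)) ^ (1 / 8 : ℝ) with hg
  have hder : ∀ t ∈ Set.Ioi (0 : ℝ),
      HasDerivAt g (d * t ^ (-(7 / 8 : ℝ)) * (t + d) ^ (-(9 / 8 : ℝ))) t := by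
    intro t ht
    have ht : 0 < t := ht
    have htd : 0 < t + d := by linarith
    have h1 : HasDerivAt (fun t => t / (t + d)) ((1 * (t + d) - t * 1) / (t + d) ^ 2) t :=
      (hasDerivAt_id t).div ((hasDerivAt_id t).add_const d) htd.ne'
    have h2 := (h1.rpow_const (p := (1 / 8 : ℝ)) (Or.inl (by positivity))).const_mul 8
    refine h2.congr_deriv ?_
    rw [Real.div_rpow ht.le htd.le, show (1 / 8 : ℝ) - 1 = -(7 / 8) by norm_num,
      show (-(9 / 8) : ℝ) = (7 / 8 : ℝ) - 2 by norm_num, Real.rpow_sub htd,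
      Real.rpow_neg htd.le (7 / 8)]
    norm_num
    field_simp
  have hcont : ContinuousWithinAt g (Set.Ici 0) 0 := by
    refine ContinuousAt.continuousWithinAt ?_
    refine ContinuousAt.mul continuousAt_const (ContinuousAt.rpow_const ?_ (Or.inr (by norm_num)))
    exact continuousAt_id.div (by fun_prop) (by simp [hd.ne'])
  have hpos : ∀ t ∈ Set.Ioi (0 : ℝ), 0 ≤ d * t ^ (-(7 / 8 : ℝ)) * (t + d) ^ (-(9 / 8 : ℝ)) := by
    intro t ht
    have ht : 0 < t := ht
    positivity
  have hlim : Tendsto g atTop (𝓝 8) := by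
    have h1 : Tendsto (fun t : ℝ => t / (t + d)) atTop (𝓝 1) := by
      have h2 : Tendsto (fun t : ℝ => 1 - d / (t + d)) atTop (𝓝 (1 - 0)) :=
        tendsto_const_nhds.sub (Tendsto.div_atTop tendsto_const_nhds
          (tendsto_atTop_add_const_right _ _ tendsto_id))
      rw [sub_zero] at h2
      refine h2.congr' ?_
      filter_upwards [eventually_gt_atTop 0] with t ht
      field_simp
      ring
    have h3 := (h1.rpow_const (p := (1 / 8 : ℝ)) (Or.inl one_ne_zero)).const_mul 8
    simp only [Real.one_rpow, mul_one] at h3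
    exact h3
  have hInt := integrableOn_Ioi_deriv_of_nonneg hcont hder hpos hlim
  have hval := integral_Ioi_of_hasDerivAt_of_nonneg hcont hder hpos hlim
  rw [← ofReal_integral_eq_lintegral_ofReal hInt
    ((ae_restrict_iff' measurableSet_Ioi).mpr (ae_of_all _ hpos)), hval]
  simp [hg]

/-- The exponent of the maximal function in the weighted estimate. -/
def pexp (N : ℕ) : ℝ := 1 + 1 / (8 * N)

lemma one_lt_pexp (hN : 0 < N) : 1 < pexp N := by
  unfold pexp
  have : (0 : ℝ) < N := by exact_mod_cast hN
  have : 0 < 1 / (8 * (N : ℝ)) := by positivity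
  linarith

/-- A power less than one of the conical square function. -/
def hfun (G : (Fin N → ℝ) × ℝ → ℝ≥0∞) (x : Fin N → ℝ) : ℝ≥0∞ :=
  (conesq G x ^ (1 / 2 : ℝ)) ^ (1 / pexp N)

lemma measurable_hfun {G : (Fin N → ℝ) × ℝ → ℝ≥0∞} (hG : Measurable G) : Measurable (hfun G) :=
  ((measurable_conesq hG).pow_const _).pow_const _

lemma exists_mem_tset (hN : 0 < N) {t : ℝ} (ht : 0 < t) : ∃ j, t ∈ tset N j := by
  have : t ∈ ⋃ j, tset N j := by rw [iUnion_tset hN]; exact ht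
  exact Set.mem_iUnion.mp this

lemma ww_le (hN : 0 < N) {G : (Fin N → ℝ) × ℝ → ℝ≥0∞} (hG : Measurable G) (y : Fin N → ℝ)
    {t : ℝ} (ht : 0 < t) : ww G (y, t) ≤ conesq G y ^ (1 / 2 : ℝ) := by
  obtain ⟨j, hj⟩ := exists_mem_tset hN ht
  rw [ww_eq G hj]
  gcongr
  exact ws_le_conesq hG j y

lemma ww_rpow_le_mfun (hN : 0 < N) {G : (Fin N → ℝ) × ℝ → ℝ≥0∞} (hG : Measurable G)
    (x y : Fin N → ℝ) {t : ℝ} (ht : 0 < t) :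
    ww G (y, t) ^ (1 / pexp N) ≤
      ENNReal.ofReal ((4 * N * ((‖x - y‖ + t) / t)) ^ N) * mfun (hfun G) x := by
  obtain ⟨j, hj⟩ := exists_mem_tset hN ht
  have hN1 : (1 : ℝ) ≤ N := by exact_mod_cast hN
  have hp := one_lt_pexp hN
  have h2 : (0 : ℝ) < 2 ^ j := by positivity
  set R := ‖x - y‖ + 2 * 2 ^ j with hR
  have hR0 : 0 < R := by positivity
  have hsub : dcube 0 j y ⊆ Metric.ball x R := by
    intro z hz
    rw [Metric.mem_ball, dist_eq_norm, norm_sub_rev]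
    have h3 := norm_sub_le_of_mem_dcube hz
    have h4 := norm_add_le (x - y) (y - z)
    rw [sub_add_sub_cancel] at h4
    linarith
  have h5 : ENNReal.ofReal ((2 ^ j) ^ N) * ww G (y, t) ^ (1 / pexp N) ≤
      ENNReal.ofReal ((2 * R) ^ N) * mfun (hfun G) x := by
    refine le_trans ?_ (lintegral_ball_le (hfun G) x hR0)
    refine le_trans ?_ (lintegral_mono_set hsub)
    rw [← volume_dcube (0 : Fin N → ℝ) j y, mul_comm, ← setLIntegral_const]
    refine setLIntegral_mono' (measurableSet_dcube _ _ _) fun z hz => ?_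
    unfold hfun
    have : ww G (y, t) = ww G (z, t) := by
      rw [ww_eq G hj, ww_eq G hj, ws_eq_of_mem G hz]
    rw [this]
    exact ENNReal.rpow_le_rpow (ww_le hN hG z ht) (by positivity)
  have h6 : ENNReal.ofReal ((2 ^ j) ^ N) ≠ 0 := by
    rw [Ne, ENNReal.ofReal_eq_zero, not_le]; positivity
  have h7 : ww G (y, t) ^ (1 / pexp N) = (ENNReal.ofReal ((2 ^ j) ^ N))⁻¹ *
      (ENNReal.ofReal ((2 ^ j) ^ N) * ww G (y, t) ^ (1 / pexp N)) := by
    rw [← mul_assoc, ENNReal.inv_mul_cancel h6 ENNReal.ofReal_ne_top, one_mul]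
  rw [h7]
  refine (mul_le_mul_right h5 _).trans ?_
  rw [← mul_assoc]
  refine mul_le_mul_left ?_ _
  rw [← ENNReal.ofReal_inv_of_pos (by positivity), ← ENNReal.ofReal_mul (by positivity)]
  refine ENNReal.ofReal_le_ofReal ?_
  rw [← inv_pow, ← mul_pow]
  refine pow_le_pow_left₀ (by positivity) ?_ _
  have ht1 : t ≤ 2 * N * 2 ^ j := by
    have := hj.2
    rw [zpow_add_one₀ (by norm_num)] at this
    linarith
  rw [hR, inv_mul_le_iff₀ h2, mul_div_assoc', mul_div_assoc', le_div_iff₀ ht]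
  have h8 : ‖x - y‖ * t ≤ ‖x - y‖ * (2 * N * 2 ^ j) := by gcongr
  have h9 : (2 : ℝ) ^ j * t ≤ N * (2 ^ j * t) := le_mul_of_one_le_left (by positivity) hN1
  nlinarith

lemma ww_le_mul (hN : 0 < N) {G : (Fin N → ℝ) × ℝ → ℝ≥0∞} (hG : Measurable G)
    (x y : Fin N → ℝ) {t : ℝ} (ht : 0 < t) :
    ww G (y, t) ≤ hfun G y * (ENNReal.ofReal ((4 * N * ((‖x - y‖ + t) / t)) ^ (1 / 8 : ℝ)) *
      mfun (hfun G) x ^ (pexp N - 1)) := by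
  have hN0 : (0 : ℝ) < N := by exact_mod_cast hN
  have hp := one_lt_pexp hN
  have h0 : 0 < 1 / pexp N := by positivity
  have h1 : ww G (y, t) = ww G (y, t) ^ (1 / pexp N) *
      (ww G (y, t) ^ (1 / pexp N)) ^ (pexp N - 1) := by
    rw [← ENNReal.rpow_mul, ← ENNReal.rpow_add_of_nonneg _ _ h0.le (by
      have : 0 ≤ pexp N - 1 := by linarith
      positivity)]
    rw [show 1 / pexp N + 1 / pexp N * (pexp N - 1) = 1 by field_simp; ring, ENNReal.rpow_one]
  rw [h1]
  refine mul_le_mul' (ENNReal.rpow_le_rpow (ww_le hN hG y ht) h0.le) ?_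
  refine (ENNReal.rpow_le_rpow (ww_rpow_le_mfun hN hG x y ht) (by linarith)).trans ?_
  rw [ENNReal.mul_rpow_of_nonneg _ _ (by linarith),
    ENNReal.ofReal_rpow_of_nonneg (by positivity) (by linarith), ← Real.rpow_natCast,
    ← Real.rpow_mul (by positivity)]
  have : (N : ℝ) * (pexp N - 1) = 1 / 8 := by unfold pexp; field_simp; ring
  rw [this]

lemma kernel_weight_le {C₀ t D d : ℝ} (hC₀ : 0 ≤ C₀) (ht : 0 < t) (htD : t ≤ D) (hd : 0 ≤ d)
    {e : ℝ} (he : 0 ≤ e) (n : ℕ) :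
    t⁻¹ * (C₀ * e * ((D + d) ^ (n + 1))⁻¹ * (t / D) ^ (1 / 4 : ℝ)) *
        (4 * n * ((d + t) / t)) ^ (1 / 8 : ℝ) ≤
      (C₀ * (4 * n) ^ (1 / 8 : ℝ)) * (e * t ^ (-(7 / 8 : ℝ)) * D ^ (-(1 / 4 : ℝ))) *
        (D + d) ^ (-((n : ℝ) + 7 / 8)) := by
  have hD : 0 < D := by linarith
  have hDd : 0 < D + d := by linarith
  rw [Real.mul_rpow (by positivity) (by positivity), Real.div_rpow (by positivity) ht.le,
    Real.div_rpow ht.le hD.le]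
  have h1 : (d + t) ^ (1 / 8 : ℝ) ≤ (D + d) ^ (1 / 8 : ℝ) := by
    exact Real.rpow_le_rpow (by positivity) (by linarith) (by norm_num)
  have h2 : (D + d) ^ (-((n : ℝ) + 7 / 8)) = (D + d) ^ (1 / 8 : ℝ) * ((D + d) ^ (n + 1))⁻¹ := by
    rw [← Real.rpow_natCast, ← Real.rpow_neg hDd.le, ← Real.rpow_add hDd]
    congr 1; push_cast; ring
  have h3 : t ^ (-(7 / 8 : ℝ)) = t⁻¹ * t ^ (1 / 4 : ℝ) * (t ^ (1 / 8 : ℝ))⁻¹ := by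
    rw [← Real.rpow_neg_one, ← Real.rpow_neg ht.le, ← Real.rpow_add ht, ← Real.rpow_add ht]
    norm_num
  rw [h2, h3, Real.rpow_neg hD.le]
  calc _ = (C₀ * (4 * n) ^ (1 / 8 : ℝ)) * (e * (t⁻¹ * t ^ (1 / 4 : ℝ) * (t ^ (1 / 8 : ℝ))⁻¹) *
        (D ^ (1 / 4 : ℝ))⁻¹) * ((d + t) ^ (1 / 8 : ℝ) * ((D + d) ^ (n + 1))⁻¹) := by
        rw [div_eq_mul_inv, div_eq_mul_inv]; ring
    _ ≤ _ := by gcongr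

/-- The constant in `lintegral_mul_ww_le`. -/
def wC (N : ℕ) (C₀ : ℝ) : ℝ≥0∞ :=
  ENNReal.ofReal (C₀ * (4 * N) ^ (1 / 8 : ℝ)) * ENNReal.ofReal (decC N (7 / 8)) * 8

lemma lintegral_mul_ww_le (hN : 0 < N) {C₀ : ℝ} (hC₀ : 0 ≤ C₀)
    {G : (Fin N → ℝ) × ℝ → ℝ≥0∞} (hG : Measurable G) (k : ℤ) (x : Fin N → ℝ)
    {b : (Fin N → ℝ) × ℝ → ℝ}
    (hb : ∀ y t, 0 < t → |b (y, t)| ≤ C₀ * 2 ^ k * ((t + 2 ^ k + ‖x - y‖) ^ (N + 1))⁻¹) :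
    ∫⁻ p, ‖b p‖ₑ * ENNReal.ofReal (rho k p.2) * ww G p ∂hm N ≤
      wC N C₀ * mfun (hfun G) x ^ pexp N := by
  have hp := one_lt_pexp hN
  have hk : (0 : ℝ) < 2 ^ k := by positivity
  set V := mfun (hfun G) x with hV
  have hdec : 0 ≤ decC N (7 / 8) := decC_nonneg N (by norm_num)
  set c : ℝ → ℝ≥0∞ := fun t => ENNReal.ofReal (C₀ * (4 * N) ^ (1 / 8 : ℝ)) *
    ENNReal.ofReal (2 ^ k * t ^ (-(7 / 8 : ℝ)) * (t + 2 ^ k) ^ (-(1 / 4 : ℝ))) *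
      V ^ (pexp N - 1) with hc
  have hcm : Measurable c := by
    refine Measurable.mul_const (Measurable.const_mul ?_ _) _
    fun_prop
  refine (lintegral_hm_le (K := fun p => c p.2 *
    (ENNReal.ofReal ((p.2 + 2 ^ k + ‖x - p.1‖) ^ (-((N : ℝ) + 7 / 8))) * hfun G p.1)) ?_ ?_).trans ?_
  · refine (hcm.comp measurable_snd).mul (Measurable.mul ?_ ((measurable_hfun hG).comp measurable_fst))
    fun_prop
  · intro y t ht
    beta_reduce
    have h1 : ‖b (y, t)‖ₑ ≤ ENNReal.ofReal (C₀ * 2 ^ k * ((t + 2 ^ k + ‖x - y‖) ^ (N + 1))⁻¹) := by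
      rw [← ofReal_norm_eq_enorm, Real.norm_eq_abs]
      exact ENNReal.ofReal_le_ofReal (hb y t ht)
    have h2 := ww_le_mul hN hG x y ht
    have hker := kernel_weight_le hC₀ ht (D := t + 2 ^ k) (by linarith) (norm_nonneg (x - y))
      hk.le N
    calc ENNReal.ofReal t⁻¹ * (‖b (y, t)‖ₑ * ENNReal.ofReal (rho k t) * ww G (y, t))
        ≤ ENNReal.ofReal t⁻¹ * (ENNReal.ofReal
            (C₀ * 2 ^ k * ((t + 2 ^ k + ‖x - y‖) ^ (N + 1))⁻¹) * ENNReal.ofReal (rho k t) *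
            (hfun G y * (ENNReal.ofReal ((4 * N * ((‖x - y‖ + t) / t)) ^ (1 / 8 : ℝ)) *
              V ^ (pexp N - 1)))) := by gcongr
      _ = ENNReal.ofReal (t⁻¹ * (C₀ * 2 ^ k * ((t + 2 ^ k + ‖x - y‖) ^ (N + 1))⁻¹ *
            (t / (t + 2 ^ k)) ^ (1 / 4 : ℝ)) * (4 * N * ((‖x - y‖ + t) / t)) ^ (1 / 8 : ℝ)) *
            (hfun G y * V ^ (pexp N - 1)) := by
          unfold rho
          rw [ENNReal.ofReal_mul (p := t⁻¹ * _) (by positivity),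
            ENNReal.ofReal_mul (p := t⁻¹) (by positivity),
            ENNReal.ofReal_mul (p := C₀ * 2 ^ k * _) (by positivity)]
          simp only [mul_assoc, mul_left_comm]
      _ ≤ ENNReal.ofReal ((C₀ * (4 * N) ^ (1 / 8 : ℝ)) *
            (2 ^ k * t ^ (-(7 / 8 : ℝ)) * (t + 2 ^ k) ^ (-(1 / 4 : ℝ))) *
            (t + 2 ^ k + ‖x - y‖) ^ (-((N : ℝ) + 7 / 8))) * (hfun G y * V ^ (pexp N - 1)) := by
          gcongr
      _ = _ := by
          rw [hc, ENNReal.ofReal_mul (by positivity), ENNReal.ofReal_mul (by positivity)]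
          ring
  · have h3 : ∀ t ∈ Set.Ioi (0 : ℝ), ∫⁻ y, c t *
        (ENNReal.ofReal ((t + 2 ^ k + ‖x - y‖) ^ (-((N : ℝ) + 7 / 8))) * hfun G y) ≤
        ENNReal.ofReal (C₀ * (4 * N) ^ (1 / 8 : ℝ)) * ENNReal.ofReal (decC N (7 / 8)) *
          V ^ pexp N *
          ENNReal.ofReal (2 ^ k * t ^ (-(7 / 8 : ℝ)) * (t + 2 ^ k) ^ (-(9 / 8 : ℝ))) := by
      intro t ht
      have ht : 0 < t := ht
      have hm1 : Measurable fun y => ENNReal.ofReal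
          ((t + 2 ^ k + ‖x - y‖) ^ (-((N : ℝ) + 7 / 8))) * hfun G y :=
        Measurable.mul (by fun_prop) (measurable_hfun hG)
      rw [lintegral_const_mul _ hm1]
      refine (mul_le_mul_right (lintegral_decay_le (a := 7 / 8) (by norm_num) (measurable_hfun hG)
        x (L := t + 2 ^ k) (by positivity)) _).trans_eq ?_
      rw [← hV, hc]
      beta_reduce
      have e1 : V ^ pexp N = V ^ (pexp N - 1) * V := by
        conv_rhs => rw [← ENNReal.rpow_one V, ← ENNReal.rpow_mul, one_mul,
          ← ENNReal.rpow_add_of_nonneg _ _ (by linarith) zero_le_one, sub_add_cancel]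
      have e2 : (t + 2 ^ k) ^ (-(9 / 8 : ℝ)) =
          (t + 2 ^ k) ^ (-(1 / 4 : ℝ)) * (t + 2 ^ k) ^ (-(7 / 8 : ℝ)) := by
        rw [← Real.rpow_add (by positivity)]; norm_num
      rw [e1, e2, ENNReal.ofReal_mul hdec, ← mul_assoc (2 ^ k * t ^ (-(7 / 8 : ℝ))),
        ENNReal.ofReal_mul (p := 2 ^ k * t ^ (-(7 / 8 : ℝ)) * (t + 2 ^ k) ^ (-(1 / 4 : ℝ)))
          (by positivity)]
      ring
    refine (setLIntegral_mono' measurableSet_Ioi h3).trans ?_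
    rw [lintegral_const_mul _ (by fun_prop)]
    refine (mul_le_mul_right (lintegral_rpow_mul_rpow_le hk) _).trans_eq ?_
    unfold wC
    ring

/-! ### The one-parameter vector-valued inequality -/

instance instSFiniteHm (N : ℕ) : SFinite (hm N) := by unfold hm; infer_instance

lemma ennreal_mul_le_sqrt_mul_sqrt {b F r r' w : ℝ≥0∞} (hr : r' * r = 1) (hw : w ≠ ⊤)
    (hF : w = 0 → F = 0) :
    b * F ≤ (b * r' * (F ^ 2 / w)) ^ (1 / 2 : ℝ) * (b * r * w) ^ (1 / 2 : ℝ) := by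
  rcases eq_or_ne w 0 with h0 | h0
  · simp [hF h0]
  rw [← ENNReal.mul_rpow_of_nonneg _ _ (by norm_num)]
  have : b * r' * (F ^ 2 / w) * (b * r * w) = (b * F) ^ (2 : ℝ) := by
    rw [div_eq_mul_inv, ENNReal.rpow_two]
    calc _ = (b * F) ^ 2 * (r' * r) * (w⁻¹ * w) := by ring
      _ = _ := by rw [hr, ENNReal.inv_mul_cancel h0 hw, mul_one, mul_one]
  rw [this, ← ENNReal.rpow_mul]
  norm_num

lemma lintegral_sqrt_mul_sqrt_le {α : Type*} [MeasurableSpace α] {μ : Measure α}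
    {f g : α → ℝ≥0∞} (hf : AEMeasurable f μ) (hg : AEMeasurable g μ) :
    ∫⁻ a, f a ^ (1 / 2 : ℝ) * g a ^ (1 / 2 : ℝ) ∂μ ≤
      (∫⁻ a, f a ∂μ) ^ (1 / 2 : ℝ) * (∫⁻ a, g a ∂μ) ^ (1 / 2 : ℝ) := by
  have h := ENNReal.lintegral_mul_le_Lp_mul_Lq μ Real.HolderConjugate.two_two
    (hf.pow_const (1 / 2 : ℝ)) (hg.pow_const (1 / 2 : ℝ))
  simp only [Pi.mul_apply, ← ENNReal.rpow_mul] at h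
  norm_num at h ⊢
  exact h

lemma ennreal_sqrt_mul_sqrt (a : ℝ≥0∞) : a ^ (1 / 2 : ℝ) * a ^ (1 / 2 : ℝ) = a := by
  rw [← ENNReal.rpow_add_of_nonneg _ _ (by norm_num) (by norm_num)]; norm_num

lemma sq_lintegral_mul_le {α : Type*} [MeasurableSpace α] {μ : Measure α}
    {b F r r' w : α → ℝ≥0∞} (hb : AEMeasurable b μ) (hF : AEMeasurable F μ)
    (hr : AEMeasurable r μ) (hr' : AEMeasurable r' μ) (hw : AEMeasurable w μ)
    (h : ∀ᵐ a ∂μ, r' a * r a = 1 ∧ w a ≠ ⊤ ∧ (w a = 0 → F a = 0)) :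
    (∫⁻ a, b a * F a ∂μ) ^ 2 ≤
      (∫⁻ a, b a * r' a * (F a ^ 2 / w a) ∂μ) * ∫⁻ a, b a * r a * w a ∂μ := by
  have h1 : ∫⁻ a, b a * F a ∂μ ≤ (∫⁻ a, b a * r' a * (F a ^ 2 / w a) ∂μ) ^ (1 / 2 : ℝ) *
      (∫⁻ a, b a * r a * w a ∂μ) ^ (1 / 2 : ℝ) := by
    refine le_trans (lintegral_mono_ae ?_) (lintegral_sqrt_mul_sqrt_le
      ((hb.mul hr').mul ((hF.pow_const 2).div hw)) ((hb.mul hr).mul hw))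
    filter_upwards [h] with a ha
    exact ennreal_mul_le_sqrt_mul_sqrt ha.1 ha.2.1 ha.2.2
  calc _ ≤ (_ * _) ^ 2 := by gcongr
    _ = _ := by rw [mul_pow, sq, sq, ennreal_sqrt_mul_sqrt, ennreal_sqrt_mul_sqrt]

/-- The parameter measure for the one-parameter random dyadic square function. -/
def tm (N : ℕ) : Measure (RSpace N × ℤ) := (randMeasure N).prod Measure.count

instance instSFiniteTm (N : ℕ) : SigmaFinite (tm N) := by unfold tm; infer_instance

lemma lintegral_tm {F : RSpace N × ℤ → ℝ≥0∞} (hF : Measurable F) :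
    ∫⁻ q, F q ∂tm N = ∑' k : ℤ, ∫⁻ ω, F (ω, k) ∂randMeasure N := by
  unfold tm
  rw [lintegral_prod_symm' _ hF, lintegral_count]

lemma measurable_qint_uncurry {Θ : Type*} [MeasurableSpace Θ] {g : Θ → (Fin N → ℝ) → ℝ}
    (hg : Measurable (Function.uncurry g)) :
    Measurable fun q : Θ × ((Fin N → ℝ) × ℝ) => qint (g q.1) q.2 := by
  have hp := measurable_pkt (N := N)
  have h : Measurable fun r : (Θ × ((Fin N → ℝ) × ℝ)) × (Fin N → ℝ) =>
      g r.1.1 r.2 * (r.1.2.2 * pkt N (r.1.2.1 - r.2) r.1.2.2) := by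
    have h1 : Measurable fun r : (Θ × ((Fin N → ℝ) × ℝ)) × (Fin N → ℝ) => g r.1.1 r.2 :=
      hg.comp ((measurable_fst.comp measurable_fst).prodMk measurable_snd)
    have h2 : Measurable fun r : (Θ × ((Fin N → ℝ) × ℝ)) × (Fin N → ℝ) =>
        pkt N (r.1.2.1 - r.2) r.1.2.2 := by
      have h4 : Measurable fun r : (Θ × ((Fin N → ℝ) × ℝ)) × (Fin N → ℝ) =>
        (r.1.2.1 - r.2, r.1.2.2) := by fun_prop
      have h5 := hp.comp h4
      simp only [Function.comp_def] at h5
      exact h5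
    have h3 : Measurable fun r : (Θ × ((Fin N → ℝ) × ℝ)) × (Fin N → ℝ) => r.1.2.2 :=
      measurable_snd.comp (measurable_snd.comp measurable_fst)
    exact h1.mul (h3.mul h2)
  exact (h.stronglyMeasurable.integral_prod_right').measurable

/-- The kernel of the martingale difference tested against the Poisson kernel, weighted. -/
def bker (q : RSpace N × ℤ) (x : Fin N → ℝ) (p : (Fin N → ℝ) × ℝ) : ℝ≥0∞ :=
  ‖qint (kerT q.1 q.2 x) p‖ₑ * ENNReal.ofReal (rho q.2 p.2)⁻¹

lemma measurable_rho : Measurable fun q : ℤ × ℝ => rho q.1 q.2 := by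
  refine measurable_from_prod_countable_right fun k => ?_
  unfold rho
  fun_prop

lemma measurable_qint_kerT : Measurable fun q : ((RSpace N × ℤ) × (Fin N → ℝ)) ×
    ((Fin N → ℝ) × ℝ) => qint (kerT q.1.1.1 q.1.1.2 q.1.2) q.2 := by
  refine measurable_qint_uncurry
    (g := fun r : (RSpace N × ℤ) × (Fin N → ℝ) => kerT r.1.1 r.1.2 r.2) ?_
  have h := measurable_kerT (N := N)
  have h2 : Measurable fun r : ((RSpace N × ℤ) × (Fin N → ℝ)) × (Fin N → ℝ) =>
    (r.1.1, r.1.2, r.2) := by fun_prop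
  have h3 := h.comp h2
  simp only [Function.comp_def] at h3
  exact h3

lemma measurable_bker : Measurable fun q : ((RSpace N × ℤ) × (Fin N → ℝ)) ×
    ((Fin N → ℝ) × ℝ) => bker q.1.1 q.1.2 q.2 := by
  unfold bker
  refine measurable_qint_kerT.enorm.mul (ENNReal.measurable_ofReal.comp (Measurable.inv ?_))
  have h2 : Measurable fun r : ((RSpace N × ℤ) × (Fin N → ℝ)) × ((Fin N → ℝ) × ℝ) =>
    (r.1.1.2, r.2.2) := by fun_prop
  have h3 := measurable_rho.comp h2
  simp only [Function.comp_def] at h3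
  exact h3

lemma lintegral_tm_bker_le (N : ℕ) : ∃ C : ℝ≥0∞, C ≠ ⊤ ∧ ∀ p : (Fin N → ℝ) × ℝ, 0 < p.2 →
    ∫⁻ q, (∫⁻ x, bker q x p) ∂tm N ≤ C := by
  obtain ⟨C, hC, h⟩ := tsum_qint_kerT_le N
  refine ⟨C, hC, fun p hp => ?_⟩
  have hm5 : Measurable fun q : RSpace N × ℤ => ∫⁻ x, bker q x p := by
    have : Measurable fun r : (RSpace N × ℤ) × (Fin N → ℝ) => (r, p) := by fun_prop
    have h9 := measurable_bker.comp this
    simp only [Function.comp_def] at h9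
    exact h9.lintegral_prod_right'
  rw [lintegral_tm hm5]
  refine le_trans (le_of_eq ?_) (h p.1 p.2 hp)
  refine tsum_congr fun k => ?_
  have hm6 : Measurable fun r : RSpace N × (Fin N → ℝ) => ‖qint (kerT r.1 k r.2) p‖ₑ := by
    have : Measurable fun r : RSpace N × (Fin N → ℝ) => (((r.1, k), r.2), p) := by fun_prop
    have h1 := measurable_qint_kerT.comp this
    simp only [Function.comp_def] at h1
    exact h1.enorm
  rw [← lintegral_mul_const _ hm6.lintegral_prod_right']
  refine lintegral_congr fun ω => ?_
  have hm7 : Measurable fun x => ‖qint (kerT ω k x) p‖ₑ := by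
    have : Measurable fun x : Fin N → ℝ => (ω, x) := by fun_prop
    have h1 := hm6.comp this
    simp only [Function.comp_def] at h1
    exact h1
  exact lintegral_mul_const _ hm7

lemma measurable_bker_mul {R : (Fin N → ℝ) × ℝ → ℝ≥0∞} (hR : Measurable R) :
    Measurable fun r : ((RSpace N × ℤ) × (Fin N → ℝ)) × ((Fin N → ℝ) × ℝ) =>
      bker r.1.1 r.1.2 r.2 * R r.2 := measurable_bker.mul (hR.comp measurable_snd)

lemma lintegral_bker_swap {R : (Fin N → ℝ) × ℝ → ℝ≥0∞} (hR : Measurable R) :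
    ∫⁻ x, ∫⁻ q, ∫⁻ p, bker q x p * R p ∂hm N ∂tm N =
      ∫⁻ p, (∫⁻ q, (∫⁻ x, bker q x p) ∂tm N) * R p ∂hm N := by
  have hm1 := measurable_bker_mul hR
  have hm2 : Measurable fun r : (RSpace N × ℤ) × (Fin N → ℝ) =>
      ∫⁻ p, bker r.1 r.2 p * R p ∂hm N := hm1.lintegral_prod_right'
  have hm8 : Measurable fun r : (Fin N → ℝ) × (RSpace N × ℤ) =>
      ∫⁻ p, bker r.2 r.1 p * R p ∂hm N := by
    have h9 := hm2.comp measurable_swap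
    simp only [Function.comp_def, Prod.fst_swap, Prod.snd_swap] at h9
    exact h9
  rw [lintegral_lintegral_swap (f := fun x q => ∫⁻ p, bker q x p * R p ∂hm N)
    hm8.aemeasurable]
  have hm4 : ∀ (q : RSpace N × ℤ) p, Measurable fun x => bker q x p := fun q p => by
    have : Measurable fun x : Fin N → ℝ => ((q, x), p) := by fun_prop
    have h9 := measurable_bker.comp this
    simp only [Function.comp_def] at h9
    exact h9
  have e1 : ∀ q : RSpace N × ℤ, ∫⁻ x, ∫⁻ p, bker q x p * R p ∂hm N =
      ∫⁻ p, (∫⁻ x, bker q x p) * R p ∂hm N := by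
    intro q
    have : Measurable fun r : (Fin N → ℝ) × ((Fin N → ℝ) × ℝ) => ((q, r.1), r.2) := by fun_prop
    have h9 := hm1.comp this
    simp only [Function.comp_def] at h9
    rw [lintegral_lintegral_swap (f := fun x p => bker q x p * R p) h9.aemeasurable]
    refine lintegral_congr fun p => ?_
    rw [lintegral_mul_const _ (hm4 q p)]
  rw [lintegral_congr e1]
  have hm3 : Measurable fun r : (RSpace N × ℤ) × ((Fin N → ℝ) × ℝ) => ∫⁻ x, bker r.1 x r.2 := by
    have : Measurable fun r : ((RSpace N × ℤ) × ((Fin N → ℝ) × ℝ)) × (Fin N → ℝ) =>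
      ((r.1.1, r.2), r.1.2) := by fun_prop
    have h9 := measurable_bker.comp this
    simp only [Function.comp_def] at h9
    exact h9.lintegral_prod_right'
  rw [lintegral_lintegral_swap (f := fun q p => (∫⁻ x, bker q x p) * R p)
    (hm3.mul (hR.comp measurable_snd)).aemeasurable]
  refine lintegral_congr fun p => ?_
  have h9 := hm3.comp (measurable_prodMk_right (y := p))
  simp only [Function.comp_def] at h9
  rw [lintegral_mul_const _ h9]

lemma lintegral_bker_le (N : ℕ) : ∃ C : ℝ≥0∞, C ≠ ⊤ ∧ ∀ R : (Fin N → ℝ) × ℝ → ℝ≥0∞,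
    Measurable R → ∫⁻ x, ∫⁻ q, ∫⁻ p, bker q x p * R p ∂hm N ∂tm N ≤ C * ∫⁻ p, R p ∂hm N := by
  obtain ⟨C, hC, h⟩ := lintegral_tm_bker_le N
  refine ⟨C, hC, fun R hR => ?_⟩
  rw [lintegral_bker_swap hR, ← lintegral_const_mul _ hR]
  refine lintegral_mono_ae ?_
  filter_upwards [ae_hm_pos N] with p hp
  exact mul_le_mul_left (h p hp) _

section OneStep

variable {Θ : Type} [MeasurableSpace Θ]

/-- The density of the square function of a family of functions. -/
def gsq (ν : Measure Θ) (g : Θ → (Fin N → ℝ) → ℝ) (p : (Fin N → ℝ) × ℝ) : ℝ≥0∞ :=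
  ∫⁻ θ, ‖qint (g θ) p‖ₑ ^ 2 ∂ν

lemma measurable_gsq (ν : Measure Θ) [SFinite ν] {g : Θ → (Fin N → ℝ) → ℝ}
    (hg : Measurable (Function.uncurry g)) : Measurable (gsq ν g) :=
  ((measurable_qint_uncurry hg).enorm.pow_const 2).lintegral_prod_left'

lemma ae_ww_nondegenerate (hN : 0 < N) (ν : Measure Θ) [SFinite ν] {g : Θ → (Fin N → ℝ) → ℝ}
    (hg : Measurable (Function.uncurry g))
    (hfin : ∫⁻ x, conesq (gsq ν g) x ^ (1 / 2 : ℝ) ≠ ⊤) :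
    ∀ᵐ θ ∂ν, ∀ᵐ p ∂hm N, ww (gsq ν g) p ≠ ⊤ ∧
      (ww (gsq ν g) p = 0 → ‖qint (g θ) p‖ₑ = 0) := by
  have hG := measurable_gsq ν hg
  have hq := (measurable_qint_uncurry hg).enorm
  have hset : MeasurableSet {r : Θ × ((Fin N → ℝ) × ℝ) | ww (gsq ν g) r.2 ≠ ⊤ ∧
      (ww (gsq ν g) r.2 = 0 → ‖qint (g r.1) r.2‖ₑ = 0)} := by
    have hw : Measurable fun r : Θ × ((Fin N → ℝ) × ℝ) => ww (gsq ν g) r.2 :=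
      (measurable_ww hG).comp measurable_snd
    have h1 : MeasurableSet {r : Θ × ((Fin N → ℝ) × ℝ) | ww (gsq ν g) r.2 = ⊤} :=
      hw (measurableSet_singleton ⊤)
    have h2 : MeasurableSet {r : Θ × ((Fin N → ℝ) × ℝ) | ww (gsq ν g) r.2 = 0} :=
      hw (measurableSet_singleton 0)
    have h3 : MeasurableSet {r : Θ × ((Fin N → ℝ) × ℝ) | ‖qint (g r.1) r.2‖ₑ = 0} :=
      hq (measurableSet_singleton 0)
    have : {r : Θ × ((Fin N → ℝ) × ℝ) | ww (gsq ν g) r.2 ≠ ⊤ ∧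
      (ww (gsq ν g) r.2 = 0 → ‖qint (g r.1) r.2‖ₑ = 0)} =
      {r | ww (gsq ν g) r.2 = ⊤}ᶜ ∩ ({r | ww (gsq ν g) r.2 = 0}ᶜ ∪
        {r | ‖qint (g r.1) r.2‖ₑ = 0}) := by
      ext r; simp [imp_iff_not_or]
    rw [this]
    exact h1.compl.inter (h2.compl.union h3)
  rw [Measure.ae_ae_comm hset]
  have hS : ∀ᵐ p ∂hm N, conesq (gsq ν g) p.1 ^ (1 / 2 : ℝ) ≠ ⊤ := by
    have h1 : ∀ᵐ x, conesq (gsq ν g) x ^ (1 / 2 : ℝ) < ⊤ :=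
      ae_lt_top ((measurable_conesq hG).pow_const _) hfin
    have h2 : ∀ᵐ p ∂((volume : Measure (Fin N → ℝ)).prod (volume.restrict (Set.Ioi (0 : ℝ)))),
        conesq (gsq ν g) p.1 ^ (1 / 2 : ℝ) ≠ ⊤ :=
      Measure.quasiMeasurePreserving_fst.ae (h1.mono fun x hx => hx.ne)
    exact (withDensity_absolutelyContinuous _ _).ae_le h2
  have hD : ∀ᵐ p ∂hm N, gsq ν g p / ww (gsq ν g) p < ⊤ := by
    refine ae_lt_top (hG.div (measurable_ww hG)) ?_
    refine ne_top_of_le_ne_top ?_ (lintegral_div_ww_le hN hG)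
    exact ENNReal.mul_ne_top ENNReal.ofReal_ne_top (ENNReal.mul_ne_top (by simp) hfin)
  filter_upwards [hS, hD, ae_hm_pos N] with p h1 h2 h3
  have h4 : ww (gsq ν g) p ≠ ⊤ := ne_top_of_le_ne_top h1 (ww_le hN hG p.1 h3)
  by_cases h0 : ww (gsq ν g) p = 0
  · have h5 : gsq ν g p = 0 := by
      by_contra h6
      rw [h0, ENNReal.div_zero h6] at h2
      exact lt_irrefl _ h2
    have hqp : Measurable fun θ => ‖qint (g θ) p‖ₑ ^ 2 :=
      (hq.comp (measurable_prodMk_right (y := p))).pow_const 2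
    have h6 := (lintegral_eq_zero_iff hqp).mp h5
    filter_upwards [h6] with θ hθ
    refine ⟨h4, fun _ => ?_⟩
    simpa using hθ
  · exact ae_of_all _ fun θ => ⟨h4, fun h => absurd h h0⟩

lemma measurable_integral_mul_kerT {g : Θ → (Fin N → ℝ) → ℝ}
    (hg : Measurable (Function.uncurry g)) :
    Measurable fun r : (Θ × (RSpace N × ℤ)) × (Fin N → ℝ) =>
      ∫ z, g r.1.1 z * kerT r.1.2.1 r.1.2.2 r.2 z := by
  have h1 : Measurable fun s : ((Θ × (RSpace N × ℤ)) × (Fin N → ℝ)) × (Fin N → ℝ) =>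
      g s.1.1.1 s.2 := by
    have : Measurable fun s : ((Θ × (RSpace N × ℤ)) × (Fin N → ℝ)) × (Fin N → ℝ) =>
      (s.1.1.1, s.2) := by fun_prop
    have h9 := hg.comp this
    simp only [Function.comp_def] at h9
    exact h9
  have h2 : Measurable fun s : ((Θ × (RSpace N × ℤ)) × (Fin N → ℝ)) × (Fin N → ℝ) =>
      kerT s.1.1.2.1 s.1.1.2.2 s.1.2 s.2 := by
    have : Measurable fun s : ((Θ × (RSpace N × ℤ)) × (Fin N → ℝ)) × (Fin N → ℝ) =>
      (s.1.1.2, s.1.2, s.2) := by fun_prop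
    have h3 := measurable_kerT.comp this
    simp only [Function.comp_def] at h3
    exact h3
  exact ((h1.mul h2).stronglyMeasurable.integral_prod_right').measurable

set_option maxHeartbeats 1000000 in
lemma lintegral_sq_integral_kerT_le (hN : 0 < N) {C₀ : ℝ} (hC₀ : 0 ≤ C₀)
    (hker : ∀ (ω : RSpace N) (k : ℤ) (x y : Fin N → ℝ) (t : ℝ), 0 < t →
      |qint (kerT ω k x) (y, t)| ≤ C₀ * 2 ^ k * ((t + 2 ^ k + ‖x - y‖) ^ (N + 1))⁻¹)
    (ν : Measure Θ) [SFinite ν] {g : Θ → (Fin N → ℝ) → ℝ}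
    (hg : Measurable (Function.uncurry g)) (hgi : ∀ θ, Integrable (g θ))
    (hfin : ∫⁻ x, conesq (gsq ν g) x ^ (1 / 2 : ℝ) ≠ ⊤) (x : Fin N → ℝ) (q : RSpace N × ℤ) :
    ∫⁻ θ, ‖∫ z, g θ z * kerT q.1 q.2 x z‖ₑ ^ 2 ∂ν ≤
      16 * (wC N C₀ * mfun (hfun (gsq ν g)) x ^ pexp N) *
        ∫⁻ p, bker q x p * (gsq ν g p / ww (gsq ν g) p) ∂hm N := by
  have hG := measurable_gsq ν hg
  have hq := (measurable_qint_uncurry hg).enorm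
  have hwm := measurable_ww hG
  have hbm : Measurable fun p => ‖qint (kerT q.1 q.2 x) p‖ₑ := by
    have : Measurable fun p : (Fin N → ℝ) × ℝ => ((q, x), p) := by fun_prop
    have h1 := measurable_qint_kerT.comp this
    simp only [Function.comp_def] at h1
    exact h1.enorm
  have hbk : Measurable fun p => bker q x p := by
    have : Measurable fun p : (Fin N → ℝ) × ℝ => ((q, x), p) := by fun_prop
    have h9 := measurable_bker.comp this
    simp only [Function.comp_def] at h9
    exact h9
  have hrm : Measurable fun p : (Fin N → ℝ) × ℝ => rho q.2 p.2 := by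
    have : Measurable fun p : (Fin N → ℝ) × ℝ => (q.2, p.2) := by fun_prop
    have h9 := measurable_rho.comp this
    simp only [Function.comp_def] at h9
    exact h9
  set K := wC N C₀ * mfun (hfun (gsq ν g)) x ^ pexp N with hK
  have hae : ∀ᵐ θ ∂ν, ‖∫ z, g θ z * kerT q.1 q.2 x z‖ₑ ^ 2 ≤
      16 * K * ∫⁻ p, bker q x p * (‖qint (g θ) p‖ₑ ^ 2 / ww (gsq ν g) p) ∂hm N := by
    filter_upwards [ae_ww_nondegenerate hN ν hg hfin] with θ hθ
    have hqθ : Measurable fun p => ‖qint (g θ) p‖ₑ := hq.comp (measurable_prodMk_left (x := θ))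
    have h1 := enorm_integral_mul_le_qint hN (hgi θ) (integrable_kerT q.1 q.2 x)
      (abs_kerT_le q.1 q.2 x) (ae_continuousAt_kerT q.1 q.2 x)
    have h2 : (∫⁻ p, ‖qint (kerT q.1 q.2 x) p‖ₑ * ‖qint (g θ) p‖ₑ ∂hm N) ^ 2 ≤ _ :=
      sq_lintegral_mul_le (r := fun p => ENNReal.ofReal (rho q.2 p.2))
        (r' := fun p => ENNReal.ofReal (rho q.2 p.2)⁻¹) (w := ww (gsq ν g))
        hbm.aemeasurable hqθ.aemeasurable hrm.ennreal_ofReal.aemeasurable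
        hrm.inv.ennreal_ofReal.aemeasurable hwm.aemeasurable (by
          filter_upwards [hθ, ae_hm_pos N] with p hp hp0
          refine ⟨?_, hp⟩
          have := rho_pos q.2 hp0
          rw [← ENNReal.ofReal_mul (by positivity), inv_mul_cancel₀ this.ne', ENNReal.ofReal_one])
    have h3 := lintegral_mul_ww_le hN hC₀ hG q.2 x (b := qint (kerT q.1 q.2 x))
      (hker q.1 q.2 x)
    calc _ ≤ (4 * ∫⁻ p, ‖qint (kerT q.1 q.2 x) p‖ₑ * ‖qint (g θ) p‖ₑ ∂hm N) ^ 2 := by gcongr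
      _ = 16 * (∫⁻ p, ‖qint (kerT q.1 q.2 x) p‖ₑ * ‖qint (g θ) p‖ₑ ∂hm N) ^ 2 := by
          rw [mul_pow]; norm_num
      _ ≤ 16 * ((∫⁻ p, bker q x p * (‖qint (g θ) p‖ₑ ^ 2 / ww (gsq ν g) p) ∂hm N) * K) :=
          mul_le_mul_right (h2.trans (mul_le_mul_right h3 _)) _
      _ = _ := by ring
  refine (lintegral_mono_ae hae).trans ?_
  have hm1 : Measurable fun r : Θ × ((Fin N → ℝ) × ℝ) =>
      bker q x r.2 * (‖qint (g r.1) r.2‖ₑ ^ 2 / ww (gsq ν g) r.2) :=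
    (hbk.comp measurable_snd).mul ((hq.pow_const 2).div (hwm.comp measurable_snd))
  rw [lintegral_const_mul _ hm1.lintegral_prod_right', lintegral_lintegral_swap hm1.aemeasurable]
  refine mul_le_mul_right (lintegral_mono fun p => le_of_eq ?_) _
  have hqp : Measurable fun θ => ‖qint (g θ) p‖ₑ ^ 2 :=
    (hq.comp (measurable_prodMk_right (y := p))).pow_const 2
  simp_rw [div_eq_mul_inv]
  rw [lintegral_const_mul _ (hqp.mul_const _), lintegral_mul_const _ hqp]
  rfl

end OneStep

lemma lintegral_kerT_le_conesq (hN : 0 < N) : ∃ C : ℝ≥0∞, C ≠ ⊤ ∧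
    ∀ {Θ : Type} [MeasurableSpace Θ] (ν : Measure Θ) [SFinite ν] (g : Θ → (Fin N → ℝ) → ℝ),
      Measurable (Function.uncurry g) → (∀ θ, Integrable (g θ)) →
      ∫⁻ x, (∫⁻ θ, ∫⁻ q, ‖∫ z, g θ z * kerT q.1 q.2 x z‖ₑ ^ 2 ∂tm N ∂ν) ^ (1 / 2 : ℝ) ≤
        C * ∫⁻ x, conesq (gsq ν g) x ^ (1 / 2 : ℝ) := by
  obtain ⟨C₀, hC₀, hker⟩ := abs_qint_kerT_le N
  obtain ⟨C₁, hC₁, hA⟩ := lintegral_bker_le N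
  obtain ⟨C₂, hC₂, hM⟩ := lintegral_mfun_rpow_le hN (one_lt_pexp hN)
  have hp := one_lt_pexp hN
  set D : ℝ≥0∞ := ENNReal.ofReal ((2 * N) ^ N) * 2 with hD
  have hwC : wC N C₀ ≠ ⊤ := by
    unfold wC
    exact ENNReal.mul_ne_top (ENNReal.mul_ne_top ENNReal.ofReal_ne_top ENNReal.ofReal_ne_top)
      (by simp)
  refine ⟨(16 * wC N C₀ * C₂) ^ (1 / 2 : ℝ) * (C₁ * D) ^ (1 / 2 : ℝ) + 1, ?_, ?_⟩
  · refine ENNReal.add_ne_top.mpr ⟨ENNReal.mul_ne_top ?_ ?_, by simp⟩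
    · exact ENNReal.rpow_ne_top_of_nonneg (by norm_num)
        (ENNReal.mul_ne_top (ENNReal.mul_ne_top (by simp) hwC) hC₂)
    · exact ENNReal.rpow_ne_top_of_nonneg (by norm_num)
        (ENNReal.mul_ne_top hC₁ (ENNReal.mul_ne_top ENNReal.ofReal_ne_top (by simp)))
  intro Θ _ ν _ g hg hgi
  by_cases hfin : ∫⁻ x, conesq (gsq ν g) x ^ (1 / 2 : ℝ) = ⊤
  · rw [hfin, ENNReal.mul_top (by simp)]
    exact le_top
  have hG := measurable_gsq ν hg
  have hVm : Measurable fun x => 16 * (wC N C₀ * mfun (hfun (gsq ν g)) x ^ pexp N) :=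
    (((measurable_mfun (measurable_hfun hG)).pow_const _).const_mul _).const_mul _
  set R : (Fin N → ℝ) × ℝ → ℝ≥0∞ := fun p => gsq ν g p / ww (gsq ν g) p with hR
  have hRm : Measurable R := hG.div (measurable_ww hG)
  have hAm : Measurable fun x => ∫⁻ q, ∫⁻ p, bker q x p * R p ∂hm N ∂tm N := by
    have hm1 : Measurable fun r : ((RSpace N × ℤ) × (Fin N → ℝ)) × ((Fin N → ℝ) × ℝ) =>
        bker r.1.1 r.1.2 r.2 * R r.2 := measurable_bker.mul (hRm.comp measurable_snd)
    exact hm1.lintegral_prod_right'.lintegral_prod_left'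
  have hpt : ∀ x, ∫⁻ θ, ∫⁻ q, ‖∫ z, g θ z * kerT q.1 q.2 x z‖ₑ ^ 2 ∂tm N ∂ν ≤
      (16 * (wC N C₀ * mfun (hfun (gsq ν g)) x ^ pexp N)) *
        ∫⁻ q, ∫⁻ p, bker q x p * R p ∂hm N ∂tm N := by
    intro x
    have hmx : Measurable fun r : Θ × (RSpace N × ℤ) =>
        ‖∫ z, g r.1 z * kerT r.2.1 r.2.2 x z‖ₑ ^ 2 := by
      have : Measurable fun r : Θ × (RSpace N × ℤ) => (r, x) := by fun_prop
      have h9 := (measurable_integral_mul_kerT hg).comp this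
      simp only [Function.comp_def] at h9
      exact h9.enorm.pow_const 2
    rw [lintegral_lintegral_swap hmx.aemeasurable]
    have hbx : Measurable fun q => ∫⁻ p, bker q x p * R p ∂hm N := by
      have : Measurable fun r : (RSpace N × ℤ) × ((Fin N → ℝ) × ℝ) => ((r.1, x), r.2) := by
        fun_prop
      have h9 := measurable_bker.comp this
      simp only [Function.comp_def] at h9
      exact (h9.mul (hRm.comp measurable_snd)).lintegral_prod_right'
    rw [← lintegral_const_mul _ hbx]
    exact lintegral_mono fun q =>
      lintegral_sq_integral_kerT_le hN hC₀.le hker ν hg hgi hfin x q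
  set S := ∫⁻ x, conesq (gsq ν g) x ^ (1 / 2 : ℝ) with hS
  have hV : ∫⁻ x, 16 * (wC N C₀ * mfun (hfun (gsq ν g)) x ^ pexp N) ≤ 16 * wC N C₀ * C₂ * S := by
    rw [lintegral_const_mul _ (((measurable_mfun (measurable_hfun hG)).pow_const _).const_mul _),
      lintegral_const_mul _ ((measurable_mfun (measurable_hfun hG)).pow_const _), ← mul_assoc,
      mul_assoc _ C₂]
    refine mul_le_mul_right ((hM _ (measurable_hfun hG)).trans_eq ?_) _
    congr 1
    refine lintegral_congr fun x => ?_
    unfold hfun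
    rw [← ENNReal.rpow_mul, one_div_mul_cancel (by linarith), ENNReal.rpow_one]
  have hAS : ∫⁻ x, ∫⁻ q, ∫⁻ p, bker q x p * R p ∂hm N ∂tm N ≤ C₁ * D * S := by
    refine (hA R hRm).trans ?_
    rw [mul_assoc, hD, mul_assoc]
    exact mul_le_mul_right (lintegral_div_ww_le hN hG) _
  calc _ ≤ ∫⁻ x, (16 * (wC N C₀ * mfun (hfun (gsq ν g)) x ^ pexp N)) ^ (1 / 2 : ℝ) *
        (∫⁻ q, ∫⁻ p, bker q x p * R p ∂hm N ∂tm N) ^ (1 / 2 : ℝ) := by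
        refine lintegral_mono fun x => ?_
        beta_reduce
        rw [← ENNReal.mul_rpow_of_nonneg _ _ (by norm_num)]
        exact ENNReal.rpow_le_rpow (hpt x) (by norm_num)
    _ ≤ _ := lintegral_sqrt_mul_sqrt_le hVm.aemeasurable hAm.aemeasurable
    _ ≤ (16 * wC N C₀ * C₂ * S) ^ (1 / 2 : ℝ) * (C₁ * D * S) ^ (1 / 2 : ℝ) :=
        mul_le_mul' (ENNReal.rpow_le_rpow hV (by norm_num)) (ENNReal.rpow_le_rpow hAS (by norm_num))
    _ = (16 * wC N C₀ * C₂) ^ (1 / 2 : ℝ) * (C₁ * D) ^ (1 / 2 : ℝ) * S := by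
        rw [ENNReal.mul_rpow_of_nonneg _ S (by norm_num),
          ENNReal.mul_rpow_of_nonneg _ S (by norm_num)]
        conv_rhs => rw [← ennreal_sqrt_mul_sqrt S]
        ring
    _ ≤ _ := mul_le_mul_left le_self_add _

/-! ### Tensorization of vector-valued square function inequalities -/

section Tensor

variable {Θ E P E₁ P₁ Q₁ E₂ P₂ Q₂ : Type} [MeasurableSpace Θ] [MeasureSpace E] [MeasurableSpace P]
  [MeasureSpace E₁] [MeasurableSpace P₁] [MeasurableSpace Q₁]
  [MeasureSpace E₂] [MeasurableSpace P₂] [MeasurableSpace Q₂]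

/-- A jointly measurable kernel, bounded in the integration variable. -/
structure IsBddKernel (K : E → P → E → ℝ) : Prop where
  measurable : Measurable fun r : (E × P) × E => K r.1.1 r.1.2 r.2
  bdd : ∀ x p, ∃ M, ∀ z, |K x p z| ≤ M

/-- The square of the square function of the family `g` with kernel `K`. -/
def sqf (ν : Measure Θ) (π : Measure P) (K : E → P → E → ℝ) (g : Θ → E → ℝ) (x : E) : ℝ≥0∞ :=
  ∫⁻ θ, ∫⁻ p, ‖∫ z, g θ z * K x p z‖ₑ ^ 2 ∂π ∂ν

/-- The square function with kernel `K` is bounded in `L¹`, in the vector-valued sense, by the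
square function with kernel `L`. -/
def Dominates (π : Measure P₁) (K : E → P₁ → E → ℝ) (ρ : Measure Q₁) (L : E → Q₁ → E → ℝ)
    (C : ℝ≥0∞) : Prop :=
  ∀ (Θ : Type) [MeasurableSpace Θ] (ν : Measure Θ) [SFinite ν] (g : Θ → E → ℝ),
    Measurable (Function.uncurry g) → (∀ θ, Integrable (g θ)) →
    ∫⁻ x, sqf ν π K g x ^ (1 / 2 : ℝ) ≤ C * ∫⁻ x, sqf ν ρ L g x ^ (1 / 2 : ℝ)

lemma Dominates.trans {π : Measure P₁} {ρ : Measure Q₁} {σ : Measure P₂} {K : E → P₁ → E → ℝ}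
    {L : E → Q₁ → E → ℝ} {J : E → P₂ → E → ℝ} {C D : ℝ≥0∞} (h : Dominates π K ρ L C)
    (h' : Dominates ρ L σ J D) : Dominates π K σ J (C * D) := by
  intro Θ _ ν _ g hg hgi
  refine (h _ ν g hg hgi).trans ?_
  rw [mul_assoc]
  exact mul_le_mul_right (h' _ ν g hg hgi) _

/-- The tensor product of two kernels. -/
def tker (K₁ : E₁ → P₁ → E₁ → ℝ) (K₂ : E₂ → P₂ → E₂ → ℝ) (x : E₁ × E₂) (p : P₁ × P₂)
    (z : E₁ × E₂) : ℝ :=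
  K₁ x.1 p.1 z.1 * K₂ x.2 p.2 z.2

/-- Integration of a family against a kernel in the first variable. -/
def pintl (K₁ : E₁ → P₁ → E₁ → ℝ) (g : Θ → E₁ × E₂ → ℝ) (x : E₁) (q : Θ × P₁) (z₂ : E₂) : ℝ :=
  ∫ z₁, g q.1 (z₁, z₂) * K₁ x q.2 z₁

/-- Integration of a family against a kernel in the second variable. -/
def pintr (K₂ : E₂ → P₂ → E₂ → ℝ) (g : Θ → E₁ × E₂ → ℝ) (x : E₂) (q : Θ × P₂) (z₁ : E₁) : ℝ :=
  ∫ z₂, g q.1 (z₁, z₂) * K₂ x q.2 z₂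

lemma IsBddKernel.integrable_mul {K : E → P → E → ℝ} (hK : IsBddKernel K) {f : E → ℝ}
    (hf : Integrable f) (x : E) (p : P) : Integrable fun z => f z * K x p z := by
  obtain ⟨M, hM⟩ := hK.bdd x p
  have h1 := hK.measurable.comp (measurable_prodMk_left (x := (x, p)))
  simp only [Function.comp_def] at h1
  exact hf.mul_bdd h1.aestronglyMeasurable (ae_of_all _ fun z => hM z)

lemma IsBddKernel.measurable_integral [SFinite (volume : Measure E)] {K : E → P → E → ℝ}
    (hK : IsBddKernel K)
    {g : Θ → E → ℝ} (hg : Measurable (Function.uncurry g)) :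
    Measurable fun r : (Θ × P) × E => ∫ z, g r.1.1 z * K r.2 r.1.2 z := by
  have h1 : Measurable fun s : ((Θ × P) × E) × E => g s.1.1.1 s.2 := by
    have : Measurable fun s : ((Θ × P) × E) × E => (s.1.1.1, s.2) := by fun_prop
    have h9 := hg.comp this
    simp only [Function.comp_def] at h9
    exact h9
  have h2 : Measurable fun s : ((Θ × P) × E) × E => K s.1.2 s.1.1.2 s.2 := by
    have : Measurable fun s : ((Θ × P) × E) × E => ((s.1.2, s.1.1.2), s.2) := by fun_prop
    have h9 := hK.measurable.comp this
    simp only [Function.comp_def] at h9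
    exact h9
  exact ((h1.mul h2).stronglyMeasurable.integral_prod_right').measurable

lemma IsBddKernel.measurable_integrand [SFinite (volume : Measure E)] {K : E → P → E → ℝ}
    (hK : IsBddKernel K)
    {g : Θ → E → ℝ} (hg : Measurable (Function.uncurry g)) (x : E) :
    Measurable fun r : Θ × P => ‖∫ z, g r.1 z * K x r.2 z‖ₑ ^ 2 := by
  have h9 := (hK.measurable_integral hg).comp (measurable_prodMk_right (y := x))
  simp only [Function.comp_def] at h9
  exact h9.enorm.pow_const 2

lemma IsBddKernel.measurable_sqf [SFinite (volume : Measure E)] {K : E → P → E → ℝ}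
    (hK : IsBddKernel K)
    (ν : Measure Θ) [SFinite ν] (π : Measure P) [SFinite π]
    {g : Θ → E → ℝ} (hg : Measurable (Function.uncurry g)) :
    Measurable (sqf ν π K g) := by
  have h1 : Measurable fun r : (E × Θ) × P => ‖∫ z, g r.1.2 z * K r.1.1 r.2 z‖ₑ ^ 2 := by
    have : Measurable fun r : (E × Θ) × P => ((r.1.2, r.2), r.1.1) := by fun_prop
    have h9 := (hK.measurable_integral hg).comp this
    simp only [Function.comp_def] at h9
    exact h9.enorm.pow_const 2
  exact h1.lintegral_prod_right'.lintegral_prod_right'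

lemma IsBddKernel.tker {K₁ : E₁ → P₁ → E₁ → ℝ} {K₂ : E₂ → P₂ → E₂ → ℝ} (h₁ : IsBddKernel K₁)
    (h₂ : IsBddKernel K₂) : IsBddKernel (tker K₁ K₂) where
  measurable := by
    have m1 : Measurable fun r : ((E₁ × E₂) × (P₁ × P₂)) × (E₁ × E₂) =>
      ((r.1.1.1, r.1.2.1), r.2.1) := by fun_prop
    have m2 : Measurable fun r : ((E₁ × E₂) × (P₁ × P₂)) × (E₁ × E₂) =>
      ((r.1.1.2, r.1.2.2), r.2.2) := by fun_prop
    exact (h₁.measurable.comp m1).mul (h₂.measurable.comp m2)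
  bdd x p := by
    obtain ⟨M₁, hM₁⟩ := h₁.bdd x.1 p.1
    obtain ⟨M₂, hM₂⟩ := h₂.bdd x.2 p.2
    refine ⟨M₁ * M₂, fun z => ?_⟩
    unfold Treil.tker
    rw [abs_mul]
    exact mul_le_mul (hM₁ _) (hM₂ _) (abs_nonneg _) ((abs_nonneg _).trans (hM₁ z.1))

variable [SigmaFinite (volume : Measure E₁)] [SigmaFinite (volume : Measure E₂)]
  {K₁ : E₁ → P₁ → E₁ → ℝ} {K₂ : E₂ → P₂ → E₂ → ℝ} {g : Θ → E₁ × E₂ → ℝ}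

lemma measurable_pintl (h₁ : IsBddKernel K₁) (hg : Measurable (Function.uncurry g)) (x : E₁) :
    Measurable (Function.uncurry (pintl K₁ g x)) := by
  have h1 : Measurable fun s : ((Θ × P₁) × E₂) × E₁ => g s.1.1.1 (s.2, s.1.2) := by
    have : Measurable fun s : ((Θ × P₁) × E₂) × E₁ => (s.1.1.1, (s.2, s.1.2)) := by fun_prop
    have h9 := hg.comp this
    simp only [Function.comp_def] at h9
    exact h9
  have h2 : Measurable fun s : ((Θ × P₁) × E₂) × E₁ => K₁ x s.1.1.2 s.2 := by
    have : Measurable fun s : ((Θ × P₁) × E₂) × E₁ => ((x, s.1.1.2), s.2) := by fun_prop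
    have h9 := h₁.measurable.comp this
    simp only [Function.comp_def] at h9
    exact h9
  exact ((h1.mul h2).stronglyMeasurable.integral_prod_right').measurable

lemma measurable_pintr (h₂ : IsBddKernel K₂) (hg : Measurable (Function.uncurry g)) (x : E₂) :
    Measurable (Function.uncurry (pintr K₂ g x)) := by
  have h1 : Measurable fun s : ((Θ × P₂) × E₁) × E₂ => g s.1.1.1 (s.1.2, s.2) := by
    have : Measurable fun s : ((Θ × P₂) × E₁) × E₂ => (s.1.1.1, (s.1.2, s.2)) := by fun_prop
    have h9 := hg.comp this
    simp only [Function.comp_def] at h9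
    exact h9
  have h2 : Measurable fun s : ((Θ × P₂) × E₁) × E₂ => K₂ x s.1.1.2 s.2 := by
    have : Measurable fun s : ((Θ × P₂) × E₁) × E₂ => ((x, s.1.1.2), s.2) := by fun_prop
    have h9 := h₂.measurable.comp this
    simp only [Function.comp_def] at h9
    exact h9
  exact ((h1.mul h2).stronglyMeasurable.integral_prod_right').measurable

lemma integrable_mul_fst (h₁ : IsBddKernel K₁) {f : E₁ × E₂ → ℝ} (hf : Integrable f) (x : E₁)
    (p : P₁) : Integrable fun z : E₁ × E₂ => f z * K₁ x p z.1 := by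
  obtain ⟨M, hM⟩ := h₁.bdd x p
  have h1 := (h₁.measurable.comp (measurable_prodMk_left (x := (x, p)))).comp
    (measurable_fst : Measurable (Prod.fst : E₁ × E₂ → E₁))
  simp only [Function.comp_def] at h1
  exact hf.mul_bdd h1.aestronglyMeasurable (ae_of_all _ fun z => hM z.1)

lemma integrable_mul_snd (h₂ : IsBddKernel K₂) {f : E₁ × E₂ → ℝ} (hf : Integrable f) (x : E₂)
    (p : P₂) : Integrable fun z : E₁ × E₂ => f z * K₂ x p z.2 := by
  obtain ⟨M, hM⟩ := h₂.bdd x p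
  have h1 := (h₂.measurable.comp (measurable_prodMk_left (x := (x, p)))).comp
    (measurable_snd : Measurable (Prod.snd : E₁ × E₂ → E₂))
  simp only [Function.comp_def] at h1
  exact hf.mul_bdd h1.aestronglyMeasurable (ae_of_all _ fun z => hM z.2)

lemma integrable_pintl (h₁ : IsBddKernel K₁) (hgi : ∀ θ, Integrable (g θ)) (x : E₁)
    (q : Θ × P₁) : Integrable (pintl K₁ g x q) :=
  (integrable_mul_fst h₁ (hgi q.1) x q.2).integral_prod_right

lemma integrable_pintr (h₂ : IsBddKernel K₂) (hgi : ∀ θ, Integrable (g θ)) (x : E₂)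
    (q : Θ × P₂) : Integrable (pintr K₂ g x q) :=
  (integrable_mul_snd h₂ (hgi q.1) x q.2).integral_prod_left

lemma integral_mul_tker_eq_pintl (h₁ : IsBddKernel K₁) (h₂ : IsBddKernel K₂)
    (hgi : ∀ θ, Integrable (g θ)) (θ : Θ) (x : E₁ × E₂) (p : P₁ × P₂) :
    ∫ z, g θ z * tker K₁ K₂ x p z = ∫ z₂, pintl K₁ g x.1 (θ, p.1) z₂ * K₂ x.2 p.2 z₂ := by
  rw [Measure.volume_eq_prod, integral_prod_symm _ ((h₁.tker h₂).integrable_mul (hgi θ) x p)]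
  refine integral_congr_ae (ae_of_all _ fun z₂ => ?_)
  simp only [pintl, tker]
  rw [← integral_mul_const]
  simp only [mul_assoc]

lemma integral_mul_tker_eq_pintr (h₁ : IsBddKernel K₁) (h₂ : IsBddKernel K₂)
    (hgi : ∀ θ, Integrable (g θ)) (θ : Θ) (x : E₁ × E₂) (p : P₁ × P₂) :
    ∫ z, g θ z * tker K₁ K₂ x p z = ∫ z₁, pintr K₂ g x.2 (θ, p.2) z₁ * K₁ x.1 p.1 z₁ := by
  rw [Measure.volume_eq_prod, integral_prod _ ((h₁.tker h₂).integrable_mul (hgi θ) x p)]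
  refine integral_congr_ae (ae_of_all _ fun z₂ => ?_)
  simp only [pintr, tker]
  rw [← integral_mul_const]
  refine integral_congr_ae (ae_of_all _ fun z₁ => ?_)
  ring

variable {π₁ : Measure P₁} {π₂ : Measure P₂} [SFinite π₁] [SFinite π₂] {ν : Measure Θ} [SFinite ν]

lemma sqf_tker_eq_pintl (h₁ : IsBddKernel K₁) (h₂ : IsBddKernel K₂)
    (hg : Measurable (Function.uncurry g)) (hgi : ∀ θ, Integrable (g θ)) (x : E₁ × E₂) :
    sqf ν (π₁.prod π₂) (tker K₁ K₂) g x = sqf (ν.prod π₁) π₂ K₂ (pintl K₁ g x.1) x.2 := by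
  have hm := (h₁.tker h₂).measurable_integrand hg x
  have hm' := h₂.measurable_integrand (measurable_pintl h₁ hg x.1) x.2
  unfold sqf
  rw [lintegral_prod _ hm'.lintegral_prod_right'.aemeasurable]
  refine lintegral_congr fun θ => ?_
  have h9 := hm.comp (measurable_prodMk_left (x := θ))
  simp only [Function.comp_def] at h9
  rw [lintegral_prod _ h9.aemeasurable]
  simp only [integral_mul_tker_eq_pintl h₁ h₂ hgi]

lemma sqf_tker_eq_pintr (h₁ : IsBddKernel K₁) (h₂ : IsBddKernel K₂)
    (hg : Measurable (Function.uncurry g)) (hgi : ∀ θ, Integrable (g θ)) (x : E₁ × E₂) :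
    sqf ν (π₁.prod π₂) (tker K₁ K₂) g x = sqf (ν.prod π₂) π₁ K₁ (pintr K₂ g x.2) x.1 := by
  have hm := (h₁.tker h₂).measurable_integrand hg x
  have hm' := h₁.measurable_integrand (measurable_pintr h₂ hg x.2) x.1
  unfold sqf
  rw [lintegral_prod _ hm'.lintegral_prod_right'.aemeasurable]
  refine lintegral_congr fun θ => ?_
  have h9 := hm.comp (measurable_prodMk_left (x := θ))
  simp only [Function.comp_def] at h9
  rw [lintegral_prod_symm' _ h9]
  simp only [integral_mul_tker_eq_pintr h₁ h₂ hgi]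

lemma Dominates.tker_right {ρ₂ : Measure Q₂} [SFinite ρ₂] {L₂ : E₂ → Q₂ → E₂ → ℝ} {C : ℝ≥0∞}
    (h : Dominates π₂ K₂ ρ₂ L₂ C) (h₁ : IsBddKernel K₁) (h₂ : IsBddKernel K₂)
    (hL : IsBddKernel L₂) :
    Dominates (π₁.prod π₂) (tker K₁ K₂) (π₁.prod ρ₂) (tker K₁ L₂) C := by
  intro Θ _ ν _ g hg hgi
  have hm := ((h₁.tker h₂).measurable_sqf ν (π₁.prod π₂) hg).pow_const (1 / 2 : ℝ)
  have hm' := ((h₁.tker hL).measurable_sqf ν (π₁.prod ρ₂) hg).pow_const (1 / 2 : ℝ)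
  rw [Measure.volume_eq_prod, lintegral_prod _ hm.aemeasurable, lintegral_prod _ hm'.aemeasurable,
    ← lintegral_const_mul _ hm'.lintegral_prod_right']
  refine lintegral_mono fun x₁ => ?_
  simp only [sqf_tker_eq_pintl h₁ h₂ hg hgi, sqf_tker_eq_pintl h₁ hL hg hgi]
  exact h _ (ν.prod π₁) _ (measurable_pintl h₁ hg x₁) (integrable_pintl h₁ hgi x₁)

lemma Dominates.tker_left {ρ₁ : Measure Q₁} [SFinite ρ₁] {L₁ : E₁ → Q₁ → E₁ → ℝ} {C : ℝ≥0∞}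
    (h : Dominates π₁ K₁ ρ₁ L₁ C) (h₁ : IsBddKernel K₁) (h₂ : IsBddKernel K₂)
    (hL : IsBddKernel L₁) :
    Dominates (π₁.prod π₂) (tker K₁ K₂) (ρ₁.prod π₂) (tker L₁ K₂) C := by
  intro Θ _ ν _ g hg hgi
  have hm := ((h₁.tker h₂).measurable_sqf ν (π₁.prod π₂) hg).pow_const (1 / 2 : ℝ)
  have hm' := ((hL.tker h₂).measurable_sqf ν (ρ₁.prod π₂) hg).pow_const (1 / 2 : ℝ)
  rw [Measure.volume_eq_prod, lintegral_prod_symm' _ hm, lintegral_prod_symm' _ hm',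
    ← lintegral_const_mul _ hm'.lintegral_prod_left']
  refine lintegral_mono fun x₂ => ?_
  simp only [sqf_tker_eq_pintr h₁ h₂ hg hgi, sqf_tker_eq_pintr hL h₂ hg hgi]
  exact h _ (ν.prod π₂) _ (measurable_pintr h₂ hg x₂) (integrable_pintr h₂ hgi x₂)

lemma Dominates.tker {ρ₁ : Measure Q₁} [SFinite ρ₁] {L₁ : E₁ → Q₁ → E₁ → ℝ}
    {ρ₂ : Measure Q₂} [SFinite ρ₂] {L₂ : E₂ → Q₂ → E₂ → ℝ} {C₁ C₂ : ℝ≥0∞}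
    (h : Dominates π₁ K₁ ρ₁ L₁ C₁) (h' : Dominates π₂ K₂ ρ₂ L₂ C₂)
    (h₁ : IsBddKernel K₁) (h₂ : IsBddKernel K₂)
    (hL₁ : IsBddKernel L₁) (hL₂ : IsBddKernel L₂) :
    Dominates (π₁.prod π₂) (Treil.tker K₁ K₂) (ρ₁.prod ρ₂) (Treil.tker L₁ L₂) (C₁ * C₂) :=
  (h.tker_left h₁ h₂ hL₁).trans (h'.tker_right hL₁ h₂ hL₂)

end Tensor

lemma Dominates.comp_equiv {E E' P P' Q Q' : Type} [MeasureSpace E] [MeasureSpace E']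
    [SFinite (volume : Measure E)]
    [MeasurableSpace P] [MeasurableSpace P'] [MeasurableSpace Q] [MeasurableSpace Q']
    {π : Measure P} {π' : Measure P'} {ρ : Measure Q} {ρ' : Measure Q'} [SFinite π] [SFinite ρ]
    {K : E → P → E → ℝ} {L : E → Q → E → ℝ} {C : ℝ≥0∞} (h : Dominates π K ρ L C)
    (hK : IsBddKernel K) (hL : IsBddKernel L)
    (e : E' ≃ᵐ E) (he : MeasurePreserving e) {a : P' → P} (ha : MeasurePreserving a π' π)
    {b : Q' → Q} (hb : MeasurePreserving b ρ' ρ) :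
    Dominates π' (fun x p z => K (e x) (a p) (e z)) ρ' (fun x p z => L (e x) (b p) (e z)) C := by
  intro Θ _ ν _ g hg hgi
  set g' : Θ → E → ℝ := fun θ z => g θ (e.symm z) with hg'
  have hm : Measurable (Function.uncurry g') := by
    have : Measurable fun r : Θ × E => (r.1, e.symm r.2) :=
      measurable_fst.prodMk (e.symm.measurable.comp measurable_snd)
    exact hg.comp this
  have hi : ∀ θ, Integrable (g' θ) := fun θ =>
    (he.symm e).integrable_comp_of_integrable (hgi θ)
  have e1 : ∀ θ (G : E → ℝ), ∫ z, g θ z * G (e z) = ∫ z, g' θ z * G z := by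
    intro θ G
    rw [← he.integral_comp' (g := fun z => g' θ z * G z)]
    simp [hg']
  have key : ∀ {P P' : Type} [MeasurableSpace P] [MeasurableSpace P'] {π : Measure P}
      {π' : Measure P'} [SFinite π] {K : E → P → E → ℝ} (_ : IsBddKernel K) {a : P' → P}
      (_ : MeasurePreserving a π' π),
      ∫⁻ x, sqf ν π' (fun x p z => K (e x) (a p) (e z)) g x ^ (1 / 2 : ℝ) =
        ∫⁻ x, sqf ν π K g' x ^ (1 / 2 : ℝ) := by
    intro P P' _ _ π π' _ K hK a ha
    rw [← he.lintegral_comp ((hK.measurable_sqf ν π hm).pow_const _)]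
    refine lintegral_congr fun x => ?_
    congr 1
    unfold sqf
    refine lintegral_congr fun θ => ?_
    have h9 := (hK.measurable_integrand hm (e x)).comp (measurable_prodMk_left (x := θ))
    simp only [Function.comp_def] at h9
    rw [← ha.lintegral_comp h9]
    simp only [e1]
  rw [key hK ha, key hL hb]
  exact h _ ν g' hm hi

/-- The tensor product of finitely many kernels. -/
def piker {n : ℕ} {E P : Fin n → Type} (K : ∀ i, E i → P i → E i → ℝ) (x : ∀ i, E i)
    (p : ∀ i, P i) (z : ∀ i, E i) : ℝ :=
  ∏ i, K i (x i) (p i) (z i)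

lemma IsBddKernel.piker {n : ℕ} {E P : Fin n → Type} [∀ i, MeasureSpace (E i)]
    [∀ i, SigmaFinite (volume : Measure (E i))] [∀ i, MeasurableSpace (P i)]
    {K : ∀ i, E i → P i → E i → ℝ} (hK : ∀ i, IsBddKernel (K i)) : IsBddKernel (piker K) where
  measurable := by
    unfold Treil.piker
    refine Finset.measurable_prod _ fun i _ => ?_
    have m : Measurable fun r : ((∀ i, E i) × (∀ i, P i)) × (∀ i, E i) =>
        ((r.1.1 i, r.1.2 i), r.2 i) := by fun_prop
    exact (hK i).measurable.comp m
  bdd x p := by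
    choose M hM using fun i => (hK i).bdd (x i) (p i)
    refine ⟨∏ i, M i, fun z => ?_⟩
    unfold Treil.piker
    rw [Finset.abs_prod]
    exact Finset.prod_le_prod (fun i _ => abs_nonneg _) fun i _ => hM i _

lemma dominates_pi {n : ℕ} {E P Q : Fin n → Type} [∀ i, MeasureSpace (E i)]
    [∀ i, SigmaFinite (volume : Measure (E i))] [∀ i, MeasurableSpace (P i)]
    [∀ i, MeasurableSpace (Q i)] {π : ∀ i, Measure (P i)} {ρ : ∀ i, Measure (Q i)}
    [∀ i, SigmaFinite (π i)] [∀ i, SigmaFinite (ρ i)]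
    {K : ∀ i, E i → P i → E i → ℝ} {L : ∀ i, E i → Q i → E i → ℝ} {C : Fin n → ℝ≥0∞}
    (hK : ∀ i, IsBddKernel (K i)) (hL : ∀ i, IsBddKernel (L i))
    (h : ∀ i, Dominates (π i) (K i) (ρ i) (L i) (C i)) :
    Dominates (Measure.pi π) (piker K) (Measure.pi ρ) (piker L) (∏ i, C i) := by
  induction n with
  | zero =>
    have e : ∀ {Θ : Type} [MeasurableSpace Θ] (ν : Measure Θ) (g : Θ → (∀ i, E i) → ℝ)
        (P : Fin 0 → Type) [∀ i, MeasurableSpace (P i)] (π : ∀ i, Measure (P i))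
        (K : ∀ i, E i → P i → E i → ℝ) (x : ∀ i, E i),
        sqf ν (Measure.pi π) (piker K) g x = ∫⁻ θ, ‖∫ z, g θ z‖ₑ ^ 2 ∂ν := by
      intro Θ _ ν g P _ π K x
      simp [sqf, piker, Measure.pi_of_empty π fun i => i.elim0]
    intro Θ _ ν _ g hg hgi
    simp [e]
  | succ n ih =>
    have ih' := ih (E := fun i => E (Fin.succAbove 0 i)) (P := fun i => P (Fin.succAbove 0 i))
      (Q := fun i => Q (Fin.succAbove 0 i)) (π := fun i => π (Fin.succAbove 0 i))
      (ρ := fun i => ρ (Fin.succAbove 0 i)) (K := fun i => K (Fin.succAbove 0 i))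
      (L := fun i => L (Fin.succAbove 0 i)) (C := fun i => C (Fin.succAbove 0 i)) (fun i => hK _) (fun i => hL _) (fun i => h _)
    have h1 := (h 0).tker ih' (hK 0) (IsBddKernel.piker fun i => hK _) (hL 0)
      (IsBddKernel.piker fun i => hL _)
    have h2 := Dominates.comp_equiv h1 ((hK 0).tker (IsBddKernel.piker fun i => hK _))
      ((hL 0).tker (IsBddKernel.piker fun i => hL _))
      (MeasurableEquiv.piFinSuccAbove E 0) (volume_preserving_piFinSuccAbove E 0)
      (measurePreserving_piFinSuccAbove π 0) (measurePreserving_piFinSuccAbove ρ 0)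
    rw [Fin.prod_univ_succAbove C 0]
    have e : ∀ {P : Fin (n + 1) → Type} [∀ i, MeasurableSpace (P i)]
        (K : ∀ i, E i → P i → E i → ℝ),
        (fun x p z => tker (K 0) (piker fun i => K (Fin.succAbove 0 i))
          (MeasurableEquiv.piFinSuccAbove E 0 x) (MeasurableEquiv.piFinSuccAbove P 0 p)
          (MeasurableEquiv.piFinSuccAbove E 0 z)) = piker K := by
      intro P _ K
      funext x p z
      simp only [piker, tker, Fin.prod_univ_succAbove _ 0]
      rfl
    rw [e K, e L] at h2
    exact h2

/-- The kernel of the one-parameter Lusin square function. -/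
def conk (x : Fin N → ℝ) (p : (Fin N → ℝ) × ℝ) (z : Fin N → ℝ) : ℝ :=
  {p : (Fin N → ℝ) × ℝ | Real.sqrt (∑ i, (p.1 i - x i) ^ 2) < p.2}.indicator
    (fun p => p.2 ^ ((1 - (N : ℝ)) / 2) * pkt N (p.1 - z) p.2) p

lemma isBddKernel_conk (N : ℕ) : IsBddKernel (conk (N := N)) where
  measurable := by
    have m1 : Measurable fun r : ((Fin N → ℝ) × ((Fin N → ℝ) × ℝ)) × (Fin N → ℝ) =>
        (r.1.2.1 - r.2, r.1.2.2) := by fun_prop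
    have m2 := measurable_pkt (N := N).comp m1
    simp only [Function.comp_def] at m2
    have m3 : Measurable fun r : ((Fin N → ℝ) × ((Fin N → ℝ) × ℝ)) × (Fin N → ℝ) =>
        r.1.2.2 ^ ((1 - (N : ℝ)) / 2) := by fun_prop
    have m4 : MeasurableSet {r : ((Fin N → ℝ) × ((Fin N → ℝ) × ℝ)) × (Fin N → ℝ) |
        Real.sqrt (∑ i, (r.1.2.1 i - r.1.1 i) ^ 2) < r.1.2.2} :=
      measurable_fst measurableSet_cone
    exact (m3.mul m2).indicator m4
  bdd x p := by
    by_cases hp : Real.sqrt (∑ i, (p.1 i - x i) ^ 2) < p.2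
    · have ht : 0 < p.2 := (Real.sqrt_nonneg _).trans_lt hp
      refine ⟨p.2 ^ ((1 - (N : ℝ)) / 2) * (poiB N * (p.2 ^ (N + 1))⁻¹), fun z => ?_⟩
      unfold conk
      rw [Set.indicator_of_mem (by exact hp), abs_mul, abs_of_nonneg (by positivity)]
      exact mul_le_mul_of_nonneg_left (abs_pkt_le_const _ ht le_rfl) (by positivity)
    · refine ⟨0, fun z => ?_⟩
      unfold conk
      rw [Set.indicator_of_notMem (by exact hp), abs_zero]

lemma isBddKernel_kerT (N : ℕ) :
    IsBddKernel fun (x : Fin N → ℝ) (q : RSpace N × ℤ) z => kerT q.1 q.2 x z where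
  measurable := by
    have m1 : Measurable fun r : ((Fin N → ℝ) × (RSpace N × ℤ)) × (Fin N → ℝ) =>
        (r.1.2, r.1.1, r.2) := by fun_prop
    have h9 := measurable_kerT.comp m1
    simp only [Function.comp_def] at h9
    exact h9
  bdd x p := ⟨_, abs_kerT_le p.1 p.2 x⟩

lemma sqf_conk {Θ : Type} [MeasurableSpace Θ] (ν : Measure Θ) [SFinite ν]
    {g : Θ → (Fin N → ℝ) → ℝ} (hg : Measurable (Function.uncurry g)) (x : Fin N → ℝ) :
    sqf ν volume conk g x = conesq (gsq ν g) x := by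
  have hm := (isBddKernel_conk N).measurable_integrand hg x
  have hS : MeasurableSet {p : (Fin N → ℝ) × ℝ | Real.sqrt (∑ i, (p.1 i - x i) ^ 2) < p.2} := by
    have h9 := measurableSet_cone.preimage
      (measurable_prodMk_left (x := x) (β := (Fin N → ℝ) × ℝ))
    exact h9
  unfold sqf conesq
  rw [lintegral_lintegral_swap hm.aemeasurable, ← lintegral_indicator hS]
  refine lintegral_congr fun p => ?_
  by_cases hp : Real.sqrt (∑ i, (p.1 i - x i) ^ 2) < p.2
  · rw [Set.indicator_of_mem (by exact hp)]
    have ht : 0 < p.2 := (Real.sqrt_nonneg _).trans_lt hp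
    have hqp : Measurable fun θ => ‖qint (g θ) p‖ₑ ^ 2 :=
      ((measurable_qint_uncurry hg).enorm.comp (measurable_prodMk_right (y := p))).pow_const 2
    unfold gsq
    rw [← lintegral_mul_const _ hqp]
    refine lintegral_congr fun θ => ?_
    have e1 : ∫ z, g θ z * conk x p z =
        p.2 ^ ((1 - (N : ℝ)) / 2) * p.2⁻¹ * qint (g θ) p := by
      unfold conk qint
      rw [← integral_const_mul]
      refine integral_congr_ae (ae_of_all _ fun z => ?_)
      beta_reduce
      rw [Set.indicator_of_mem (by exact hp)]
      field_simp
    rw [e1, enorm_mul, mul_pow, mul_comm]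
    congr 1
    rw [Real.enorm_eq_ofReal (by positivity), ← ENNReal.ofReal_pow (by positivity)]
    congr 1
    rw [mul_pow, ← Real.rpow_natCast (_ ^ _) 2, ← Real.rpow_mul ht.le, ← Real.rpow_natCast,
      ← Real.rpow_natCast, ← Real.rpow_neg_one p.2, ← Real.rpow_neg ht.le, ← Real.rpow_mul ht.le,
      ← Real.rpow_add ht]
    congr 1
    push_cast
    ring
  · rw [Set.indicator_of_notMem (by exact hp)]
    have e1 : ∀ θ, ∫ z, g θ z * conk x p z = 0 := by
      intro θ
      unfold conk
      simp [Set.indicator_of_notMem (show p ∉ {p : (Fin N → ℝ) × ℝ |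
        Real.sqrt (∑ i, (p.1 i - x i) ^ 2) < p.2} from hp)]
    simp [e1]

lemma exists_dominates_kerT_conk (hN : 0 < N) : ∃ C : ℝ≥0∞, C ≠ ⊤ ∧
    Dominates (tm N) (fun (x : Fin N → ℝ) (q : RSpace N × ℤ) z => kerT q.1 q.2 x z)
      volume conk C := by
  obtain ⟨C, hC, h⟩ := lintegral_kerT_le_conesq hN
  refine ⟨C, hC, ?_⟩
  intro Θ _ ν _ g hg hgi
  simp only [sqf_conk ν hg]
  exact h ν g hg hgi

/-! ### Passage between the product square functions and their kernels -/

lemma measurePreserving_pi_prod {ι : Type*} [Fintype ι] {A B : ι → Type*}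
    [∀ i, MeasurableSpace (A i)] [∀ i, MeasurableSpace (B i)] (μ : ∀ i, Measure (A i))
    (ν : ∀ i, Measure (B i)) [∀ i, SigmaFinite (μ i)] [∀ i, SigmaFinite (ν i)] :
    MeasurePreserving (fun q : ∀ i, A i × B i => (fun i => (q i).1, fun i => (q i).2))
      (Measure.pi fun i => (μ i).prod (ν i)) ((Measure.pi μ).prod (Measure.pi ν)) where
  measurable := by fun_prop
  map_eq := by
    refine (Measure.FiniteSpanningSetsIn.ext ?_ (isPiSystem_pi.prod isPiSystem_pi)
      ((Measure.FiniteSpanningSetsIn.pi fun i ↦ (μ i).toFiniteSpanningSetsIn).prod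
      (Measure.FiniteSpanningSetsIn.pi (fun i ↦ (ν i).toFiniteSpanningSetsIn))) ?_).symm
    · refine (generateFrom_eq_prod generateFrom_pi generateFrom_pi ?_ ?_).symm
      · exact (Measure.FiniteSpanningSetsIn.pi
          (fun i ↦ (μ i).toFiniteSpanningSetsIn)).isCountablySpanning
      · exact (Measure.FiniteSpanningSetsIn.pi
          (fun i ↦ (ν i).toFiniteSpanningSetsIn)).isCountablySpanning
    · rintro _ ⟨_, ⟨s, hs, rfl⟩, ⟨_, ⟨t, ht, rfl⟩, rfl⟩⟩
      rw [Measure.map_apply (by fun_prop)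
        ((MeasurableSet.univ_pi fun i => hs i (Set.mem_univ i)).prod
          (MeasurableSet.univ_pi fun i => ht i (Set.mem_univ i)))]
      have e : (fun q : ∀ i, A i × B i => (fun i => (q i).1, fun i => (q i).2)) ⁻¹'
          (Set.univ.pi s ×ˢ Set.univ.pi t) = Set.univ.pi fun i => s i ×ˢ t i := by
        ext; simp [Set.mem_pi, forall_and]
      rw [e]
      simp_rw [Measure.pi_pi, Measure.prod_prod, Measure.pi_pi, Finset.prod_mul_distrib]

lemma pi_count_int (n : ℕ) :
    (Measure.pi fun _ : Fin n => (Measure.count : Measure ℤ)) = Measure.count := by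
  refine Measure.ext_of_singleton fun a => ?_
  rw [← Set.univ_pi_singleton, Measure.pi_pi, Set.univ_pi_singleton]
  simp

lemma lintegral_pi_tm {n : ℕ} {Nd : Fin n → ℕ} {F : (∀ j, RSpace (Nd j) × ℤ) → ℝ≥0∞}
    (hF : Measurable F) :
    ∫⁻ q, F q ∂(Measure.pi fun j => tm (Nd j)) =
      ∫⁻ ω, (∑' k : Fin n → ℤ, F fun j => (ω j, k j)) ∂prodRandMeasure n Nd := by
  have h := measurePreserving_pi_prod (fun j => randMeasure (Nd j))
    (fun _ : Fin n => (Measure.count : Measure ℤ))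
  have hm : Measurable fun r : (∀ j, RSpace (Nd j)) × (Fin n → ℤ) =>
      F fun j => (r.1 j, r.2 j) := by
    have : Measurable fun r : (∀ j, RSpace (Nd j)) × (Fin n → ℤ) =>
      fun j => (r.1 j, r.2 j) := by fun_prop
    exact hF.comp this
  have h1 := h.lintegral_comp hm
  rw [lintegral_prod _ hm.aemeasurable, pi_count_int] at h1
  simp only [lintegral_count] at h1
  exact h1

section Rect

variable {n : ℕ} {Nd : Fin n → ℕ}

lemma ravg_eq_integral (c : ∀ j : Fin n, ℤ → Fin (Nd j) → ℝ) (k : Fin n → ℤ) (f : X n Nd → ℝ)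
    (x : X n Nd) :
    ravg n Nd c k f x = ∫ z, f z * ∏ j, aker (c j (k j)) (k j) (x j) (z j) := by
  unfold ravg
  rw [← integral_indicator
    (MeasurableSet.univ_pi fun j => measurableSet_dcube (c j (k j)) (k j) (x j)),
    div_eq_mul_inv, ← integral_mul_const]
  refine integral_congr_ae (ae_of_all _ fun z => ?_)
  beta_reduce
  by_cases hz : z ∈ Set.univ.pi fun j => dcube (c j (k j)) (k j) (x j)
  · rw [Set.indicator_of_mem hz, ← Finset.prod_inv_distrib]
    congr 1
    refine Finset.prod_congr rfl fun j _ => ?_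
    unfold aker
    rw [Set.indicator_of_mem (hz j (Set.mem_univ j))]
  · rw [Set.indicator_of_notMem hz]
    obtain ⟨j, hj⟩ : ∃ j, z j ∉ dcube (c j (k j)) (k j) (x j) := by
      by_contra! h
      exact hz fun j _ => h j
    have h0 : aker (c j (k j)) (k j) (x j) (z j) = 0 := by
      unfold aker
      rw [Set.indicator_of_notMem hj]
    rw [Finset.prod_eq_zero (f := fun j => aker (c j (k j)) (k j) (x j) (z j))
      (Finset.mem_univ j) h0]
    ring

lemma integrable_mul_prod_aker {f : X n Nd → ℝ} (hf : Integrable f) (a : ∀ j, Fin (Nd j) → ℝ)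
    (k : Fin n → ℤ) (x : X n Nd) :
    Integrable fun z => f z * ∏ j, aker (a j) (k j) (x j) (z j) := by
  refine hf.mul_bdd (c := ∏ j, (((2 : ℝ) ^ (k j)) ^ (Nd j))⁻¹) ?_ (ae_of_all _ fun z => ?_)
  · refine (Finset.measurable_prod _ fun j _ => ?_).aestronglyMeasurable
    have : Measurable fun z => aker (a j) (k j) (x j) z :=
      measurable_const.indicator (measurableSet_dcube _ _ _)
    exact this.comp (measurable_pi_apply j)
  · rw [Real.norm_eq_abs, Finset.abs_prod]
    exact Finset.prod_le_prod (fun j _ => abs_nonneg _) fun j _ => abs_aker_le _ _ _ _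

lemma kerT_eq_sum (ω : RSpace N) (k : ℤ) (x z : Fin N → ℝ) :
    kerT ω k x z = ∑ b : Bool, (if b then 1 else -1) *
      aker (randOffset ω (k - if b then 1 else 0)) (k - if b then 1 else 0) x z := by
  simp [kerT, sub_eq_add_neg]

lemma rmdiff_eq_integral {f : X n Nd → ℝ} (hf : Integrable f) (ω : PSpace n Nd) (k : Fin n → ℤ)
    (x : X n Nd) :
    rmdiff n Nd (fun j => randOffset (ω j)) k f x =
      ∫ z, f z * ∏ j, kerT (ω j) (k j) (x j) (z j) := by
  have e : ∀ z : X n Nd, f z * ∏ j, kerT (ω j) (k j) (x j) (z j) =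
      ∑ ε : Fin n → Bool, (-1 : ℝ) ^ (Finset.univ.filter fun j => ε j = false).card *
        (f z * ∏ j, aker (randOffset (ω j) (k j - if ε j then 1 else 0))
          (k j - if ε j then 1 else 0) (x j) (z j)) := by
    intro z
    simp only [kerT_eq_sum]
    rw [Finset.prod_univ_sum, Fintype.piFinset_univ, Finset.mul_sum]
    refine Finset.sum_congr rfl fun ε _ => ?_
    rw [Finset.prod_mul_distrib, ← mul_assoc, ← mul_assoc]
    congr 1
    rw [mul_comm]
    congr 1
    rw [Finset.prod_ite, Finset.prod_const_one, one_mul, Finset.prod_const]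
    simp
  simp only [e]
  rw [integral_finset_sum _ fun ε _ =>
    ((integrable_mul_prod_aker hf _ _ x).const_mul _)]
  unfold rmdiff
  refine Finset.sum_congr rfl fun ε _ => ?_
  rw [integral_const_mul, ravg_eq_integral]

lemma isBddKernel_piker_kerT : IsBddKernel
    (piker fun (j : Fin n) (x : Fin (Nd j) → ℝ) (q : RSpace (Nd j) × ℤ) z => kerT q.1 q.2 x z) :=
  IsBddKernel.piker fun j => isBddKernel_kerT (Nd j)

lemma lintegral_rSsq_eq {f : X n Nd → ℝ} (hf : Integrable f) (hfm : Measurable f) (x : X n Nd) :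
    ∫⁻ ω, rSsq n Nd (fun j => randOffset (ω j)) f x ∂prodRandMeasure n Nd =
      sqf (Measure.dirac ()) (Measure.pi fun j => tm (Nd j))
        (piker fun (j : Fin n) (x : Fin (Nd j) → ℝ) (q : RSpace (Nd j) × ℤ) z =>
          kerT q.1 q.2 x z) (fun _ => f) x := by
  have hg : Measurable (Function.uncurry fun _ : Unit => f) := hfm.comp measurable_snd
  have hm := (isBddKernel_piker_kerT (Nd := Nd)).measurable_integrand hg x
  have h9 := hm.comp (measurable_prodMk_left (x := ()))
  simp only [Function.comp_def] at h9
  unfold sqf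
  rw [lintegral_dirac, lintegral_pi_tm h9]
  refine lintegral_congr fun ω => tsum_congr fun k => ?_
  rw [rmdiff_eq_integral hf, ← enorm_pow, Real.enorm_eq_ofReal (sq_nonneg _)]
  rfl

lemma measurable_rSsq {f : X n Nd → ℝ} (hf : Integrable f) (hfm : Measurable f) :
    Measurable fun r : PSpace n Nd × X n Nd =>
      rSsq n Nd (fun j => randOffset (r.1 j)) f r.2 := by
  have hg : Measurable (Function.uncurry fun _ : Unit => f) := hfm.comp measurable_snd
  have hm := (isBddKernel_piker_kerT (Nd := Nd)).measurable_integral hg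
  unfold rSsq
  refine Measurable.ennreal_tsum fun k => ?_
  have m : Measurable fun r : PSpace n Nd × X n Nd =>
      (((), fun j => (r.1 j, k j)), r.2) := by fun_prop
  have h9 := hm.comp m
  simp only [Function.comp_def] at h9
  simp only [rmdiff_eq_integral hf]
  exact (h9.pow_const 2).ennreal_ofReal

instance : IsProbabilityMeasure (prodRandMeasure n Nd) := by
  unfold prodRandMeasure; infer_instance

lemma lintegral_sqrt_le_sqrt_lintegral {α : Type*} [MeasurableSpace α] (μ : Measure α)
    [IsProbabilityMeasure μ] {f : α → ℝ≥0∞} (hf : Measurable f) :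
    ∫⁻ a, f a ^ (1 / 2 : ℝ) ∂μ ≤ (∫⁻ a, f a ∂μ) ^ (1 / 2 : ℝ) := by
  have h := lintegral_sqrt_mul_sqrt_le (μ := μ) hf.aemeasurable
    (measurable_const (a := (1 : ℝ≥0∞))).aemeasurable
  simpa using h

lemma lintegral_lintegral_sqrt_le {α β : Type*} [MeasurableSpace α] [MeasurableSpace β]
    (μ : Measure α) [IsProbabilityMeasure μ] (ν : Measure β) [SFinite ν] {F : α → β → ℝ≥0∞}
    (hF : Measurable (Function.uncurry F)) :
    ∫⁻ a, (∫⁻ b, F a b ^ (1 / 2 : ℝ) ∂ν) ∂μ ≤ ∫⁻ b, (∫⁻ a, F a b ∂μ) ^ (1 / 2 : ℝ) ∂ν := by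
  rw [lintegral_lintegral_swap (f := fun a b => F a b ^ (1 / 2 : ℝ))
    (hF.pow_const (1 / 2 : ℝ)).aemeasurable]
  refine lintegral_mono fun b => ?_
  have h := hF.comp (measurable_prodMk_right (y := b))
  simp only [Function.comp_def] at h
  exact lintegral_sqrt_le_sqrt_lintegral _ h

lemma lintegral_lintegral_sqrt_rSsq_le {f : X n Nd → ℝ} (hf : Integrable f) (hfm : Measurable f) :
    ∫⁻ ω, (∫⁻ x, (rSsq n Nd (fun j => randOffset (ω j)) f x) ^ (1 / 2 : ℝ))
        ∂prodRandMeasure n Nd ≤ randProdSNorm n Nd f :=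
  lintegral_lintegral_sqrt_le (prodRandMeasure n Nd) volume
    (F := fun ω x => rSsq n Nd (fun j => randOffset (ω j)) f x) (measurable_rSsq hf hfm)

lemma measurableSet_prodCone (x : X n Nd) : MeasurableSet (prodCone n Nd x) := by
  unfold prodCone
  rw [Set.setOf_forall]
  refine MeasurableSet.iInter fun j => ?_
  have h9 := measurableSet_cone.preimage
    (measurable_prodMk_left (x := x j) (β := (Fin (Nd j) → ℝ) × ℝ))
  exact h9.preimage (measurable_pi_apply j)

lemma sqf_piker_conk (f : X n Nd → ℝ) (x : X n Nd) :
    sqf (Measure.dirac ()) (Measure.pi fun j => (volume : Measure ((Fin (Nd j) → ℝ) × ℝ)))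
        (piker fun (j : Fin n) => conk (N := Nd j)) (fun _ => f) x =
      ∫⁻ p in prodCone n Nd x, ENNReal.ofReal
        ((∫ z, f z * ∏ j, pkt (Nd j) ((p j).1 - z j) (p j).2) ^ 2 *
          ∏ j, (p j).2 ^ (1 - (Nd j : ℝ))) := by
  unfold sqf
  rw [lintegral_dirac, ← lintegral_indicator (measurableSet_prodCone x), volume_pi]
  refine lintegral_congr fun p => ?_
  by_cases hp : p ∈ prodCone n Nd x
  · rw [Set.indicator_of_mem hp, ← enorm_pow, Real.enorm_eq_ofReal (sq_nonneg _)]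
    congr 1
    have e : ∀ z : X n Nd, f z * piker (fun (j : Fin n) => conk (N := Nd j)) x p z =
        (∏ j, (p j).2 ^ ((1 - (Nd j : ℝ)) / 2)) *
          (f z * ∏ j, pkt (Nd j) ((p j).1 - z j) (p j).2) := by
      intro z
      unfold piker
      rw [mul_left_comm, ← Finset.prod_mul_distrib]
      congr 1
      refine Finset.prod_congr rfl fun j _ => ?_
      unfold conk
      beta_reduce
      rw [Set.indicator_of_mem (by exact hp j)]
    simp only [e]
    rw [integral_const_mul, mul_pow, mul_comm, ← Finset.prod_pow]
    congr 1
    refine Finset.prod_congr rfl fun j _ => ?_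
    have ht : 0 < (p j).2 := (Real.sqrt_nonneg _).trans_lt (hp j)
    rw [← Real.rpow_natCast (_ ^ _) 2, ← Real.rpow_mul ht.le]
    congr 1
    push_cast
    ring
  · rw [Set.indicator_of_notMem hp]
    obtain ⟨j, hj⟩ : ∃ j, ¬ Real.sqrt (∑ i, ((p j).1 i - x j i) ^ 2) < (p j).2 := by
      by_contra! h
      exact hp h
    have e : ∀ z : X n Nd, piker (fun (j : Fin n) => conk (N := Nd j)) x p z = 0 := by
      intro z
      unfold piker
      refine Finset.prod_eq_zero (Finset.mem_univ j) ?_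
      unfold conk
      beta_reduce
      rw [Set.indicator_of_notMem (by exact hj)]
    simp [e]

end Rect

section ParametricSmooth

open scoped ContDiff

variable {Z E A : Type} [TopologicalSpace Z] [SecondCountableTopology Z] [MeasurableSpace Z]
  [OpensMeasurableSpace Z] {μ : Measure Z}
  [NormedAddCommGroup E] [NormedSpace ℝ E]
  [NormedAddCommGroup A] [NormedSpace ℝ A] [ProperSpace A]

/-- A continuous family of coordinates `Φ z : E → A` on the open set `U`, locally bounded
uniformly in the parameter `z`, whose derivative is a smooth function `V` of the coordinates. -/
structure IsCoordFamily (U : Set E) (Φ : Z → E → A) (V : A → E →L[ℝ] A) : Prop where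
  isOpen : IsOpen U
  contDiff : ContDiff ℝ ∞ V
  continuous : ∀ p ∈ U, Continuous fun z => Φ z p
  bounded : ∀ p ∈ U, ∃ R, ∀ᶠ q in 𝓝 p, ∀ z, ‖Φ z q‖ ≤ R
  hasFDerivAt : ∀ z, ∀ p ∈ U, HasFDerivAt (Φ z) (V (Φ z p)) p

variable {U : Set E} {Φ : Z → E → A} {V : A → E →L[ℝ] A}

lemma IsCoordFamily.contDiff_fderiv_comp (h : IsCoordFamily U Φ V) {F : Type}
    [NormedAddCommGroup F] [NormedSpace ℝ F] {G : A → F} (hG : ContDiff ℝ ∞ G) :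
    ContDiff ℝ ∞ fun a => (fderiv ℝ G a).comp (V a) :=
  (hG.fderiv_right (m := ∞) (by simp)).clm_comp h.contDiff

lemma IsCoordFamily.hasFDerivAt_integral (h : IsCoordFamily U Φ V) {F : Type}
    [NormedAddCommGroup F] [NormedSpace ℝ F] [SecondCountableTopology F]
    [SecondCountableTopology (E →L[ℝ] F)] {G : A → F}
    (hG : ContDiff ℝ ∞ G) {f : Z → ℝ} (hf : Integrable f μ) {p : E} (hp : p ∈ U) :
    HasFDerivAt (fun q => ∫ z, f z • G (Φ z q) ∂μ)
      (∫ z, f z • (fderiv ℝ G (Φ z p)).comp (V (Φ z p)) ∂μ) p := by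
  have hG' := h.contDiff_fderiv_comp hG
  obtain ⟨R, hR⟩ := h.bounded p hp
  obtain ⟨C, hC⟩ := (isCompact_closedBall (0 : A) R).exists_bound_of_continuousOn
    hG.continuous.continuousOn
  obtain ⟨C', hC'⟩ := (isCompact_closedBall (0 : A) R).exists_bound_of_continuousOn
    hG'.continuous.continuousOn
  have hs : {q | q ∈ U ∧ ∀ z, ‖Φ z q‖ ≤ R} ∈ 𝓝 p := (h.isOpen.eventually_mem hp).and hR
  have hmeas : ∀ q ∈ U, AEStronglyMeasurable (fun z => f z • G (Φ z q)) μ := fun q hq =>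
    hf.aestronglyMeasurable.smul (hG.continuous.comp (h.continuous q hq)).aestronglyMeasurable
  refine hasFDerivAt_integral_of_dominated_of_fderiv_le (bound := fun z => ‖f z‖ * C')
    (F' := fun q z => f z • (fderiv ℝ G (Φ z q)).comp (V (Φ z q))) hs
    ((h.isOpen.eventually_mem hp).mono hmeas) ?_
    (hf.aestronglyMeasurable.smul (hG'.continuous.comp (h.continuous p hp)).aestronglyMeasurable)
    (Eventually.of_forall fun z q hq => ?_) (hf.norm.mul_const _)
    (Eventually.of_forall fun z q hq => ?_)
  · refine (hf.norm.mul_const C).mono' (hmeas p hp) (Eventually.of_forall fun z => ?_)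
    rw [norm_smul]
    exact mul_le_mul_of_nonneg_left (hC _ (by simpa using hR.self_of_nhds z)) (norm_nonneg _)
  · rw [norm_smul]
    exact mul_le_mul_of_nonneg_left (hC' _ (by simpa using hq.2 z)) (norm_nonneg _)
  · exact (((hG.differentiable (by simp) _).hasFDerivAt).comp q
      (h.hasFDerivAt z q hq.1)).const_smul (f z)

lemma IsCoordFamily.contDiffOn_integral (h : IsCoordFamily U Φ V) [FiniteDimensional ℝ E]
    {f : Z → ℝ} (hf : Integrable f μ) (m : ℕ) :
    ∀ (F : Type) [NormedAddCommGroup F] [NormedSpace ℝ F] [FiniteDimensional ℝ F] (G : A → F),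
      ContDiff ℝ ∞ G → ContDiffOn ℝ m (fun q => ∫ z, f z • G (Φ z q) ∂μ) U := by
  induction m with
  | zero =>
    intro F _ _ _ G hG
    have := FiniteDimensional.proper_real F
    have := FiniteDimensional.proper_real (E →L[ℝ] F)
    exact contDiffOn_zero.2 fun p hp =>
      (h.hasFDerivAt_integral hG hf hp).continuousAt.continuousWithinAt
  | succ m ih =>
    intro F _ _ _ G hG
    have := FiniteDimensional.proper_real F
    have := FiniteDimensional.proper_real (E →L[ℝ] F)
    push_cast
    rw [contDiffOn_succ_iff_fderiv_of_isOpen h.isOpen]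
    refine ⟨fun p hp => (h.hasFDerivAt_integral hG hf hp).differentiableAt.differentiableWithinAt,
      fun hm => absurd hm (by simp), ?_⟩
    exact (ih _ _ (h.contDiff_fderiv_comp hG)).congr fun p hp =>
      (h.hasFDerivAt_integral hG hf hp).fderiv

lemma IsCoordFamily.fderiv_integral_apply (h : IsCoordFamily U Φ V) [FiniteDimensional ℝ E]
    {f : Z → ℝ} (hf : Integrable f μ) {G : A → ℝ} (hG : ContDiff ℝ ∞ G) {p : E} (hp : p ∈ U)
    (v : E) :
    fderiv ℝ (fun q => ∫ z, f z • G (Φ z q) ∂μ) p v =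
      ∫ z, f z • fderiv ℝ G (Φ z p) (V (Φ z p) v) ∂μ := by
  have := FiniteDimensional.proper_real (E →L[ℝ] ℝ)
  rw [(h.hasFDerivAt_integral hG hf hp).fderiv, ContinuousLinearMap.integral_apply]
  · rfl
  have hG' := h.contDiff_fderiv_comp hG
  obtain ⟨R, hR⟩ := h.bounded p hp
  obtain ⟨C', hC'⟩ := (isCompact_closedBall (0 : A) R).exists_bound_of_continuousOn
    hG'.continuous.continuousOn
  refine (hf.norm.mul_const C').mono' (hf.aestronglyMeasurable.smul
    (hG'.continuous.comp (h.continuous p hp)).aestronglyMeasurable)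
    (Eventually.of_forall fun z => ?_)
  rw [norm_smul]
  exact mul_le_mul_of_nonneg_left (hC' _ (by simpa using hR.self_of_nhds z)) (norm_nonneg _)

/-- Iterated derivatives of `∫ f z • G (Φ z q)` are computed under the integral sign. -/
lemma IsCoordFamily.iteratedFDeriv_integral (h : IsCoordFamily U Φ V) [FiniteDimensional ℝ E]
    {f : Z → ℝ} (hf : Integrable f μ) {G : A → ℝ} (hG : ContDiff ℝ ∞ G) {m : ℕ}
    (w : Fin (m + 1) → E) {H : A → ℝ} (hH : ContDiff ℝ ∞ H)
    (hi : ∀ q ∈ U, iteratedFDeriv ℝ m (fun q => ∫ z, f z • G (Φ z q) ∂μ) q (Fin.tail w) =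
      ∫ z, f z • H (Φ z q) ∂μ) {p : E} (hp : p ∈ U) :
    iteratedFDeriv ℝ (m + 1) (fun q => ∫ z, f z • G (Φ z q) ∂μ) p w =
      ∫ z, f z • fderiv ℝ H (Φ z p) (V (Φ z p) (w 0)) ∂μ := by
  rw [iteratedFDeriv_succ_apply_left, ← h.fderiv_integral_apply hf hH hp]
  have hc : ContDiffAt ℝ ((m + 1 : ℕ) : ℕ∞) (fun q => ∫ z, f z • G (Φ z q) ∂μ) p :=
    (h.contDiffOn_integral hf (m + 1) ℝ G hG).contDiffAt (h.isOpen.mem_nhds hp)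
  have hd : DifferentiableAt ℝ (iteratedFDeriv ℝ m (fun q => ∫ z, f z • G (Φ z q) ∂μ)) p :=
    hc.differentiableAt_iteratedFDeriv (by exact_mod_cast Nat.lt_succ_self m)
  have he : (fun q => iteratedFDeriv ℝ m (fun q => ∫ z, f z • G (Φ z q) ∂μ) q (Fin.tail w))
      =ᶠ[𝓝 p] fun q => ∫ z, f z • H (Φ z q) ∂μ :=
    (h.isOpen.eventually_mem hp).mono hi
  rw [← he.fderiv_eq]
  rw [show fderiv ℝ (fun q => iteratedFDeriv ℝ m (fun q => ∫ z, f z • G (Φ z q) ∂μ) q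
    (Fin.tail w)) p = _ from ((hd.hasFDerivAt).continuousMultilinear_apply_const _).fderiv]
  rfl

end ParametricSmooth

section PoissonCoord

open scoped ContDiff

variable {N : ℕ}

/-- The homogeneous coordinates `(q / |q|, 1 / |q|)` of a point of the upper half-space. -/
def poiCoord (q : (Fin N → ℝ) × ℝ) : ((Fin N → ℝ) × ℝ) × ℝ := (ih q.1 q.2 • q, ih q.1 q.2)

/-- The Euclidean pairing with `a`. -/
def euclPair (a : (Fin N → ℝ) × ℝ) : ((Fin N → ℝ) × ℝ) →L[ℝ] ℝ :=
  (∑ i, a.1 i • (ContinuousLinearMap.proj i).comp (ContinuousLinearMap.fst ℝ (Fin N → ℝ) ℝ)) +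
    a.2 • ContinuousLinearMap.snd ℝ (Fin N → ℝ) ℝ

lemma euclPair_apply (a v : (Fin N → ℝ) × ℝ) :
    euclPair a v = ∑ i, a.1 i * v.1 i + a.2 * v.2 := by
  simp [euclPair, ContinuousLinearMap.sum_apply]

/-- The derivative of `poiCoord`, in terms of its value. -/
def poiCoordDeriv (b : ((Fin N → ℝ) × ℝ) × ℝ) :
    ((Fin N → ℝ) × ℝ) →L[ℝ] ((Fin N → ℝ) × ℝ) × ℝ :=
  (b.2 • ContinuousLinearMap.id ℝ _ - (b.2 • euclPair b.1).smulRight b.1).prod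
    (-(b.2 ^ 2 • euclPair b.1))

lemma hasFDerivAt_ih_prod {q : (Fin N → ℝ) × ℝ} (hq : 0 < q.2) :
    HasFDerivAt (fun q : (Fin N → ℝ) × ℝ => ih q.1 q.2)
      (-(ih q.1 q.2 ^ 3 • euclPair q)) q := by
  have hs : HasFDerivAt (fun q : (Fin N → ℝ) × ℝ => (∑ i, q.1 i ^ 2) + q.2 ^ 2)
      ((2 : ℝ) • euclPair q) q := by
    have h1 : ∀ i, HasFDerivAt (fun q : (Fin N → ℝ) × ℝ => q.1 i ^ 2)
        ((2 * q.1 i) • (ContinuousLinearMap.proj i).comp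
          (ContinuousLinearMap.fst ℝ (Fin N → ℝ) ℝ)) q := fun i => by
      have h := ((ContinuousLinearMap.proj (R := ℝ) (φ := fun _ : Fin N => ℝ) i).comp
        (ContinuousLinearMap.fst ℝ (Fin N → ℝ) ℝ)).hasFDerivAt (x := q)
      simpa using h.pow 2
    have h2 : HasFDerivAt (fun q : (Fin N → ℝ) × ℝ => q.2 ^ 2)
        ((2 * q.2) • ContinuousLinearMap.snd ℝ (Fin N → ℝ) ℝ) q := by
      have h := (ContinuousLinearMap.snd ℝ (Fin N → ℝ) ℝ).hasFDerivAt (x := q)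
      simpa using h.pow 2
    refine ((HasFDerivAt.fun_sum fun i (_ : i ∈ Finset.univ) => h1 i).add h2).congr_fderiv ?_
    simp only [euclPair, smul_add, Finset.smul_sum, smul_smul]
  have hpos := ssq_add_pos q.1 hq
  have hd : HasDerivAt (fun s : ℝ => (√s)⁻¹) (-(2⁻¹ * ih q.1 q.2 ^ 3))
      ((∑ i, q.1 i ^ 2) + q.2 ^ 2) := by
    refine ((Real.hasDerivAt_sqrt hpos.ne').inv (Real.sqrt_pos.2 hpos).ne').congr_deriv ?_
    have h0 := (Real.sqrt_pos.2 hpos).ne'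
    unfold ih
    field_simp
  refine (hd.comp_hasFDerivAt q hs).congr_fderiv ?_
  refine ContinuousLinearMap.ext fun v => ?_
  simp only [ContinuousLinearMap.smul_apply, ContinuousLinearMap.neg_apply, smul_eq_mul]
  ring

lemma hasFDerivAt_poiCoord {q : (Fin N → ℝ) × ℝ} (hq : 0 < q.2) :
    HasFDerivAt poiCoord (poiCoordDeriv (poiCoord q)) q := by
  have h := hasFDerivAt_ih_prod hq
  refine ((h.smul (hasFDerivAt_id q)).prodMk h).congr_fderiv ?_
  have e : euclPair (ih q.1 q.2 • q) = ih q.1 q.2 • euclPair q :=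
    ContinuousLinearMap.ext fun v => by
      simp [euclPair_apply, Finset.mul_sum, mul_add, mul_assoc]
  refine ContinuousLinearMap.ext fun v => Prod.ext ?_ ?_
  · simp only [poiCoordDeriv, poiCoord, e, ContinuousLinearMap.prod_apply,
      ContinuousLinearMap.add_apply, ContinuousLinearMap.sub_apply, ContinuousLinearMap.smul_apply,
      ContinuousLinearMap.smulRight_apply, ContinuousLinearMap.neg_apply,
      ContinuousLinearMap.id_apply, id, smul_eq_mul, neg_smul, smul_smul, sub_eq_add_neg]
    congr 3
    ring
  · simp only [poiCoordDeriv, poiCoord, e, ContinuousLinearMap.prod_apply,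
      ContinuousLinearMap.smul_apply, ContinuousLinearMap.neg_apply, smul_eq_mul]
    ring

lemma contDiff_poiCoordDeriv_apply (v : (Fin N → ℝ) × ℝ) :
    ContDiff ℝ ∞ fun b : ((Fin N → ℝ) × ℝ) × ℝ => poiCoordDeriv b v := by
  have h : ContDiff ℝ ∞ fun b : ((Fin N → ℝ) × ℝ) × ℝ => euclPair b.1 v := by
    simp only [euclPair_apply]
    fun_prop
  have e : ∀ b : ((Fin N → ℝ) × ℝ) × ℝ, poiCoordDeriv b v =
      (b.2 • v - (b.2 * euclPair b.1 v) • b.1, -(b.2 ^ 2 * euclPair b.1 v)) := fun b => by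
    simp [poiCoordDeriv]
  simp only [e]
  fun_prop

lemma norm_poiCoord_le {q : (Fin N → ℝ) × ℝ} (hq : 0 < q.2) :
    ‖poiCoord q‖ ≤ 2 + 2 * q.2⁻¹ := by
  have h0 := ih_nonneg q.1 q.2
  have h1 := ih_le q.1 hq
  have hn := norm_nonneg q.1
  have hi : 0 < q.2⁻¹ := inv_pos.2 hq
  have h2 : ‖q‖ ≤ ‖q.1‖ + q.2 := by
    rw [Prod.norm_def, Real.norm_of_nonneg hq.le]
    exact max_le (by linarith) (by linarith)
  unfold poiCoord
  rw [Prod.norm_def]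
  refine max_le ?_ ?_
  · rw [norm_smul, Real.norm_of_nonneg h0]
    have : ih q.1 q.2 * ‖q‖ ≤ 2 * (‖q.1‖ + q.2)⁻¹ * (‖q.1‖ + q.2) :=
      mul_le_mul h1 h2 (norm_nonneg _) (by positivity)
    rw [mul_assoc, inv_mul_cancel₀ (by positivity)] at this
    linarith
  · rw [Real.norm_of_nonneg h0]
    have : (‖q.1‖ + q.2)⁻¹ ≤ q.2⁻¹ := inv_anti₀ hq (by linarith)
    linarith

variable {n : ℕ} {Nd : Fin n → ℕ}

/-- The product of the upper half-spaces. -/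
def halfSpaces (n : ℕ) (Nd : Fin n → ℕ) : Set (W n Nd) := {p | ∀ j, 0 < (p j).2}

/-- The homogeneous coordinates of `p - z` in each factor. -/
def prodCoord (z : X n Nd) (p : W n Nd) : Π j, ((Fin (Nd j) → ℝ) × ℝ) × ℝ :=
  fun j => poiCoord ((p j).1 - z j, (p j).2)

lemma isCoordFamily_prodCoord : IsCoordFamily (halfSpaces n Nd) (prodCoord (Nd := Nd))
    (fun b => ContinuousLinearMap.pi fun j =>
      (poiCoordDeriv (b j)).comp (ContinuousLinearMap.proj j)) where
  isOpen := by
    unfold halfSpaces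
    rw [Set.setOf_forall]
    exact isOpen_iInter_of_finite fun j => isOpen_lt continuous_const (by fun_prop)
  contDiff := by
    rw [contDiff_clm_apply_iff]
    intro v
    rw [contDiff_pi]
    intro j
    exact (contDiff_poiCoordDeriv_apply (v j)).comp
      (ContinuousLinearMap.proj (R := ℝ)
        (φ := fun j : Fin n => ((Fin (Nd j) → ℝ) × ℝ) × ℝ) j).contDiff
  continuous p hp := by
    refine continuous_pi fun j => ?_
    rw [continuous_iff_continuousAt]
    intro z
    exact ContinuousAt.comp (g := poiCoord) (f := fun z : X n Nd => ((p j).1 - z j, (p j).2))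
      (hasFDerivAt_poiCoord (q := ((p j).1 - z j, (p j).2)) (hp j)).continuousAt
      ((continuous_const.sub (continuous_apply j)).prodMk continuous_const).continuousAt
  bounded p hp := by
    have hc : ∀ᶠ q in 𝓝 p, ∀ j, (p j).2 / 2 < (q j).2 := by
      rw [eventually_all]
      intro j
      have : ContinuousAt (fun q : W n Nd => (q j).2) p :=
        (continuous_apply j).snd.continuousAt
      exact this.eventually_const_lt (half_lt_self (hp j))
    refine ⟨∑ j, (2 + 2 * ((p j).2 / 2)⁻¹), hc.mono fun q hq z => ?_⟩
    have h0 : ∀ j, 0 < 2 + 2 * ((p j).2 / 2)⁻¹ := fun j => by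
      have := hp j
      positivity
    rw [pi_norm_le_iff_of_nonneg (Finset.sum_nonneg fun j _ => (h0 j).le)]
    intro j
    have hj : 0 < (p j).2 / 2 := half_pos (hp j)
    refine (norm_poiCoord_le (q := ((q j).1 - z j, (q j).2)) (hj.trans (hq j))).trans ?_
    refine le_trans ?_ (Finset.single_le_sum (fun j _ => (h0 j).le) (Finset.mem_univ j))
    have := inv_anti₀ hj (hq j).le
    simp only
    linarith
  hasFDerivAt z p hp := by
    refine hasFDerivAt_pi.2 fun j => ?_
    have h1 : HasFDerivAt (fun p : W n Nd => ((p j).1 - z j, (p j).2))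
        (ContinuousLinearMap.proj (R := ℝ)
          (φ := fun j : Fin n => (Fin (Nd j) → ℝ) × ℝ) j) p := by
      have h := (ContinuousLinearMap.proj (R := ℝ)
        (φ := fun j : Fin n => (Fin (Nd j) → ℝ) × ℝ) j).hasFDerivAt (x := p)
      exact h.sub_const (z j, 0) |>.congr_of_eventuallyEq
        (Eventually.of_forall fun p => by simp [Prod.ext_iff])
    exact (hasFDerivAt_poiCoord (q := ((p j).1 - z j, (p j).2)) (hp j)).comp p h1

end PoissonCoord

section MixedDerivative

open scoped ContDiff

variable {n : ℕ} {Nd : Fin n → ℕ}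

/-- The unit vector in the `t_j`-direction. -/
def tDir (Nd : Fin n → ℕ) (j : Fin n) : W n Nd := Pi.single j (0, 1)

open Classical in
/-- The product of the Poisson kernels centred at `z`, differentiated in `t_j` for `j ∈ S`. -/
def mixedPk (S : Finset (Fin n)) (z : X n Nd) (p : W n Nd) : ℝ :=
  ∏ k, (if k ∈ S then pkt (Nd k) else pk (Nd k)) ((p k).1 - z k) (p k).2

open Classical in
lemma hasDerivAt_mixedPk {S : Finset (Fin n)} {j : Fin n} (hj : j ∉ S) (z : X n Nd) {p : W n Nd}
    (hp : p ∈ halfSpaces n Nd) :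
    HasDerivAt (fun s : ℝ => mixedPk S z (p + s • tDir Nd j)) (mixedPk (insert j S) z p) 0 := by
  unfold mixedPk
  have hk : ∀ k ∈ Finset.univ.erase j, ∀ s : ℝ, (p + s • tDir Nd j) k = p k := fun k hk s => by
    simp [tDir, Finset.ne_of_mem_erase hk]
  have e1 : ∀ s : ℝ, (p + s • tDir Nd j) j = ((p j).1, (p j).2 + s) := fun s => by
    simp [tDir, Prod.ext_iff]
  have hd : HasDerivAt (fun s : ℝ => pk (Nd j) ((p j).1 - z j) ((p j).2 + s))
      (pkt (Nd j) ((p j).1 - z j) (p j).2) 0 := by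
    have h := hasDerivAt_pk ((p j).1 - z j) (hp j)
    rw [← add_zero (p j).2] at h
    simpa using h.comp_const_add (p j).2 0
  refine ((hd.mul_const (∏ k ∈ Finset.univ.erase j, (if k ∈ S then pkt (Nd k) else pk (Nd k))
    ((p k).1 - z k) (p k).2)).congr_deriv ?_).congr_of_eventuallyEq
    (Eventually.of_forall fun s => ?_)
  · rw [← Finset.mul_prod_erase _ _ (Finset.mem_univ j), if_pos (Finset.mem_insert_self j S)]
    congr 1
    refine Finset.prod_congr rfl fun k hk => ?_
    simp only [Finset.mem_insert, Finset.ne_of_mem_erase hk, false_or]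
  · beta_reduce
    rw [← Finset.mul_prod_erase _ _ (Finset.mem_univ j), if_neg hj, e1]
    congr 1
    refine Finset.prod_congr rfl fun k hk' => ?_
    rw [hk k hk']

/-- The Poisson kernel as a function of the homogeneous coordinates. -/
lemma pk_eq_poiCoord {N : ℕ} (y : Fin N → ℝ) (t : ℝ) :
    pk N y t = poiC N * ((poiCoord (y, t)).1.2 * (poiCoord (y, t)).2 ^ N) := by
  rw [pk_eq_ih]
  simp only [poiCoord, Prod.smul_mk, smul_eq_mul]
  ring

lemma prodPoisson_eq (f : X n Nd → ℝ) : prodPoisson n Nd f = fun p =>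
    ∫ z, f z • ∏ j, poiC (Nd j) * ((prodCoord z p j).1.2 * (prodCoord z p j).2 ^ Nd j) := by
  funext p
  simp only [prodPoisson, pk_eq_poiCoord, prodCoord, smul_eq_mul]

open Classical in
lemma exists_iteratedFDeriv_prodPoisson {f : X n Nd → ℝ} (hf : Integrable f) (m : ℕ)
    (σ : Fin m → Fin n) (hσ : Function.Injective σ) :
    ∃ H : (Π j, ((Fin (Nd j) → ℝ) × ℝ) × ℝ) → ℝ, ContDiff ℝ ∞ H ∧
      (∀ z, ∀ p ∈ halfSpaces n Nd, H (prodCoord z p) =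
        mixedPk (Finset.univ.image σ) z p) ∧
      ∀ p ∈ halfSpaces n Nd, iteratedFDeriv ℝ m (prodPoisson n Nd f) p (fun i => tDir Nd (σ i)) =
        ∫ z, f z • H (prodCoord z p) := by
  have hG : ContDiff ℝ ∞ fun b : Π j, ((Fin (Nd j) → ℝ) × ℝ) × ℝ =>
      ∏ j, poiC (Nd j) * ((b j).1.2 * (b j).2 ^ Nd j) := by
    refine contDiff_prod fun j _ => ?_
    have h : ContDiff ℝ ∞ fun b : ((Fin (Nd j) → ℝ) × ℝ) × ℝ =>
        poiC (Nd j) * (b.1.2 * b.2 ^ Nd j) := by fun_prop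
    exact h.comp (ContinuousLinearMap.proj (R := ℝ)
      (φ := fun j : Fin n => ((Fin (Nd j) → ℝ) × ℝ) × ℝ) j).contDiff
  induction m with
  | zero =>
    refine ⟨_, hG, fun z p _ => ?_, fun p _ => ?_⟩
    · simp [mixedPk, pk_eq_poiCoord, prodCoord]
    · rw [iteratedFDeriv_zero_apply, prodPoisson_eq]
  | succ m ih =>
    obtain ⟨H, hH, h1, h2⟩ := ih (fun i => σ i.succ)
      (hσ.comp (Fin.succ_injective m))
    have hc := isCoordFamily_prodCoord (Nd := Nd)
    refine ⟨fun b => fderiv ℝ H b (ContinuousLinearMap.pi (fun j =>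
      (poiCoordDeriv (b j)).comp (ContinuousLinearMap.proj j)) (tDir Nd (σ 0))),
      (hc.contDiff_fderiv_comp hH).clm_apply contDiff_const, fun z p hp => ?_, fun p hp => ?_⟩
    · have hj : σ 0 ∉ Finset.univ.image fun i : Fin m => σ i.succ := by
        simp only [Finset.mem_image, Finset.mem_univ, true_and, not_exists]
        exact fun i hi => Fin.succ_ne_zero i (hσ hi)
      have hS : Finset.univ.image σ = insert (σ 0) (Finset.univ.image fun i : Fin m => σ i.succ) := by
        ext k
        simp [Fin.exists_fin_succ, eq_comm]
      rw [hS]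
      refine HasDerivAt.unique ?_ (hasDerivAt_mixedPk hj z hp)
      have hl : HasDerivAt (fun s : ℝ => p + s • tDir Nd (σ 0)) (tDir Nd (σ 0)) 0 := by
        simpa using ((hasDerivAt_id (0 : ℝ)).smul_const (tDir Nd (σ 0))).const_add p
      have hp0 : p + (0 : ℝ) • tDir Nd (σ 0) = p := by simp
      have hF : HasFDerivAt (fun q => H (prodCoord z q)) _ (p + (0 : ℝ) • tDir Nd (σ 0)) :=
        ((hH.differentiable (by simp) _).hasFDerivAt).comp _
          (hc.hasFDerivAt z _ (hp0.symm ▸ hp))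
      have h3 := hF.comp_hasDerivAt (0 : ℝ) hl
      rw [hp0] at h3
      refine h3.congr_of_eventuallyEq ?_
      have ht : Tendsto (fun s : ℝ => p + s • tDir Nd (σ 0)) (𝓝 0) (𝓝 p) := by
        simpa using hl.continuousAt.tendsto
      filter_upwards [ht.eventually (hc.isOpen.eventually_mem hp)] with s hs
      exact (h1 z _ hs).symm
    · rw [prodPoisson_eq] at h2 ⊢
      exact hc.iteratedFDeriv_integral hf hG (fun i => tDir Nd (σ i)) hH h2 hp

lemma iteratedFDeriv_prodPoisson {f : X n Nd → ℝ} (hf : Integrable f) {p : W n Nd}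
    (hp : p ∈ halfSpaces n Nd) :
    iteratedFDeriv ℝ n (prodPoisson n Nd f) p (tDir Nd) =
      ∫ z, f z * ∏ j, pkt (Nd j) ((p j).1 - z j) (p j).2 := by
  obtain ⟨H, _, h1, h2⟩ := exists_iteratedFDeriv_prodPoisson hf n id Function.injective_id
  refine (h2 p hp).trans (integral_congr_ae (Eventually.of_forall fun z => ?_))
  beta_reduce
  rw [h1 z p hp, smul_eq_mul]
  simp [mixedPk]

lemma sq_integral_pkt_le_mixedGradSq {f : X n Nd → ℝ} (hf : Integrable f) {p : W n Nd}
    (hp : p ∈ halfSpaces n Nd) :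
    (∫ z, f z * ∏ j, pkt (Nd j) ((p j).1 - z j) (p j).2) ^ 2 ≤
      mixedGradSq n Nd (prodPoisson n Nd f) p := by
  have e : (fun j => dirW n Nd j (Fin.last (Nd j))) = tDir Nd := by
    funext j
    simp [dirW, tDir]
  rw [← iteratedFDeriv_prodPoisson hf hp, ← e]
  exact Finset.single_le_sum (f := fun d : Π j : Fin n, Fin (Nd j + 1) =>
    (iteratedFDeriv ℝ n (prodPoisson n Nd f) p fun j => dirW n Nd j (d j)) ^ 2)
    (fun _ _ => sq_nonneg _) (Finset.mem_univ fun j => Fin.last (Nd j))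

lemma sqf_piker_conk_le_lusinSq {f : X n Nd → ℝ} (hf : Integrable f) (x : X n Nd) :
    sqf (Measure.dirac ()) (Measure.pi fun j => (volume : Measure ((Fin (Nd j) → ℝ) × ℝ)))
        (piker fun (j : Fin n) => conk (N := Nd j)) (fun _ => f) x ≤ lusinSq n Nd f x := by
  rw [sqf_piker_conk]
  refine setLIntegral_mono' (measurableSet_prodCone x) fun p hp => ?_
  have ht : ∀ j, 0 < (p j).2 := fun j => (Real.sqrt_nonneg _).trans_lt (hp j)
  exact ENNReal.ofReal_le_ofReal (mul_le_mul_of_nonneg_right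
    (sq_integral_pkt_le_mixedGradSq hf ht)
    (Finset.prod_nonneg fun j _ => Real.rpow_nonneg (ht j).le _))

end MixedDerivative

section Final

variable {n : ℕ} {Nd : Fin n → ℕ}

lemma rSsq_congr_ae (c : Π j : Fin n, ℤ → Fin (Nd j) → ℝ) {f g : X n Nd → ℝ} (h : f =ᵐ[volume] g)
    (x : X n Nd) : rSsq n Nd c f x = rSsq n Nd c g x := by
  have e : ∀ k, ravg n Nd c k f x = ravg n Nd c k g x := fun k => by
    unfold ravg
    rw [integral_congr_ae (ae_restrict_of_ae h)]
  simp only [rSsq, rmdiff, e]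

lemma prodPoisson_congr_ae {f g : X n Nd → ℝ} (h : f =ᵐ[volume] g) :
    prodPoisson n Nd f = prodPoisson n Nd g := by
  funext p
  refine integral_congr_ae (h.mono fun z hz => ?_)
  simp only [hz]

lemma lusinSq_congr_ae {f g : X n Nd → ℝ} (h : f =ᵐ[volume] g) (x : X n Nd) :
    lusinSq n Nd f x = lusinSq n Nd g x := by
  simp only [lusinSq, prodPoisson_congr_ae h]

/-- The random dyadic square function, averaged in `L²` over the lattices, is controlled by the
product Lusin square function. -/
lemma exists_randProdSNorm_le (hNd : ∀ j, 0 < Nd j) : ∃ C : ℝ≥0∞, C ≠ ⊤ ∧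
    ∀ f : X n Nd → ℝ, Integrable f → Measurable f →
      randProdSNorm n Nd f ≤ C * H1prodNorm n Nd f := by
  choose C hC h using fun j => exists_dominates_kerT_conk (hNd j)
  refine ⟨∏ j, C j, ENNReal.prod_ne_top fun j _ => hC j, fun f hf hfm => ?_⟩
  have hg : Measurable (Function.uncurry fun _ : Unit => f) := hfm.comp measurable_snd
  have hd := dominates_pi (fun j => isBddKernel_kerT (Nd j)) (fun j => isBddKernel_conk (Nd j)) h
    Unit (Measure.dirac ()) (fun _ => f) hg (fun _ => hf)
  unfold randProdSNorm H1prodNorm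
  simp only [lintegral_rSsq_eq hf hfm]
  refine hd.trans (mul_le_mul_right (lintegral_mono fun x => ?_) _)
  exact ENNReal.rpow_le_rpow (sqf_piker_conk_le_lusinSq hf x) (by norm_num)

end Final

/-- **Multi-parameter analogue of (0.6)**:
`𝔼_ω ‖S_{𝒟(ω)} f‖_{L¹(X)} ≤ C ‖f‖_{H¹(X₁ × ⋯ × Xₙ)}` with `C` depending only on
`N₁, …, Nₙ`, where `S_{𝒟(ω)}` is the multi-parameter random dyadic square function. -/
theorem multiparam_davis (n : ℕ) (hn : 0 < n) (Nd : Fin n → ℕ) (hNd : ∀ j, 0 < Nd j) :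
    ∃ C : ℝ, 0 < C ∧
      ∀ f : X n Nd → ℝ, Integrable f volume → H1prodNorm n Nd f < ⊤ →
        (∫⁻ ω, (∫⁻ x, (rSsq n Nd (fun j => randOffset (ω j)) f x) ^ (1 / 2 : ℝ))
            ∂prodRandMeasure n Nd) ≤
          ENNReal.ofReal C * H1prodNorm n Nd f := by
  obtain ⟨C, hC, h⟩ := exists_randProdSNorm_le hNd
  refine ⟨C.toReal + 1, by positivity, fun f hf _ => ?_⟩
  have hfg : f =ᵐ[volume] hf.1.mk f := hf.1.ae_eq_mk
  have hg : Integrable (hf.1.mk f) := hf.congr hfg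
  have hgm : Measurable (hf.1.mk f) := hf.1.stronglyMeasurable_mk.measurable
  have hH : H1prodNorm n Nd f = H1prodNorm n Nd (hf.1.mk f) := by
    simp only [H1prodNorm, lusinSq_congr_ae hfg]
  have hC' : C ≤ ENNReal.ofReal (C.toReal + 1) := by
    rw [← ENNReal.ofReal_toReal hC, ENNReal.toReal_ofReal ENNReal.toReal_nonneg]
    exact ENNReal.ofReal_le_ofReal (by linarith)
  simp only [rSsq_congr_ae _ hfg, hH]
  exact (lintegral_lintegral_sqrt_rSsq_le hg hgm).trans
    ((h _ hg hgm).trans (mul_le_mul_left hC' _))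

end Treil
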